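/- For every 1 ≤ k ≤ min{r,t} and every a ∈ ℕ, there exists a unique element ω_{a,k} of the subalgebra BC_{k−1,k−1} of BC_{r,t} generated by e_1, s_1, …, s_{k−2}, s̄_1, …, s̄_{k−2}, c_1 and c̄_1 (interpreted as R when k = 1) such that e_k y_k^a e_k = ω_{a,k} e_k; similarly there exists a unique ω̄_{a,k} ∈ BC_{k−1,k−1} with e_k ȳ_k^a e_k = ω̄_{a,k} e_k. Moreover ω_{2n,k} = ω̄_{2n,k} = 0 for all n ∈ ℕ. -/

import Mathlib

open Polynomial

noncomputable section

/-- Transposition `(a b)` (0-based indices) in the symmetric group on `Fin n`;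
it is `1` if an index is out of range. -/
def sw (n a b : ℕ) : Equiv.Perm (Fin n) :=
  if h : a < n ∧ b < n then Equiv.swap ⟨a, h.1⟩ ⟨b, h.2⟩ else 1

/-- The permutation word `s_{i,j}` of the paper (1-based indices):
`s_{i,j} = s_i s_{i+1,j}` for `i < j`, `s_{i,i} = 1`, `s_{i,j} = s_{i,j+1} s_j` for `i > j`. -/
def sIJ (n i j : ℕ) : Equiv.Perm (Fin n) :=
  if i < j then ((List.range' i (j - i)).map (fun k => sw n (k - 1) k)).prod
  else ((List.range' j (i - j)).reverse.map (fun k => sw n (k - 1) k)).prod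

/-- The coefficients `a_{2n+1,j}` of the paper: `acoef ω n j = a_{2n+1,j}`, defined by the
recursion `a_{1,0} = -1`, `a_{2n+1,j+1} = a_{2n-1,j}` and
`a_{2n+1,0} = ∑_{j=0}^{n-1} a_{2n-1,j} ω_{2j+1}`. -/
def acoef {A : Type} [Ring A] (ω : ℕ → A) : ℕ → ℕ → A
  | 0, _ => -1
  | n + 1, 0 => ∑ j ∈ Finset.range (n + 1), acoef ω n j * ω (2 * j + 1)
  | n + 1, j + 1 => acoef ω n j

/-- The parameters `ω̄_k` determined by the parameters `ω` as in Corollary 3.5: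
`ω̄_{2n} = 0` and `ω̄_{2n+1} = ∑_{j=0}^{n} a_{2n+1,j} ω_{2j+1}`. -/
def obar {R : Type} [CommRing R] (ω : ℕ → R) (k : ℕ) : R :=
  if k % 2 = 0 then 0
  else ∑ j ∈ Finset.range (k / 2 + 1), acoef ω (k / 2) j * ω (2 * j + 1)

/-- Data for the presentation of the walled Brauer–Clifford superalgebra `BC_{r,t}`
(Definition 2.1 together with relations (2.1)–(2.3)) on an `R`-algebra `A`.
The images of the two symmetric groups are recorded as monoid homomorphisms, so the
symmetric group relations among the `s_i` (resp. `s̄_j`) hold automatically. -/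
structure WBC (R A : Type) [CommRing R] [Ring A] [Algebra R A] (r t : ℕ) : Type where
  σ : Equiv.Perm (Fin r) →* A
  σb : Equiv.Perm (Fin t) →* A
  c : Fin r → A
  cb : Fin t → A
  e : A
  c_sq : ∀ i, c i * c i = -1
  c_anti : ∀ i j, i ≠ j → c i * c j = -(c j * c i)
  c_conj : ∀ w i, σ w * c i * σ (w⁻¹) = c (w i)
  cb_sq : ∀ i, cb i * cb i = 1
  cb_anti : ∀ i j, i ≠ j → cb i * cb j = -(cb j * cb i)
  cb_conj : ∀ w i, σb w * cb i * σb (w⁻¹) = cb (w i)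
  comm_σσb : ∀ w v, σ w * σb v = σb v * σ w
  comm_σcb : ∀ w j, σ w * cb j = cb j * σ w
  comm_σbc : ∀ v i, σb v * c i = c i * σb v
  anti_ccb : ∀ i j, c i * cb j = -(cb j * c i)
  e_c1 : ∀ (h1 : 0 < r) (h2 : 0 < t), e * c ⟨0, h1⟩ = e * cb ⟨0, h2⟩
  c1_e : ∀ (h1 : 0 < r) (h2 : 0 < t), c ⟨0, h1⟩ * e = cb ⟨0, h2⟩ * e
  e_sq : e * e = 0
  e_s_e : 1 < r → e * σ (sw r 0 1) * e = e
  e_sb_e : 1 < t → e * σb (sw t 0 1) * e = e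
  s_e_comm : ∀ i : ℕ, 0 < i → i + 1 < r → σ (sw r i (i + 1)) * e = e * σ (sw r i (i + 1))
  sb_e_comm : ∀ j : ℕ, 0 < j → j + 1 < t → σb (sw t j (j + 1)) * e = e * σb (sw t j (j + 1))
  braid1 : 1 < r → 1 < t →
    e * σ (sw r 0 1) * σb (sw t 0 1) * e * σ (sw r 0 1)
      = e * σ (sw r 0 1) * σb (sw t 0 1) * e * σb (sw t 0 1)
  braid2 : 1 < r → 1 < t →
    σ (sw r 0 1) * e * σ (sw r 0 1) * σb (sw t 0 1) * e
      = σb (sw t 0 1) * e * σ (sw r 0 1) * σb (sw t 0 1) * e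
  c_e_comm : ∀ i : Fin r, (i : ℕ) ≠ 0 → c i * e = e * c i
  cb_e_comm : ∀ j : Fin t, (j : ℕ) ≠ 0 → cb j * e = e * cb j
  e_c_e : ∀ h : 0 < r, e * c ⟨0, h⟩ * e = 0
  e_cb_e : ∀ h : 0 < t, e * cb ⟨0, h⟩ * e = 0

namespace WBC

variable {R A : Type} [CommRing R] [Ring A] [Algebra R A] {r t : ℕ}

/-- The transposition `(i,j) ∈ Σ_r` (1-based indices). -/
def tr (d : WBC R A r t) (i j : ℕ) : A := d.σ (sw r (i - 1) (j - 1))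

/-- The transposition `(ī,j̄) ∈ Σ_t` (1-based indices). -/
def trb (d : WBC R A r t) (i j : ℕ) : A := d.σb (sw t (i - 1) (j - 1))

/-- The generator `s_j = (j, j+1)` (1-based). -/
def s (d : WBC R A r t) (j : ℕ) : A := d.σ (sw r (j - 1) j)

/-- The generator `s̄_j` (1-based). -/
def sb (d : WBC R A r t) (j : ℕ) : A := d.σb (sw t (j - 1) j)

/-- The generator `c_i` (1-based). -/
def cn (d : WBC R A r t) (i : ℕ) : A := if h : i - 1 < r then d.c ⟨i - 1, h⟩ else 0

/-- The generator `c̄_i` (1-based). -/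
def cbn (d : WBC R A r t) (i : ℕ) : A := if h : i - 1 < t then d.cb ⟨i - 1, h⟩ else 0

/-- `e_{i,j} = (1̄,j̄)(1,i) e_1 (1,i)(1̄,j̄)` (1-based). -/
def E (d : WBC R A r t) (i j : ℕ) : A := d.trb 1 j * d.tr 1 i * d.e * d.tr 1 i * d.trb 1 j

/-- `ē_{i,j} = c_i e_{i,j} c_i`. -/
def Eb (d : WBC R A r t) (i j : ℕ) : A := d.cn i * d.E i j * d.cn i

/-- `L'_i = ∑_{j=1}^{i-1} (j,i)`. -/
def LL (d : WBC R A r t) (i : ℕ) : A := ∑ j ∈ Finset.Ico 1 i, d.tr j i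

/-- The Jucys–Murphy element `L_i = L'_i + c_i L'_i c_i`. -/
def L (d : WBC R A r t) (i : ℕ) : A := d.LL i + d.cn i * d.LL i * d.cn i

/-- `L̄'_i = ∑_{j=1}^{i-1} (j̄,ī)`. -/
def LLb (d : WBC R A r t) (i : ℕ) : A := ∑ j ∈ Finset.Ico 1 i, d.trb j i

/-- The Jucys–Murphy element `L̄_i = L̄'_i - c̄_i L̄'_i c̄_i`. -/
def Lb (d : WBC R A r t) (i : ℕ) : A := d.LLb i - d.cbn i * d.LLb i * d.cbn i

/-- `y_i = ∑_{j=1}^{i-1} (e_{i,j} + ē_{i,j}) - L_i`. -/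
def y (d : WBC R A r t) (i : ℕ) : A := (∑ j ∈ Finset.Ico 1 i, (d.E i j + d.Eb i j)) - d.L i

/-- `ȳ_i = ∑_{j=1}^{i-1} (e_{j,i} - ē_{j,i}) - L̄_i`. -/
def yb (d : WBC R A r t) (i : ℕ) : A := (∑ j ∈ Finset.Ico 1 i, (d.E j i - d.Eb j i)) - d.Lb i

/-- `c^α = c_1^{α_1} ⋯ c_r^{α_r}`. -/
def cpow (d : WBC R A r t) (α : Fin r → Fin 2) : A :=
  ((List.finRange r).map (fun i => d.c i ^ (α i : ℕ))).prod

/-- `c̄^β = c̄_1^{β_1} ⋯ c̄_t^{β_t}`. -/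
def cbpow (d : WBC R A r t) (β : Fin t → Fin 2) : A :=
  ((List.finRange t).map (fun j => d.cb j ^ (β j : ℕ))).prod

/-- `e^f = e_1 e_2 ⋯ e_f`. -/
def epow (d : WBC R A r t) (f : ℕ) : A :=
  ((List.range f).map (fun i => d.E (i + 1) (i + 1))).prod

/-- Generators of the subalgebra `BC_{m,m}`: the elements `e_1`, `s_1, …, s_{m-1}`,
`s̄_1, …, s̄_{m-1}`, `c_1` and `c̄_1` (interpreted as `∅` when `m = 0`). -/
def lowerGens (d : WBC R A r t) (m : ℕ) : Set A :=
  {x | (1 ≤ m ∧ x = d.e) ∨ (∃ j : ℕ, 1 ≤ j ∧ j + 1 ≤ m ∧ x = d.s j)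
    ∨ (∃ j : ℕ, 1 ≤ j ∧ j + 1 ≤ m ∧ x = d.sb j)
    ∨ (1 ≤ m ∧ x = d.cn 1) ∨ (1 ≤ m ∧ x = d.cbn 1)}

end WBC

/-- `φ` intertwines two sets of walled Brauer–Clifford data. -/
structure WBCHom {R A B : Type} [CommRing R] [Ring A] [Algebra R A] [Ring B] [Algebra R B]
    {r t : ℕ} (d : WBC R A r t) (d' : WBC R B r t) (φ : A →ₐ[R] B) : Prop where
  map_σ : ∀ w, φ (d.σ w) = d'.σ w
  map_σb : ∀ w, φ (d.σb w) = d'.σb w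
  map_c : ∀ i, φ (d.c i) = d'.c i
  map_cb : ∀ j, φ (d.cb j) = d'.cb j
  map_e : φ d.e = d'.e

/-- `A` (with the data `d`) *is* the walled Brauer–Clifford superalgebra `BC_{r,t}`:
it is initial among all algebras with such data. -/
def WBC.IsUniversal {R A : Type} [CommRing R] [Ring A] [Algebra R A] {r t : ℕ}
    (d : WBC R A r t) : Prop :=
  ∀ (B : Type) [Ring B] [Algebra R B], ∀ d' : WBC R B r t, ∃! φ : A →ₐ[R] B, WBCHom d d' φ

/-- An element of `D^f_{r,t}`: data `1 ≤ i_1 < ⋯ < i_f ≤ r` and `k ≤ j_k ≤ t`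
(all 1-based) describing `s_{f,i_f} s̄_{f,j_f} ⋯ s_{1,i_1} s̄_{1,j_1}`. -/
structure DElt (r t f : ℕ) : Type where
  a : Fin f → ℕ
  b : Fin f → ℕ
  ha_mono : StrictMono a
  ha_lb : ∀ k, 1 ≤ a k
  ha_ub : ∀ k, a k ≤ r
  hb_lb : ∀ k : Fin f, (k : ℕ) + 1 ≤ b k
  hb_ub : ∀ k, b k ≤ t

/-- The `Σ_r`-component `s_{f,i_f} ⋯ s_{1,i_1}` of the element of `D^f_{r,t}`. -/
def DElt.pr {r t f : ℕ} (x : DElt r t f) : Equiv.Perm (Fin r) :=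
  ((List.finRange f).reverse.map (fun (k : Fin f) => sIJ r ((k : ℕ) + 1) (x.a k))).prod

/-- The `Σ_t`-component `s̄_{f,j_f} ⋯ s̄_{1,j_1}` of the element of `D^f_{r,t}`. -/
def DElt.pt {r t f : ℕ} (x : DElt r t f) : Equiv.Perm (Fin t) :=
  ((List.finRange f).reverse.map (fun (k : Fin f) => sIJ t ((k : ℕ) + 1) (x.b k))).prod

/-- Index for the basis `{c^α d_1⁻¹ e^f w d_2 c̄^β}` of `BC_{r,t}`; the component
`w ∈ Σ_{r-f} × Σ_{t-f}` is a pair of permutations fixing `1, …, f` pointwise. -/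
structure BCIndex (r t : ℕ) : Type where
  α : Fin r → Fin 2
  β : Fin t → Fin 2
  f : ℕ
  hf : f ≤ min r t
  d1 : DElt r t f
  d2 : DElt r t f
  w : Equiv.Perm (Fin r)
  wb : Equiv.Perm (Fin t)
  hw : ∀ i : Fin r, (i : ℕ) < f → w i = i
  hwb : ∀ j : Fin t, (j : ℕ) < f → wb j = j

/-- The basis element `c^α d_1⁻¹ e^f w d_2 c̄^β` of Theorem 2.4. -/
def WBC.basElt {R A : Type} [CommRing R] [Ring A] [Algebra R A] {r t : ℕ}
    (d : WBC R A r t) (x : BCIndex r t) : A :=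
  d.cpow x.α * d.σ (x.d1.pr⁻¹) * d.σb (x.d1.pt⁻¹) * d.epow x.f *
    d.σ x.w * d.σb x.wb * d.σ x.d2.pr * d.σb x.d2.pt * d.cbpow x.β

/-- Data for the presentation of the affine walled Brauer–Clifford superalgebra
`BC^aff_{r,t}` (Definition 3.1) with distinguished parameter `ω_1 ∈ R`.
`om k` is `ω_k` (with `ω_1` the scalar `ω1` and `ω_{2k} = 0`), `omb k` is `ω̄_k`. -/
structure AWBC (R A : Type) [CommRing R] [Ring A] [Algebra R A] (r t : ℕ) (ω1 : R)
    extends WBC R A r t : Type where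
  x1 : A
  xb1 : A
  om : ℕ → A
  omb : ℕ → A
  om_one : om 1 = algebraMap R A ω1
  om_even : ∀ k, om (2 * k) = 0
  omb_zero : omb 0 = 0
  om_comm : ∀ k, (∀ w, om k * σ w = σ w * om k) ∧ (∀ w, om k * σb w = σb w * om k) ∧
    (∀ i, om k * c i = c i * om k) ∧ (∀ j, om k * cb j = cb j * om k) ∧
    om k * e = e * om k ∧ om k * x1 = x1 * om k ∧ om k * xb1 = xb1 * om k ∧
    (∀ l, om k * om l = om l * om k) ∧ (∀ l, om k * omb l = omb l * om k)
  omb_comm : ∀ k, (∀ w, omb k * σ w = σ w * omb k) ∧ (∀ w, omb k * σb w = σb w * omb k) ∧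
    (∀ i, omb k * c i = c i * omb k) ∧ (∀ j, omb k * cb j = cb j * omb k) ∧
    omb k * e = e * omb k ∧ omb k * x1 = x1 * omb k ∧ omb k * xb1 = xb1 * omb k ∧
    (∀ l, omb k * omb l = omb l * omb k)
  x_comm : ∀ h : 1 < r, x1 * (σ (sw r 0 1) * x1 * σ (sw r 0 1)
      - (1 - c ⟨0, by omega⟩ * c ⟨1, h⟩) * σ (sw r 0 1))
    = (σ (sw r 0 1) * x1 * σ (sw r 0 1)
      - (1 - c ⟨0, by omega⟩ * c ⟨1, h⟩) * σ (sw r 0 1)) * x1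
  x1_c1 : ∀ h : 0 < r, x1 * c ⟨0, h⟩ = -(c ⟨0, h⟩ * x1)
  x1_c : ∀ i : Fin r, (i : ℕ) ≠ 0 → x1 * c i = c i * x1
  s_x1 : ∀ i : ℕ, 0 < i → i + 1 < r → σ (sw r i (i + 1)) * x1 = x1 * σ (sw r i (i + 1))
  xb_comm : ∀ h : 1 < t, xb1 * (σb (sw t 0 1) * xb1 * σb (sw t 0 1)
      - (1 + cb ⟨0, by omega⟩ * cb ⟨1, h⟩) * σb (sw t 0 1))
    = (σb (sw t 0 1) * xb1 * σb (sw t 0 1)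
      - (1 + cb ⟨0, by omega⟩ * cb ⟨1, h⟩) * σb (sw t 0 1)) * xb1
  xb1_cb1 : ∀ h : 0 < t, xb1 * cb ⟨0, h⟩ = -(cb ⟨0, h⟩ * xb1)
  xb1_cb : ∀ j : Fin t, (j : ℕ) ≠ 0 → xb1 * cb j = cb j * xb1
  sb_xb1 : ∀ j : ℕ, 0 < j → j + 1 < t → σb (sw t j (j + 1)) * xb1 = xb1 * σb (sw t j (j + 1))
  e_xsum : e * (x1 + xb1) = 0
  xsum_e : (x1 + xb1) * e = 0
  e_sxs : 1 < r → e * (σ (sw r 0 1) * x1 * σ (sw r 0 1)) = (σ (sw r 0 1) * x1 * σ (sw r 0 1)) * e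
  x_mixed : ∀ h : 0 < r, x1 * (e + xb1 - c ⟨0, h⟩ * e * c ⟨0, h⟩)
      = (e - c ⟨0, h⟩ * e * c ⟨0, h⟩ + xb1) * x1
  e_sbxbsb : 1 < t →
    e * (σb (sw t 0 1) * xb1 * σb (sw t 0 1)) = (σb (sw t 0 1) * xb1 * σb (sw t 0 1)) * e
  e_xodd : ∀ k : ℕ, e * x1 ^ (2 * k + 1) * e = om (2 * k + 1) * e
  e_xeven : ∀ k : ℕ, 1 ≤ k → e * x1 ^ (2 * k) * e = 0
  e_xb : ∀ k : ℕ, 1 ≤ k → e * xb1 ^ k * e = omb k * e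
  x1_cb_comm : ∀ j, x1 * cb j = cb j * x1
  xb1_c_comm : ∀ i, xb1 * c i = c i * xb1
  x1_σb : ∀ w, σb w * x1 = x1 * σb w
  xb1_σ : ∀ w, σ w * xb1 = xb1 * σ w

namespace AWBC

variable {R A : Type} [CommRing R] [Ring A] [Algebra R A] {r t : ℕ} {ω1 : R}

/-- `x'_i = s_{i-1} ⋯ s_1 x_1 s_1 ⋯ s_{i-1}` (1-based). -/
def xp (d : AWBC R A r t ω1) (i : ℕ) : A :=
  ((List.range (i - 1)).reverse.map (fun k => d.toWBC.s (k + 1))).prod * d.x1 *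
    ((List.range (i - 1)).map (fun k => d.toWBC.s (k + 1))).prod

/-- `x̄'_j = s̄_{j-1} ⋯ s̄_1 x̄_1 s̄_1 ⋯ s̄_{j-1}` (1-based). -/
def xbp (d : AWBC R A r t ω1) (j : ℕ) : A :=
  ((List.range (j - 1)).reverse.map (fun k => d.toWBC.sb (k + 1))).prod * d.xb1 *
    ((List.range (j - 1)).map (fun k => d.toWBC.sb (k + 1))).prod

/-- `x_i = x'_i - L_i`. -/
def xv (d : AWBC R A r t ω1) (i : ℕ) : A := d.xp i - d.toWBC.L i

/-- `x̄_j = x̄'_j - L̄_j`. -/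
def xbv (d : AWBC R A r t ω1) (j : ℕ) : A := d.xbp j - d.toWBC.Lb j

/-- `x^α = x_1^{α_1} ⋯ x_r^{α_r}`. -/
def xpow (d : AWBC R A r t ω1) (α : Fin r → ℕ) : A :=
  ((List.finRange r).map (fun (i : Fin r) => d.xv ((i : ℕ) + 1) ^ α i)).prod

/-- `x̄^β = x̄_1^{β_1} ⋯ x̄_t^{β_t}`. -/
def xbpow (d : AWBC R A r t ω1) (β : Fin t → ℕ) : A :=
  ((List.finRange t).map (fun (j : Fin t) => d.xbv ((j : ℕ) + 1) ^ β j)).prod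

/-- `∏_{n ∈ ℤ^{>0}} ω_{2n+1}^{a_{2n+1}}`, where `g i` is the exponent of `ω_{2(i+1)+1}`. -/
def ompow (d : AWBC R A r t ω1) (g : ℕ →₀ ℕ) : A :=
  ((g.support.sort (· ≤ ·)).map (fun n => d.om (2 * n + 3) ^ g n)).prod

/-- `z_i = x'_i + y_i`. -/
def z (d : AWBC R A r t ω1) (i : ℕ) : A := d.xp i + d.toWBC.y i

/-- `z̄_j = x̄'_j + ȳ_j`. -/
def zb (d : AWBC R A r t ω1) (j : ℕ) : A := d.xbp j + d.toWBC.yb j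

/-- Generators of the subalgebra `BC_{2,m,m}`-type subalgebra:
`e_1, s_1, …, s_{m-1}, s̄_1, …, s̄_{m-1}, c_1, c̄_1, x_1, x̄_1`. -/
def lowerGensA (d : AWBC R A r t ω1) (m : ℕ) : Set A :=
  d.toWBC.lowerGens m ∪ {x | 1 ≤ m ∧ (x = d.x1 ∨ x = d.xb1)}

end AWBC

/-- `φ` intertwines two sets of affine walled Brauer–Clifford data. -/
structure AWBCHom {R A B : Type} [CommRing R] [Ring A] [Algebra R A] [Ring B] [Algebra R B]
    {r t : ℕ} {ω1 : R} (d : AWBC R A r t ω1) (d' : AWBC R B r t ω1) (φ : A →ₐ[R] B) : Prop where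
  map_σ : ∀ w, φ (d.σ w) = d'.σ w
  map_σb : ∀ w, φ (d.σb w) = d'.σb w
  map_c : ∀ i, φ (d.c i) = d'.c i
  map_cb : ∀ j, φ (d.cb j) = d'.cb j
  map_e : φ d.e = d'.e
  map_x1 : φ d.x1 = d'.x1
  map_xb1 : φ d.xb1 = d'.xb1
  map_om : ∀ k, φ (d.om k) = d'.om k
  map_omb : ∀ k, φ (d.omb k) = d'.omb k

/-- `A` (with the data `d`) is the affine walled Brauer–Clifford superalgebra
`BC^aff_{r,t}` of Definition 3.1. -/
def AWBC.IsUniversal {R A : Type} [CommRing R] [Ring A] [Algebra R A] {r t : ℕ} {ω1 : R}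
    (d : AWBC R A r t ω1) : Prop :=
  ∀ (B : Type) [Ring B] [Algebra R B], ∀ d' : AWBC R B r t ω1,
    ∃! φ : A →ₐ[R] B, AWBCHom d d' φ

/-- Assumption 3.6: the parameters `ω̄` are determined by the `ω`'s as in Corollary 3.5. -/
def AWBC.Ass36 {R A : Type} [CommRing R] [Ring A] [Algebra R A] {r t : ℕ} {ω1 : R}
    (d : AWBC R A r t ω1) : Prop :=
  (∀ n, d.omb (2 * n) = 0) ∧
  (∀ n, d.omb (2 * n + 1) = ∑ j ∈ Finset.range (n + 1), acoef d.om n j * d.om (2 * j + 1))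

/-- `A` (with the data `d`) is the affine walled Brauer–Clifford superalgebra
`BC^aff_{r,t}` subject to Assumption 3.6. -/
def AWBC.IsUniversal36 {R A : Type} [CommRing R] [Ring A] [Algebra R A] {r t : ℕ} {ω1 : R}
    (d : AWBC R A r t ω1) : Prop :=
  d.Ass36 ∧ ∀ (B : Type) [Ring B] [Algebra R B], ∀ d' : AWBC R B r t ω1,
    d'.Ass36 → ∃! φ : A →ₐ[R] B, AWBCHom d d' φ

/-- The parameters `ω_k`, `ω̄_k` are the scalars `ω k`, `obar ω k` (specialization defining
the algebra `B̃C_{r,t}` of Definition 3.13). -/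
def AWBC.IsSpec {R A : Type} [CommRing R] [Ring A] [Algebra R A] {r t : ℕ} {ω1 : R}
    (d : AWBC R A r t ω1) (ω : ℕ → R) : Prop :=
  (∀ k, d.om k = algebraMap R A (ω k)) ∧ (∀ k, 1 ≤ k → d.omb k = algebraMap R A (obar ω k))

/-- `A` (with the data `d`) is the algebra `B̃C_{r,t}` of Definition 3.13 with parameters
`ω_{2n+1} ∈ R`. -/
def AWBC.IsSpecUniversal {R A : Type} [CommRing R] [Ring A] [Algebra R A] {r t : ℕ} {ω1 : R}
    (d : AWBC R A r t ω1) (ω : ℕ → R) : Prop :=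
  d.IsSpec ω ∧ ∀ (B : Type) [Ring B] [Algebra R B], ∀ d' : AWBC R B r t ω1,
    d'.IsSpec ω → ∃! φ : A →ₐ[R] B, AWBCHom d d' φ

/-- The cyclotomic relations `f(x_1) = 0` and `g(x̄_1) = 0`. -/
def AWBC.IsCyc {R A : Type} [CommRing R] [Ring A] [Algebra R A] {r t : ℕ} {ω1 : R}
    (d : AWBC R A r t ω1) (f g : Polynomial R) : Prop :=
  Polynomial.aeval d.x1 f = 0 ∧ Polynomial.aeval d.xb1 g = 0

/-- `A` (with the data `d`) is the cyclotomic walled Brauer–Clifford superalgebra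
`BC_{ℓ,r,t}` of Definition 3.14 attached to `f`, `g` and the scalar parameters `ω`. -/
def AWBC.IsCycUniversal {R A : Type} [CommRing R] [Ring A] [Algebra R A] {r t : ℕ} {ω1 : R}
    (d : AWBC R A r t ω1) (ω : ℕ → R) (f g : Polynomial R) : Prop :=
  d.IsSpec ω ∧ d.IsCyc f g ∧ ∀ (B : Type) [Ring B] [Algebra R B], ∀ d' : AWBC R B r t ω1,
    d'.IsSpec ω → d'.IsCyc f g → ∃! φ : A →ₐ[R] B, AWBCHom d d' φ

/-- Index of a regular monomial `x^α d x̄^β ∏_{n≥1} ω_{2n+1}^{a_{2n+1}}` of `BC^aff_{r,t}`. -/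
structure ARIndex (r t : ℕ) : Type where
  α : Fin r → ℕ
  β : Fin t → ℕ
  dIdx : BCIndex r t
  g : ℕ →₀ ℕ

/-- The regular monomial `x^α d x̄^β ∏_{n≥1} ω_{2n+1}^{a_{2n+1}}` of Definition 3.11. -/
def AWBC.regElt {R A : Type} [CommRing R] [Ring A] [Algebra R A] {r t : ℕ} {ω1 : R}
    (d : AWBC R A r t ω1) (x : ARIndex r t) : A :=
  d.xpow x.α * d.toWBC.basElt x.dIdx * d.xbpow x.β * d.ompow x.g

/-- Index of a regular monomial `x^α d x̄^β` of `B̃C_{r,t}`. -/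
structure SIndex (r t : ℕ) : Type where
  α : Fin r → ℕ
  β : Fin t → ℕ
  dIdx : BCIndex r t

/-- The regular monomial `x^α d x̄^β` of `B̃C_{r,t}`. -/
def AWBC.sregElt {R A : Type} [CommRing R] [Ring A] [Algebra R A] {r t : ℕ} {ω1 : R}
    (d : AWBC R A r t ω1) (x : SIndex r t) : A :=
  d.xpow x.α * d.toWBC.basElt x.dIdx * d.xbpow x.β

/-- Index of a regular monomial `x^α d x̄^β` of the level `ℓ` algebra `BC_{ℓ,r,t}`,
with exponents in `{0, 1, …, ℓ-1}`. -/
structure CIndex (r t ℓ : ℕ) : Type where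
  α : Fin r → Fin ℓ
  β : Fin t → Fin ℓ
  dIdx : BCIndex r t

/-- The regular monomial `x^α d x̄^β` of `BC_{ℓ,r,t}`. -/
def AWBC.cregElt {R A : Type} [CommRing R] [Ring A] [Algebra R A] {r t ℓ : ℕ} {ω1 : R}
    (d : AWBC R A r t ω1) (x : CIndex r t ℓ) : A :=
  d.xpow (fun i => (x.α i : ℕ)) * d.toWBC.basElt x.dIdx * d.xbpow (fun j => (x.β j : ℕ))

/-- Admissibility (Definition 6.4): writing `f(x) = x^{k+2m} + ∑_{i=1}^{2m} a_i x^{k+2m-i}`,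
one has `ω_L = -(a_1 ω_{L-1} + ⋯ + a_{2m} ω_{L-2m})` for all `L ≥ k + 2m`. -/
def AdmissibleParam {R : Type} [CommRing R] (ω : ℕ → R) (f : Polynomial R) (k m : ℕ) : Prop :=
  ∀ L, k + 2 * m ≤ L →
    ω L = -∑ i ∈ Finset.Icc 1 (2 * m), f.coeff (k + 2 * m - i) * ω (L - i)

/-- The parameters `ω_0 = 0`, `ω_1 = -2m(2p-2m+1)`, `ω_i = p(p+1) ω_{i-2}` of (4.16). -/
def omSeq (m : ℕ) (p : ℂ) : ℕ → ℂ
  | 0 => 0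
  | 1 => -2 * (m : ℂ) * (2 * p - 2 * (m : ℂ) + 1)
  | n + 2 => p * (p + 1) * omSeq m p n

/-- Index of a monomial `d_1^{-1} c^α x'^β e^f x̄'^{β̄} c̄^{ᾱ} w d_2` of (4.20). -/
structure L2Index (r t : ℕ) : Type where
  α : Fin r → Fin 2
  βx : Fin r → Fin 2
  αb : Fin t → Fin 2
  βxb : Fin t → Fin 2
  f : ℕ
  hf : f ≤ min r t
  d1 : DElt r t f
  d2 : DElt r t f
  w : Equiv.Perm (Fin r)
  wb : Equiv.Perm (Fin t)
  hw : ∀ i : Fin r, (i : ℕ) < f → w i = i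
  hwb : ∀ j : Fin t, (j : ℕ) < f → wb j = j

/-- The monomial `d_1^{-1} c^α x'^β e^f x̄'^{β̄} c̄^{ᾱ} w d_2` of (4.20), where
`x'^β = x'_r{}^{β_r} ⋯ x'_1{}^{β_1}` and `x̄'^{β̄} = x̄'_t{}^{β̄_t} ⋯ x̄'_1{}^{β̄_1}`. -/
def AWBC.l2Elt {R A : Type} [CommRing R] [Ring A] [Algebra R A] {r t : ℕ} {ω1 : R}
    (d : AWBC R A r t ω1) (x : L2Index r t) : A :=
  d.toWBC.σ (x.d1.pr⁻¹) * d.toWBC.σb (x.d1.pt⁻¹) * d.toWBC.cpow x.α *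
    ((List.finRange r).reverse.map (fun (i : Fin r) => d.xp ((i : ℕ) + 1) ^ (x.βx i : ℕ))).prod *
    d.toWBC.epow x.f *
    ((List.finRange t).reverse.map (fun (j : Fin t) => d.xbp ((j : ℕ) + 1) ^ (x.βxb j : ℕ))).prod *
    d.toWBC.cbpow x.αb *
    d.toWBC.σ x.w * d.toWBC.σb x.wb * d.toWBC.σ x.d2.pr * d.toWBC.σb x.d2.pt



namespace BCaux
open Equiv

lemma sw_fin (n : ℕ) (a b : Fin n) : sw n a b = Equiv.swap a b := by simp [sw]

lemma commute_fix {A : Type} [Ring A] {n : ℕ} (τ : Perm (Fin (n+1)) →* A) (e : A)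
    (H : ∀ i : ℕ, 0 < i → i + 1 < n + 1 →
      τ (sw (n+1) i (i + 1)) * e = e * τ (sw (n+1) i (i + 1)))
    (g : Perm (Fin (n+1))) (hg : g 0 = 0) : τ g * e = e * τ g := by
  have mulc : ∀ g h, τ g * e = e * τ g → τ h * e = e * τ h → τ (g * h) * e = e * τ (g * h) := by
    intro g h h1 h2
    rw [map_mul, mul_assoc, h2, ← mul_assoc, h1, mul_assoc]
  have hsw : ∀ m a : ℕ, ∀ (h : a + 1 + m + 1 < n + 1),
      τ (swap (⟨a+1, by omega⟩ : Fin (n+1)) ⟨a + 1 + m + 1, h⟩) * e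
        = e * τ (swap (⟨a+1, by omega⟩ : Fin (n+1)) ⟨a + 1 + m + 1, h⟩) := by
    intro m
    induction m with
    | zero =>
      intro a h
      have := H (a+1) (by omega) h
      have e1 : sw (n+1) (a+1) (a+1+1) = swap (⟨a+1, by omega⟩ : Fin (n+1)) ⟨a + 1 + 1, h⟩ :=
        sw_fin (n+1) ⟨a+1, by omega⟩ ⟨a+1+1, h⟩
      rw [e1] at this
      exact this
    | succ m ih =>
      intro a h
      have h1 := ih a (by omega)
      have e1 : sw (n+1) (a+1+m+1) (a+1+m+1+1)
          = swap (⟨a+1+m+1, by omega⟩ : Fin (n+1)) ⟨a + 1 + m + 1 + 1, h⟩ :=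
        sw_fin (n+1) ⟨a+1+m+1, by omega⟩ ⟨a+1+m+1+1, h⟩
      have h2 := H (a+1+m+1) (by omega) h
      rw [e1] at h2
      have := mulc _ _ (mulc _ _ h2 h1) h2
      have key : swap (⟨a+1+m+1, by omega⟩ : Fin (n+1)) ⟨a + 1 + m + 1 + 1, h⟩ *
          swap (⟨a+1, by omega⟩ : Fin (n+1)) ⟨a + 1 + m + 1, by omega⟩ *
          swap (⟨a+1+m+1, by omega⟩ : Fin (n+1)) ⟨a + 1 + m + 1 + 1, h⟩
          = swap (⟨a+1, by omega⟩ : Fin (n+1)) ⟨a + 1 + m + 1 + 1, h⟩ := by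
        have := swap_mul_swap_mul_swap (x := (⟨a+1, by omega⟩ : Fin (n+1)))
          (y := ⟨a+1+m+1, by omega⟩) (z := ⟨a+1+m+1+1, h⟩) (by simp; omega) (by simp; omega)
        rw [this, swap_comm]
      rwa [key] at this
  have hsw2 : ∀ a b : Fin (n+1), a ≠ 0 → b ≠ 0 → a < b →
      τ (swap a b) * e = e * τ (swap a b) := by
    intro a b ha hb hab
    have ha' : (a : ℕ) ≠ 0 := fun h => ha (Fin.ext h)
    have hab' : (a : ℕ) < b := hab
    have := hsw (b - a - 1) (a - 1) (by omega)
    have e1 : (⟨(a:ℕ) - 1 + 1, by omega⟩ : Fin (n+1)) = a := Fin.ext (by simp; omega)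
    have e2 : (⟨(a:ℕ) - 1 + 1 + (b - a - 1) + 1, by omega⟩ : Fin (n+1)) = b :=
      Fin.ext (by simp; omega)
    rwa [e1, e2] at this
  have hsw3 : ∀ a b : Fin (n+1), a ≠ 0 → b ≠ 0 →
      τ (swap a b) * e = e * τ (swap a b) := by
    intro a b ha hb
    rcases lt_trichotomy a b with h | h | h
    · exact hsw2 a b ha hb h
    · subst h; rw [swap_self]; change τ 1 * e = e * τ 1; simp
    · rw [swap_comm]; exact hsw2 b a hb ha h
  have hfix : ∀ x : Fin (n+1), x ≠ 0 ↔ g x ≠ 0 := by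
    intro x
    rw [not_iff_not]
    constructor
    · rintro rfl; exact hg
    · intro h; exact g.injective (h.trans hg.symm)
  have key : ∀ f : Perm {x : Fin (n+1) // x ≠ 0},
      τ (Perm.ofSubtype f) * e = e * τ (Perm.ofSubtype f) := by
    intro f
    induction f using Perm.swap_induction_on with
    | one => simp
    | swap_mul f x y hxy ih =>
      rw [map_mul, Perm.ofSubtype_swap_eq]
      exact mulc _ _ (hsw3 _ _ x.2 y.2) ih
  have := key (g.subtypePerm (fun x => (hfix x).symm))
  rwa [Perm.ofSubtype_subtypePerm] at this
  intro x hx h0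
  rw [h0] at hx
  exact hx hg

end BCaux


namespace BCaux
open Equiv

lemma exists_perm {n : ℕ} {i i' : Fin (n+1)} (h : i ≠ i') :
    ∃ g : Perm (Fin (n+1)), g 0 = i ∧ g 1 = i' ∧ (0 : Fin (n+1)) ≠ 1 ∧ 1 < n + 1 := by
  have hn : 1 < n + 1 := by
    by_contra hc
    have : n = 0 := by omega
    subst this
    exact h (Subsingleton.elim (α := Fin 1) _ _)
  have h01 : (0 : Fin (n+1)) ≠ 1 := by
    intro hh
    have := congrArg Fin.val hh
    rw [Fin.val_zero, Fin.val_one' , Nat.mod_eq_of_lt hn] at this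
    omega
  refine ⟨swap (swap 0 i 1) i' * swap 0 i, ?_, ?_, h01, hn⟩
  · rw [Perm.mul_apply, swap_apply_left, swap_apply_of_ne_of_ne _ h]
    intro hh
    have : (swap 0 i) 0 = (swap 0 i) 1 := by rw [swap_apply_left, ← hh]
    exact h01 ((swap 0 i).injective this)
  · rw [Perm.mul_apply, swap_apply_left]

section
variable {R A : Type} [CommRing R] [Ring A] [Algebra R A] {r t : ℕ} (d : WBC R A (r+1) (t+1))

def T (g : Perm (Fin (r+1))) (h : Perm (Fin (t+1))) : A := d.σ g * d.σb h

lemma T_mul (g g' : Perm (Fin (r+1))) (h h' : Perm (Fin (t+1))) :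
    T d g h * T d g' h' = T d (g * g') (h * h') := by
  simp only [T, map_mul]
  rw [mul_assoc, ← mul_assoc (d.σb h), ← d.comm_σσb]
  simp only [mul_assoc]

lemma T_one : T d 1 1 = 1 := by simp [T]
lemma T_left (g : Perm (Fin (r+1))) : T d g 1 = d.σ g := by simp [T]
lemma T_right (h : Perm (Fin (t+1))) : T d 1 h = d.σb h := by simp [T]

lemma T_e (g : Perm (Fin (r+1))) (h : Perm (Fin (t+1))) (hg : g 0 = 0) (hh : h 0 = 0) :
    T d g h * d.e = d.e * T d g h := by
  have h1 := commute_fix d.σ d.e d.s_e_comm g hg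
  have h2 := commute_fix d.σb d.e d.sb_e_comm h hh
  rw [T, mul_assoc, h2, ← mul_assoc, h1, mul_assoc]

lemma T_c (g : Perm (Fin (r+1))) (h : Perm (Fin (t+1))) (i : Fin (r+1)) :
    T d g h * d.c i = d.c (g i) * T d g h := by
  rw [← d.c_conj g i, T, mul_assoc, d.comm_σbc]
  simp only [mul_assoc]
  rw [← mul_assoc (d.σ g⁻¹), ← map_mul]
  simp

lemma T_cb (g : Perm (Fin (r+1))) (h : Perm (Fin (t+1))) (j : Fin (t+1)) :
    T d g h * d.cb j = d.cb (h j) * T d g h := by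
  rw [← d.cb_conj h j, T, d.comm_σσb, mul_assoc, d.comm_σcb]
  simp only [mul_assoc]
  rw [← mul_assoc (d.σb h⁻¹), ← map_mul]
  simp

def EE (i : Fin (r+1)) (j : Fin (t+1)) : A :=
  T d (swap 0 i) (swap 0 j) * d.e * T d (swap 0 i) (swap 0 j)

lemma EE_zero : EE d 0 0 = d.e := by
  have h1 : swap (0 : Fin (r+1)) 0 = 1 := swap_self _
  have h2 : swap (0 : Fin (t+1)) 0 = 1 := swap_self _
  rw [EE, h1, h2, T_one, one_mul, mul_one]

lemma T_EE (g : Perm (Fin (r+1))) (h : Perm (Fin (t+1))) (i j) :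
    T d g h * EE d i j = EE d (g i) (h j) * T d g h := by
  have h1 := T_e d (swap 0 (g i) * g * swap 0 i) (swap 0 (h j) * h * swap 0 j)
    (by simp) (by simp)
  have e1 : g * swap 0 i = swap 0 (g i) * (swap 0 (g i) * g * swap 0 i) := by
    rw [← mul_assoc, ← mul_assoc, swap_mul_self, one_mul]
  have e2 : h * swap 0 j = swap 0 (h j) * (swap 0 (h j) * h * swap 0 j) := by
    rw [← mul_assoc, ← mul_assoc, swap_mul_self, one_mul]
  calc T d g h * EE d i j
      = T d (g * swap 0 i) (h * swap 0 j) * d.e * T d (swap 0 i) (swap 0 j) := by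
        rw [EE, ← mul_assoc, ← mul_assoc, T_mul]
    _ = T d (swap 0 (g i)) (swap 0 (h j)) *
          (T d (swap 0 (g i) * g * swap 0 i) (swap 0 (h j) * h * swap 0 j) * d.e)
          * T d (swap 0 i) (swap 0 j) := by
        rw [e1, e2, ← T_mul, ← mul_assoc]
    _ = T d (swap 0 (g i)) (swap 0 (h j)) * d.e *
          (T d (swap 0 (g i) * g * swap 0 i) (swap 0 (h j) * h * swap 0 j)
          * T d (swap 0 i) (swap 0 j)) := by
        rw [h1]; simp only [mul_assoc]
    _ = EE d (g i) (h j) * T d g h := by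
        rw [T_mul, EE, mul_assoc (_ * d.e), T_mul]
        congr 2
        · simp only [mul_assoc, swap_mul_self, mul_one]
        · simp only [mul_assoc, swap_mul_self, mul_one]

lemma T_inv (g : Perm (Fin (r+1))) (h : Perm (Fin (t+1))) : T d g h * T d g⁻¹ h⁻¹ = 1 := by
  rw [T_mul]; simp [T_one]

lemma T_cancel {g : Perm (Fin (r+1))} {h : Perm (Fin (t+1))} {x y : A}
    (hh : x * T d g h = y * T d g h) : x = y := by
  have := congrArg (· * T d g⁻¹ h⁻¹) hh
  simpa [mul_assoc, T_inv] using this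

lemma σ_EE (g : Perm (Fin (r+1))) (i j) : d.σ g * EE d i j = EE d (g i) j * d.σ g := by
  simpa [T_left] using T_EE d g 1 i j
lemma σb_EE (h : Perm (Fin (t+1))) (i j) : d.σb h * EE d i j = EE d i (h j) * d.σb h := by
  simpa [T_right] using T_EE d 1 h i j
lemma σ_c (g : Perm (Fin (r+1))) (i) : d.σ g * d.c i = d.c (g i) * d.σ g := by
  simpa [T_left] using T_c d g 1 i
lemma σb_cb (h : Perm (Fin (t+1))) (j) : d.σb h * d.cb j = d.cb (h j) * d.σb h := by
  simpa [T_right] using T_cb d 1 h j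

lemma σ_swap_sq (i i' : Fin (r+1)) : d.σ (swap i i') * d.σ (swap i i') = 1 := by
  rw [← map_mul, swap_mul_self, map_one]
lemma σb_swap_sq (i i' : Fin (t+1)) : d.σb (swap i i') * d.σb (swap i i') = 1 := by
  rw [← map_mul, swap_mul_self, map_one]

/-- Transport from (0,0) to (i,j). -/
lemma exists_T (i : Fin (r+1)) (j : Fin (t+1)) :
    ∃ (g : Perm (Fin (r+1))) (h : Perm (Fin (t+1))), g 0 = i ∧ h 0 = j :=
  ⟨swap 0 i, swap 0 j, by simp, by simp⟩

lemma EE_sq (i j) : EE d i j * EE d i j = 0 := by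
  obtain ⟨g, h, rfl, rfl⟩ := exists_T i j
  apply T_cancel d (g := g) (h := h)
  rw [mul_assoc, ← T_EE, ← mul_assoc, ← T_EE, mul_assoc, EE_zero, d.e_sq]; simp

lemma EE_c_EE (i j) : EE d i j * d.c i * EE d i j = 0 := by
  obtain ⟨g, h, rfl, rfl⟩ := exists_T i j
  apply T_cancel d (g := g) (h := h)
  have := d.e_c_e (by omega)
  rw [mul_assoc, ← T_EE, ← mul_assoc, mul_assoc (EE _ _ _), ← T_c, ← mul_assoc, ← T_EE,
    mul_assoc, mul_assoc, EE_zero, ← mul_assoc d.e]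
  erw [this]; simp

lemma c_EE (i j) : d.c i * EE d i j = d.cb j * EE d i j := by
  obtain ⟨g, h, rfl, rfl⟩ := exists_T i j
  apply T_cancel d (g := g) (h := h)
  have := d.c1_e (by omega) (by omega)
  rw [mul_assoc, mul_assoc, ← T_EE, ← mul_assoc, ← mul_assoc, ← T_c, ← T_cb, mul_assoc, mul_assoc,
    EE_zero]
  exact congrArg _ this

lemma EE_c (i j) : EE d i j * d.c i = EE d i j * d.cb j := by
  obtain ⟨g, h, rfl, rfl⟩ := exists_T i j
  apply T_cancel d (g := g) (h := h)
  have := d.e_c1 (by omega) (by omega)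
  rw [mul_assoc, mul_assoc, ← T_c, ← T_cb, ← mul_assoc, ← mul_assoc, ← T_EE, mul_assoc, mul_assoc,
    EE_zero]
  exact congrArg _ this

lemma EE_cb_EE (i j) : EE d i j * d.cb j * EE d i j = 0 := by
  rw [← EE_c, EE_c_EE]

lemma c_EE_comm (a i j) (ha : a ≠ i) : d.c a * EE d i j = EE d i j * d.c a := by
  obtain ⟨g, h, rfl, rfl⟩ := exists_T i j
  obtain ⟨b, rfl⟩ := g.surjective a
  apply T_cancel d (g := g) (h := h)
  have hb : (b : ℕ) ≠ 0 := fun hb => ha (congrArg g (Fin.ext hb))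
  have := d.c_e_comm b hb
  rw [mul_assoc, mul_assoc, ← T_c, ← T_EE, ← mul_assoc, ← mul_assoc, ← T_c, ← T_EE, mul_assoc,
    mul_assoc, EE_zero]
  exact congrArg _ this

lemma cb_EE_comm (a i j) (ha : a ≠ j) : d.cb a * EE d i j = EE d i j * d.cb a := by
  obtain ⟨g, h, rfl, rfl⟩ := exists_T i j
  obtain ⟨b, rfl⟩ := h.surjective a
  apply T_cancel d (g := g) (h := h)
  have hb : (b : ℕ) ≠ 0 := fun hb => ha (congrArg h (Fin.ext hb))
  have := d.cb_e_comm b hb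
  rw [mul_assoc, mul_assoc, ← T_cb, ← T_EE, ← mul_assoc, ← mul_assoc, ← T_cb, ← T_EE, mul_assoc,
    mul_assoc, EE_zero]
  exact congrArg _ this

lemma sw01 {n : ℕ} (hn : 1 < n + 1) : sw (n+1) 0 1 = swap 0 1 := by
  have := sw_fin (n+1) 0 1
  rwa [Fin.val_zero, Fin.val_one', Nat.mod_eq_of_lt hn] at this

lemma EE_EE_left {j j'} (i) (hj : j ≠ j') :
    EE d i j * EE d i j' = d.σb (swap j j') * EE d i j' := by
  obtain ⟨h, rfl, rfl, h01, hn⟩ := exists_perm hj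
  obtain ⟨g, _, rfl, -⟩ := exists_T (t := t) i 0
  apply T_cancel d (g := g) (h := h)
  have h1 := d.e_sb_e hn
  rw [sw01 hn] at h1
  have h2 : EE d 0 1 = d.σb (swap 0 1) * d.e * d.σb (swap 0 1) := by
    have := σb_EE d (swap 0 1) 0 0
    rw [swap_apply_left, EE_zero] at this
    rw [this, mul_assoc, σb_swap_sq, mul_one]
  have h3 : EE d 0 0 * EE d 0 1 = d.σb (swap 0 1) * EE d 0 1 := by
    rw [EE_zero, h2, ← mul_assoc, ← mul_assoc, h1, ← mul_assoc, ← mul_assoc, σb_swap_sq, one_mul]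
  have h4 : d.σb (swap (h 0) (h 1)) * T d g h = T d g h * d.σb (swap 0 1) := by
    rw [← T_right, T_mul, ← T_right, T_mul]
    rw [one_mul, mul_one, Equiv.mul_swap_eq_swap_mul]
  rw [mul_assoc, ← T_EE, ← mul_assoc, ← T_EE, mul_assoc, h3, mul_assoc, ← T_EE, ← mul_assoc,
    ← mul_assoc, h4]

lemma EE_EE_right {i i'} (j) (hi : i ≠ i') :
    EE d i j * EE d i' j = d.σ (swap i i') * EE d i' j := by
  obtain ⟨g, rfl, rfl, h01, hn⟩ := exists_perm hi
  obtain ⟨_, h, -, rfl⟩ := exists_T (r := r) 0 j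
  apply T_cancel d (g := g) (h := h)
  have h1 := d.e_s_e hn
  rw [sw01 hn] at h1
  have h2 : EE d 1 0 = d.σ (swap 0 1) * d.e * d.σ (swap 0 1) := by
    have := σ_EE d (swap 0 1) 0 0
    rw [swap_apply_left, EE_zero] at this
    rw [this, mul_assoc, σ_swap_sq, mul_one]
  have h3 : EE d 0 0 * EE d 1 0 = d.σ (swap 0 1) * EE d 1 0 := by
    rw [EE_zero, h2, ← mul_assoc, ← mul_assoc, h1, ← mul_assoc, ← mul_assoc, σ_swap_sq, one_mul]
  have h4 : d.σ (swap (g 0) (g 1)) * T d g h = T d g h * d.σ (swap 0 1) := by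
    rw [← T_left, T_mul, ← T_left, T_mul]
    rw [one_mul, mul_one, Equiv.mul_swap_eq_swap_mul]
  rw [mul_assoc, ← T_EE, ← mul_assoc, ← T_EE, mul_assoc, h3, mul_assoc, ← T_EE, ← mul_assoc,
    ← mul_assoc, h4]

lemma braid_aux (hr : 1 < r+1) (ht : 1 < t+1) :
    EE d 0 0 * EE d 1 1 = EE d 1 1 * EE d 0 0 ∧
    EE d 0 0 * EE d 1 1 = EE d 0 0 * T d (swap 0 1) (swap 0 1) * EE d 0 0 ∧
    EE d 0 0 * EE d 1 1 * T d (swap 0 1) (swap 0 1) = EE d 0 0 * EE d 1 1 := by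
  have b1 := d.braid1 hr ht
  have b2 := d.braid2 hr ht
  rw [sw01 hr, sw01 ht] at b1 b2
  have tt : T d (swap 0 1) (swap 0 1) * T d (swap 0 1) (swap 0 1) = 1 := by
    rw [T_mul]; simp [T_one]
  have b1' : d.e * T d (swap 0 1) (swap 0 1) * d.e * T d (swap 0 1) (swap 0 1)
      = d.e * T d (swap 0 1) (swap 0 1) * d.e := by
    have := congrArg (· * d.σb (swap 0 1)) b1
    simp only [mul_assoc, σb_swap_sq, mul_one] at this
    simp only [T, mul_assoc, this]
  have b2' : T d (swap 0 1) (swap 0 1) * d.e * T d (swap 0 1) (swap 0 1) * d.e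
      = d.e * T d (swap 0 1) (swap 0 1) * d.e := by
    have := congrArg (d.σb (swap 0 1) * ·) b2
    simp only [← mul_assoc, σb_swap_sq, one_mul] at this
    rw [← d.comm_σσb] at this
    simp only [T, ← mul_assoc, this]
  have h2 : EE d 1 1 = T d (swap 0 1) (swap 0 1) * d.e * T d (swap 0 1) (swap 0 1) := by
    have := T_EE d (swap 0 1) (swap 0 1) 0 0
    rw [swap_apply_left, swap_apply_left, EE_zero] at this
    rw [this, mul_assoc, tt, mul_one]
  have k1 : EE d 0 0 * EE d 1 1 = d.e * T d (swap 0 1) (swap 0 1) * d.e := by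
    rw [EE_zero, h2, ← b1']; simp only [mul_assoc]
  refine ⟨?_, ?_, ?_⟩
  · rw [k1, h2, EE_zero, b2']
  · rw [k1, EE_zero]
  · rw [k1, b1']

lemma T_swap_conj (g : Perm (Fin (r+1))) (h : Perm (Fin (t+1))) (a b a' b') :
    T d (swap (g a) (g b)) (swap (h a') (h b')) * T d g h =
    T d g h * T d (swap a b) (swap a' b') := by
  rw [T_mul, T_mul]
  congr 1 <;> rw [Equiv.mul_swap_eq_swap_mul]

lemma EE_comm {i i' j j'} (hi : i ≠ i') (hj : j ≠ j') :
    EE d i j * EE d i' j' = EE d i' j' * EE d i j := by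
  obtain ⟨g, rfl, rfl, h01, hn⟩ := exists_perm hi
  obtain ⟨h, rfl, rfl, h01', hn'⟩ := exists_perm hj
  apply T_cancel d (g := g) (h := h)
  rw [mul_assoc, ← T_EE, ← mul_assoc, ← T_EE, mul_assoc, (braid_aux d hn hn').1, mul_assoc,
    ← T_EE, ← mul_assoc, T_EE, mul_assoc]

lemma EE_T_EE {i i' j j'} (hi : i ≠ i') (hj : j ≠ j') :
    EE d i j * T d (swap i i') (swap j j') * EE d i j = EE d i j * EE d i' j' := by
  obtain ⟨g, rfl, rfl, h01, hn⟩ := exists_perm hi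
  obtain ⟨h, rfl, rfl, h01', hn'⟩ := exists_perm hj
  apply T_cancel d (g := g) (h := h)
  rw [mul_assoc, ← T_EE, mul_assoc, ← mul_assoc (T d (swap _ _) _), T_swap_conj, mul_assoc,
    ← mul_assoc, ← T_EE, mul_assoc, ← mul_assoc (EE d 0 0), ← (braid_aux d hn hn').2.1,
    mul_assoc (EE d (g 0) (h 0)), ← T_EE, ← mul_assoc (EE d (g 0) (h 0)), ← T_EE, mul_assoc]

lemma EE_EE_T {i i' j j'} (hi : i ≠ i') (hj : j ≠ j') :
    EE d i j * EE d i' j' * T d (swap i i') (swap j j') = EE d i j * EE d i' j' := by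
  obtain ⟨g, rfl, rfl, h01, hn⟩ := exists_perm hi
  obtain ⟨h, rfl, rfl, h01', hn'⟩ := exists_perm hj
  apply T_cancel d (g := g) (h := h)
  rw [mul_assoc, T_swap_conj, mul_assoc, ← mul_assoc (EE d (g 1) (h 1)), ← T_EE, mul_assoc,
    ← mul_assoc, ← T_EE, mul_assoc, ← mul_assoc (EE d 0 0), (braid_aux d hn hn').2.2,
    mul_assoc (EE d (g 0) (h 0)), ← T_EE, ← mul_assoc (EE d (g 0) (h 0)), ← T_EE, mul_assoc]

end
end BCaux


namespace BCaux
open Equiv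

section
variable {R A : Type} [CommRing R] [Ring A] [Algebra R A] {r t : ℕ} (d : WBC R A (r+1) (t+1))

lemma tr_eq (a b : Fin (r+1)) : d.tr (a+1) (b+1) = d.σ (swap a b) := by
  simp [WBC.tr, sw_fin]
lemma trb_eq (a b : Fin (t+1)) : d.trb (a+1) (b+1) = d.σb (swap a b) := by
  simp [WBC.trb, sw_fin]
lemma cn_eq (a : Fin (r+1)) : d.cn (a+1) = d.c a := by
  simp [WBC.cn, show (a:ℕ) < r+1 from a.2, -Order.lt_add_one_iff]
lemma cbn_eq (a : Fin (t+1)) : d.cbn (a+1) = d.cb a := by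
  simp [WBC.cbn, show (a:ℕ) < t+1 from a.2, -Order.lt_add_one_iff]
lemma E_eq (a : Fin (r+1)) (b : Fin (t+1)) : d.E (a+1) (b+1) = EE d a b := by
  have h1 := tr_eq d 0 a
  have h2 := trb_eq d 0 b
  simp only [Fin.val_zero, zero_add] at h1 h2
  rw [WBC.E, h1, h2, EE, T]
  rw [← d.comm_σσb]
  simp only [mul_assoc]

lemma sum_Ico_fin {B : Type} [AddCommMonoid B] (κ : ℕ) (f : ℕ → B) :
    ∑ j ∈ Finset.Ico 1 (κ+1), f j = ∑ j : Fin κ, f (j+1) := by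
  rw [Finset.sum_Ico_eq_sum_range, Finset.sum_range]
  simp [add_comm]

variable (K : Fin (r+1)) (K' : Fin (t+1))

/-- Embedding of small indices. -/
def lo {n : ℕ} (K : Fin n) (j : Fin K.val) : Fin n := ⟨j, j.2.trans K.2⟩

def lo' {n : ℕ} {K : Fin n} {m : ℕ} {L : Fin m} (h : K.val = L.val) (j : Fin K.val) : Fin m :=
  ⟨j, by have := j.2; have := L.2; omega⟩

lemma lo_ne {n : ℕ} (K : Fin n) (j : Fin K.val) : lo K j ≠ K := fun h => by
  have := congrArg Fin.val h
  have := j.2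
  simp [lo] at *
  omega

lemma lo'_ne {n : ℕ} {K : Fin n} {m : ℕ} {L : Fin m} (h : K.val = L.val) (j : Fin K.val) :
    lo' h j ≠ L := fun h => by
  have := congrArg Fin.val h
  have := j.2
  simp [lo'] at *
  omega

variable (hK : K.val = K'.val)

def XX : A := ∑ j : Fin K.val, (EE d K (lo' hK j) - d.σ (swap (lo K j) K))
def XXb : A := ∑ j : Fin K.val, (EE d (lo K j) K' - d.σb (swap (lo' hK j) K'))

lemma y_eq : d.y (K+1) = XX d K K' hK + d.c K * XX d K K' hK * d.c K := by
  rw [WBC.y, WBC.L, WBC.LL, sum_Ico_fin, sum_Ico_fin]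
  have h1 : ∀ j : Fin K.val, d.E (K+1) (j+1) = EE d K (lo' hK j) :=
    fun j => E_eq d K (lo' hK j)
  have h2 : ∀ j : Fin K.val, d.tr (j+1) (K+1) = d.σ (swap (lo K j) K) :=
    fun j => tr_eq d (lo K j) K
  simp only [WBC.Eb, h1, h2, cn_eq, XX, Finset.sum_sub_distrib, Finset.sum_add_distrib,
    mul_sub, sub_mul, Finset.mul_sum, Finset.sum_mul]
  abel

lemma yb_eq : d.yb (K+1) = XXb d K K' hK - d.cb K' * XXb d K K' hK * d.cb K' := by
  rw [WBC.yb, WBC.Lb, WBC.LLb, sum_Ico_fin, sum_Ico_fin]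
  have h1 : ∀ j : Fin K.val, d.E (j+1) (K+1) = EE d (lo K j) K' :=
    fun j => by have := E_eq d (lo K j) K'; rwa [← hK] at this
  have h2 : ∀ j : Fin K.val, d.trb (j+1) (K+1) = d.σb (swap (lo' hK j) K') :=
    fun j => by have := trb_eq d (lo' hK j) K'; rwa [← hK] at this
  have h3 : ∀ j : Fin K.val, d.cn (j+1) = d.c (lo K j) := fun j => cn_eq d (lo K j)
  have h4 : d.cbn (K+1) = d.cb K' := by rw [hK]; exact cbn_eq d K'
  have h5 : ∀ j : Fin K.val, d.Eb (j+1) (K+1) = d.cb K' * EE d (lo K j) K' * d.cb K' := by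
    intro j
    rw [WBC.Eb, h1, h3, c_EE, mul_assoc, EE_c, mul_assoc]
  simp only [h1, h2, h4, h5, XXb, Finset.sum_sub_distrib,
    mul_sub, sub_mul, Finset.mul_sum, Finset.sum_mul]
  abel

lemma XX_cb : XX d K K' hK * d.cb K' = d.cb K' * XX d K K' hK := by
  rw [XX, Finset.sum_mul, Finset.mul_sum]
  refine Finset.sum_congr rfl fun j _ => ?_
  rw [sub_mul, mul_sub, d.comm_σcb, cb_EE_comm d K' K _ (lo'_ne hK j).symm]

lemma XXb_c : XXb d K K' hK * d.c K = d.c K * XXb d K K' hK := by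
  rw [XXb, Finset.sum_mul, Finset.mul_sum]
  refine Finset.sum_congr rfl fun j _ => ?_
  rw [sub_mul, mul_sub, d.comm_σbc, c_EE_comm d K _ K' (lo_ne K j).symm]

lemma anti_pow {y c : A} (h : y * c = -(c * y)) (n : ℕ) : y ^ (2*n) * c = c * y ^ (2*n) := by
  have : Commute (y^2) c := by
    show y^2 * c = c * y^2
    rw [pow_two, mul_assoc, h, mul_neg, ← mul_assoc, h, neg_mul, neg_neg, mul_assoc]
  rw [pow_mul]
  exact this.pow_left n

lemma vanish_aux (h2 : IsUnit (2 : R)) {y : A} (h : y * d.c K = -(d.c K * y) ∧ y * d.cb K' = d.cb K' * y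
    ∨ y * d.cb K' = -(d.cb K' * y) ∧ y * d.c K = d.c K * y) (n : ℕ) :
    EE d K K' * y ^ (2*n) * EE d K K' = 0 := by
  have hc : y ^ (2*n) * d.c K = d.c K * y ^ (2*n) := by
    rcases h with h | h
    · exact anti_pow h.1 n
    · exact (Commute.pow_left h.2 (2*n))
  have hcb : y ^ (2*n) * d.cb K' = d.cb K' * y ^ (2*n) := by
    rcases h with h | h
    · exact (Commute.pow_left h.2 (2*n))
    · exact anti_pow h.1 n
  have h1 : (EE d K K' * d.c K) * y ^ (2*n) * (d.c K * EE d K K') =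
      (EE d K K' * d.cb K') * y ^ (2*n) * (d.cb K' * EE d K K') := by
    rw [EE_c, c_EE]
  have e1 : (EE d K K' * d.c K) * y ^ (2*n) * (d.c K * EE d K K') =
      EE d K K' * (d.c K * (y ^ (2*n) * d.c K)) * EE d K K' := by simp only [mul_assoc]
  have e2 : (EE d K K' * d.cb K') * y ^ (2*n) * (d.cb K' * EE d K K') =
      EE d K K' * (d.cb K' * (y ^ (2*n) * d.cb K')) * EE d K K' := by simp only [mul_assoc]
  rw [e1, e2, hc, hcb, ← mul_assoc (d.c K), ← mul_assoc (d.cb K'), d.c_sq, d.cb_sq] at h1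
  simp only [mul_neg, one_mul, neg_mul] at h1
  set x := EE d K K' * y ^ (2*n) * EE d K K'
  have h3 : (2 : R) • x = 0 := by
    rw [two_smul]; nth_rewrite 1 [← h1]; simp
  obtain ⟨u, hu⟩ := h2
  rw [← hu] at h3
  have := congrArg (fun z => (↑u⁻¹ : R) • z) h3
  simpa [smul_smul] using this

lemma vanish_y (hK : K.val = K'.val) (h2 : IsUnit (2 : R)) (n : ℕ) :
    EE d K K' * d.y (K+1) ^ (2*n) * EE d K K' = 0 := by
  apply vanish_aux d K K' h2
  left
  rw [y_eq d K K' hK]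
  constructor
  · rw [add_mul, mul_add, mul_assoc _ (d.c K) (d.c K), ← mul_assoc (d.c K) (_ * _), ← mul_assoc (d.c K) (d.c K), d.c_sq]
    simp
  · have hx := XX_cb d K K' hK
    have ha := d.anti_ccb K K'
    rw [add_mul, mul_add, hx, mul_assoc, ha, mul_neg, ← mul_assoc, mul_assoc (d.c K), hx,
      ← mul_assoc, ha]
    simp [mul_assoc]

lemma vanish_yb (hK : K.val = K'.val) (h2 : IsUnit (2 : R)) (n : ℕ) :
    EE d K K' * d.yb (K+1) ^ (2*n) * EE d K K' = 0 := by
  apply vanish_aux d K K' h2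
  right
  rw [yb_eq d K K' hK]
  constructor
  · rw [sub_mul, mul_sub, mul_assoc _ (d.cb K') (d.cb K'), ← mul_assoc (d.cb K') (_ * _), ← mul_assoc (d.cb K') (d.cb K'), d.cb_sq]
    simp
  · have hx := XXb_c d K K' hK
    have ha : d.cb K' * d.c K = - (d.c K * d.cb K') := by rw [d.anti_ccb, neg_neg]
    rw [sub_mul, mul_sub, hx, mul_assoc, ha, mul_neg, ← mul_assoc, mul_assoc (d.cb K'), hx,
      ← mul_assoc, ha]
    simp [mul_assoc]

end
end BCaux


namespace BCaux
open Equiv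

section
variable {R A : Type} [CommRing R] [Ring A] [Algebra R A] {r t : ℕ} (d : WBC R A (r+1) (t+1))

def SS (m : ℕ) : Subalgebra R A := Algebra.adjoin R (d.lowerGens m)

lemma SS_e {m : ℕ} (h : 1 ≤ m) : d.e ∈ SS d m := Algebra.subset_adjoin (Or.inl ⟨h, rfl⟩)

lemma SS_c0 {m : ℕ} (h : 1 ≤ m) : d.c 0 ∈ SS d m := by
  have := cn_eq d 0
  simp at this
  rw [← this]
  exact Algebra.subset_adjoin (Or.inr (Or.inr (Or.inr (Or.inl ⟨h, rfl⟩))))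

lemma SS_cb0 {m : ℕ} (h : 1 ≤ m) : d.cb 0 ∈ SS d m := by
  have := cbn_eq d 0
  simp at this
  rw [← this]
  exact Algebra.subset_adjoin (Or.inr (Or.inr (Or.inr (Or.inr ⟨h, rfl⟩))))

lemma swaps_mem {n : ℕ} (τ : Perm (Fin (n+1)) →* A) (S : Subalgebra R A) (m : ℕ)
    (H : ∀ i : ℕ, i + 1 < m → τ (sw (n+1) i (i + 1)) ∈ S)
    (a b : Fin (n+1)) (ha : a.val < m) (hb : b.val < m) : τ (swap a b) ∈ S := by
  have h0 : ∀ i : ℕ, ∀ hi : i < n+1, i < m → τ (swap 0 ⟨i, hi⟩) ∈ S := by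
    intro i
    induction i with
    | zero =>
      intro hi _
      have : τ (swap 0 0) ∈ S := by
        rw [swap_self]; change τ 1 ∈ S; rw [map_one]; exact one_mem S
      exact this
    | succ i ih =>
      intro hi hm
      have h1 := ih (by omega) (by omega)
      have h2 := H i hm
      rw [show sw (n+1) i (i+1) = swap (⟨i, by omega⟩ : Fin (n+1)) ⟨i+1, hi⟩ from
        sw_fin (n+1) ⟨i, by omega⟩ ⟨i+1, hi⟩] at h2
      by_cases hi0 : i = 0
      · subst hi0; exact h2
      · have := swap_mul_swap_mul_swap (x := (0 : Fin (n+1)))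
          (y := ⟨i, by omega⟩) (z := ⟨i+1, hi⟩) (by simp [Fin.ext_iff]; omega)
          (by simp [Fin.ext_iff])
        rw [swap_comm, ← this, map_mul, map_mul]
        exact mul_mem (mul_mem h2 h1) h2
  by_cases hab : a = b
  · subst hab; rw [swap_self]; change τ 1 ∈ S; rw [map_one]; exact one_mem S
  by_cases ha0 : a = 0
  · subst ha0; exact h0 b b.2 hb
  by_cases hb0 : b = 0
  · subst hb0; rw [swap_comm]; exact h0 a a.2 ha
  have := swap_mul_swap_mul_swap (x := b) (y := 0) (z := a) hb0 (Ne.symm hab)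
  rw [← this, map_mul, map_mul, swap_comm b]
  exact mul_mem (mul_mem (h0 a a.2 ha) (h0 b b.2 hb)) (h0 a a.2 ha)

lemma SS_σ {m : ℕ} (a b : Fin (r+1)) (ha : a.val < m) (hb : b.val < m) :
    d.σ (swap a b) ∈ SS d m := by
  apply swaps_mem d.σ _ m _ a b ha hb
  intro i hi
  exact Algebra.subset_adjoin (Or.inr (Or.inl ⟨i+1, by omega, by omega, rfl⟩))

lemma SS_σb {m : ℕ} (a b : Fin (t+1)) (ha : a.val < m) (hb : b.val < m) :
    d.σb (swap a b) ∈ SS d m := by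
  apply swaps_mem d.σb _ m _ a b ha hb
  intro i hi
  exact Algebra.subset_adjoin (Or.inr (Or.inr (Or.inl ⟨i+1, by omega, by omega, rfl⟩)))

lemma SS_c {m : ℕ} (a : Fin (r+1)) (ha : a.val < m) : d.c a ∈ SS d m := by
  have h := d.c_conj (swap 0 a) 0
  rw [swap_apply_left, swap_inv] at h
  rw [← h]
  have := SS_σ d 0 a (m := m) (by simp; omega) ha
  exact mul_mem (mul_mem this (SS_c0 d (by omega))) this

lemma SS_cb {m : ℕ} (a : Fin (t+1)) (ha : a.val < m) : d.cb a ∈ SS d m := by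
  have h := d.cb_conj (swap 0 a) 0
  rw [swap_apply_left, swap_inv] at h
  rw [← h]
  have := SS_σb d 0 a (m := m) (by simp; omega) ha
  exact mul_mem (mul_mem this (SS_cb0 d (by omega))) this

lemma SS_EE {m : ℕ} (a : Fin (r+1)) (b : Fin (t+1)) (ha : a.val < m) (hb : b.val < m) :
    EE d a b ∈ SS d m := by
  have h1 := SS_σ d 0 a (m := m) (by simp; omega) ha
  have h2 := SS_σb d 0 b (m := m) (by simp; omega) hb
  exact mul_mem (mul_mem (mul_mem h1 h2) (SS_e d (by omega))) (mul_mem h1 h2)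

variable (K : Fin (r+1)) (K' : Fin (t+1))

/-- The properties of lower generators with respect to position `K`. -/
lemma gens_prop (hK : K.val = K'.val) {x : A} (hx : x ∈ d.lowerGens K.val) :
    x * EE d K K' = EE d K K' * x ∧
    ((d.c K * x = x * d.c K ∧ d.cb K' * x = x * d.cb K') ∨
     (d.c K * x = -x * d.c K ∧ d.cb K' * x = -x * d.cb K')) := by
  rcases hx with ⟨h, rfl⟩ | ⟨j, h1, h2, rfl⟩ | ⟨j, h1, h2, rfl⟩ | ⟨h, rfl⟩ | ⟨h, rfl⟩
  · have hK0 : K ≠ 0 := fun h0 => by rw [h0] at h; simp at h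
    have hK0' : K' ≠ 0 := fun h0 => by rw [hK, h0] at h; simp at h
    rw [← EE_zero]
    exact ⟨EE_comm d hK0.symm hK0'.symm, Or.inl ⟨c_EE_comm d _ _ _ hK0, cb_EE_comm d _ _ _ hK0'⟩⟩
  · have e1 : d.s j = d.σ (swap ⟨j-1, by have := K.2; omega⟩ ⟨j, by have := K.2; omega⟩) := by
      rw [WBC.s]; congr 1
      exact sw_fin (r+1) ⟨j-1, by have := K.2; omega⟩ ⟨j, by have := K.2; omega⟩
    have e2 : (swap (⟨j-1, by have := K.2; omega⟩ : Fin (r+1))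
        ⟨j, by have := K.2; omega⟩) K = K := by
      apply swap_apply_of_ne_of_ne
      · intro h; have := congrArg Fin.val h; simp at this; omega
      · intro h; have := congrArg Fin.val h; simp at this; omega
    rw [e1]
    refine ⟨?_, Or.inl ⟨?_, ?_⟩⟩
    · rw [σ_EE, e2]
    · rw [σ_c, e2]
    · rw [d.comm_σcb]
  · have e1 : d.sb j = d.σb (swap ⟨j-1, by have := K'.2; omega⟩ ⟨j, by have := K'.2; omega⟩) := by
      rw [WBC.sb]; congr 1
      exact sw_fin (t+1) ⟨j-1, by have := K'.2; omega⟩ ⟨j, by have := K'.2; omega⟩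
    have e2 : (swap (⟨j-1, by have := K'.2; omega⟩ : Fin (t+1))
        ⟨j, by have := K'.2; omega⟩) K' = K' := by
      apply swap_apply_of_ne_of_ne
      · intro h; have := congrArg Fin.val h; simp at this; omega
      · intro h; have := congrArg Fin.val h; simp at this; omega
    rw [e1]
    refine ⟨?_, Or.inl ⟨?_, ?_⟩⟩
    · rw [σb_EE, e2]
    · rw [d.comm_σbc]
    · rw [σb_cb, e2]
  · have hK0 : K ≠ 0 := fun h0 => by rw [h0] at h; simp at h
    have e1 := cn_eq d 0
    simp at e1
    rw [e1]
    refine ⟨c_EE_comm d _ _ _ hK0.symm, Or.inr ⟨?_, ?_⟩⟩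
    · rw [d.c_anti _ _ hK0]; simp
    · rw [neg_mul, d.anti_ccb]; simp
  · have hK0' : K' ≠ 0 := fun h0 => by rw [hK, h0] at h; simp at h
    have e1 := cbn_eq d 0
    simp at e1
    rw [e1]
    refine ⟨cb_EE_comm d _ _ _ hK0'.symm, Or.inr ⟨?_, ?_⟩⟩
    · rw [d.anti_ccb]; simp
    · rw [d.cb_anti _ _ hK0']; simp

lemma SS_comm_EE (hK : K.val = K'.val) {x : A} (hx : x ∈ SS d K.val) :
    x * EE d K K' = EE d K K' * x := by
  induction hx using Algebra.adjoin_induction with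
  | mem x hx => exact (gens_prop d K K' hK hx).1
  | algebraMap a => exact Algebra.commutes _ _
  | add x y _ _ h1 h2 => rw [add_mul, mul_add, h1, h2]
  | mul x y _ _ h1 h2 => rw [mul_assoc, h2, ← mul_assoc, h1, mul_assoc]

lemma SS_super (hK : K.val = K'.val) {x : A} (hx : x ∈ SS d K.val) :
    ∃ x' ∈ SS d K.val, d.c K * x = x' * d.c K ∧ d.cb K' * x = x' * d.cb K' := by
  induction hx using Algebra.adjoin_induction with
  | mem x hx =>
    have hx' : x ∈ SS d K.val := Algebra.subset_adjoin hx
    rcases (gens_prop d K K' hK hx).2 with h | h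
    · exact ⟨x, hx', h⟩
    · exact ⟨-x, neg_mem hx', h⟩
  | algebraMap a => exact ⟨algebraMap R A a, Subalgebra.algebraMap_mem _ _,
      (Algebra.commutes _ _).symm, (Algebra.commutes _ _).symm⟩
  | add x y _ _ h1 h2 =>
    obtain ⟨x', hx', a1, a2⟩ := h1
    obtain ⟨y', hy', b1, b2⟩ := h2
    exact ⟨x' + y', add_mem hx' hy', by rw [mul_add, add_mul, a1, b1],
      by rw [mul_add, add_mul, a2, b2]⟩
  | mul x y _ _ h1 h2 =>
    obtain ⟨x', hx', a1, a2⟩ := h1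
    obtain ⟨y', hy', b1, b2⟩ := h2
    exact ⟨x' * y', mul_mem hx' hy', by rw [← mul_assoc, a1, mul_assoc, b1, mul_assoc],
      by rw [← mul_assoc, a2, mul_assoc, b2, mul_assoc]⟩

lemma SS_c_right (hK : K.val = K'.val) {x : A} (hx : x ∈ SS d K.val) :
    ∃ x' ∈ SS d K.val, x * d.c K = d.c K * x' := by
  obtain ⟨x', hx', h, -⟩ := SS_super d K K' hK hx
  refine ⟨x', hx', ?_⟩
  have : d.c K * (d.c K * x) * d.c K = d.c K * (x' * d.c K) * d.c K := by rw [h]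
  simp only [← mul_assoc, d.c_sq] at this
  rw [mul_assoc _ (d.c K) (d.c K), d.c_sq] at this
  simpa using this

lemma cb_S_EE (hK : K.val = K'.val) {x : A} (hx : x ∈ SS d K.val) :
    d.cb K' * x * EE d K K' = d.c K * x * EE d K K' := by
  obtain ⟨x', hx', h, h'⟩ := SS_super d K K' hK hx
  rw [h, h', mul_assoc, mul_assoc, c_EE]

end
end BCaux


namespace BCaux
open Equiv

section
variable {R A : Type} [CommRing R] [Ring A] [Algebra R A] {r t : ℕ} (d : WBC R A (r+1) (t+1))
variable (K : Fin (r+1)) (K' : Fin (t+1))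

def QQ : Set A := {x | ∃ s ∈ SS d K.val, ∃ s' ∈ SS d K.val, x = s + d.c K * s'}

lemma QQ_S (hK : K.val = K'.val) {s q : A} (hs : s ∈ SS d K.val) (hq : q ∈ QQ d K) :
    s * q ∈ QQ d K := by
  obtain ⟨a, ha, b, hb, rfl⟩ := hq
  obtain ⟨s', hs', h⟩ := SS_c_right d K K' hK hs
  refine ⟨s * a, mul_mem hs ha, s' * b, mul_mem hs' hb, ?_⟩
  rw [mul_add, ← mul_assoc, ← mul_assoc, h]

lemma QQ_c {q : A} (hq : q ∈ QQ d K) : d.c K * q ∈ QQ d K := by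
  obtain ⟨a, ha, b, hb, rfl⟩ := hq
  refine ⟨-b, neg_mem hb, a, ha, ?_⟩
  rw [mul_add, ← mul_assoc, d.c_sq]; simp [add_comm]

def GG : Set A := {x | ∃ i : Fin (r+1), ∃ j : Fin (t+1), i ≤ K ∧ j ≤ K' ∧ ∃ q ∈ QQ d K,
  x = T d (swap i K) (swap j K') * (q * EE d K K')}

def NN : Submodule R A := Submodule.span R (GG d K K')

lemma NN_closed {f : A} (h : ∀ x ∈ GG d K K', f * x ∈ NN d K K') {x : A} (hx : x ∈ NN d K K') :
    f * x ∈ NN d K K' := by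
  induction hx using Submodule.span_induction with
  | mem x hx => exact h x hx
  | zero => simp
  | add x y _ _ h1 h2 => rw [mul_add]; exact add_mem h1 h2
  | smul a x _ h1 => rw [mul_smul_comm]; exact Submodule.smul_mem _ _ h1

lemma NN_gen {i : Fin (r+1)} {j : Fin (t+1)} (hi : i ≤ K) (hj : j ≤ K') {q : A}
    (hq : q ∈ QQ d K) : T d (swap i K) (swap j K') * (q * EE d K K') ∈ NN d K K' :=
  Submodule.subset_span ⟨i, j, hi, hj, q, hq, rfl⟩

lemma T_self : T d (swap K K) (swap K' K') = 1 := by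
  rw [swap_self, swap_self]; exact T_one d

lemma NN_Q {q : A} (hq : q ∈ QQ d K) : q * EE d K K' ∈ NN d K K' := by
  have := NN_gen d K K' le_rfl le_rfl hq
  rwa [T_self, one_mul] at this

lemma QQ_of_SS {s : A} (hs : s ∈ SS d K.val) : s ∈ QQ d K :=
  ⟨s, hs, 0, zero_mem _, by simp⟩
lemma QQ_of_cSS {s : A} (hs : s ∈ SS d K.val) : d.c K * s ∈ QQ d K :=
  ⟨0, zero_mem _, s, hs, by simp⟩

lemma cb_QQ (hK : K.val = K'.val) {q : A} (hq : q ∈ QQ d K) :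
    ∃ q' ∈ QQ d K, d.cb K' * (q * EE d K K') = q' * EE d K K' := by
  obtain ⟨a, ha, b, hb, rfl⟩ := hq
  refine ⟨d.c K * a + b, ⟨b, hb, a, ha, by abel⟩, ?_⟩
  have h1 := cb_S_EE d K K' hK ha
  have h2 := cb_S_EE d K K' hK hb
  have h3 : d.cb K' * d.c K = -(d.c K * d.cb K') := by rw [d.anti_ccb, neg_neg]
  rw [← mul_assoc, mul_add, add_mul, h1, add_mul, ← mul_assoc, h3, neg_mul, neg_mul,
    mul_assoc (d.c K) (d.cb K'), mul_assoc (d.c K) (d.cb K' * b), h2, ← mul_assoc, ← mul_assoc,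
    d.c_sq]
  simp

lemma lt_of_le_ne {n : ℕ} {i K : Fin n} (h : i ≤ K) (h' : i ≠ K) : i.val < K.val :=
  lt_of_le_of_ne h (fun hh => h' (Fin.ext hh))

lemma NN_c (hK : K.val = K'.val) {x : A} (hx : x ∈ NN d K K') : d.c K * x ∈ NN d K K' := by
  refine NN_closed d K K' ?_ hx
  rintro _ ⟨i, j, hi, hj, q, hq, rfl⟩
  have h1 := T_c d (swap i K) (swap j K') i
  rw [swap_apply_left] at h1
  rw [← mul_assoc, ← h1, mul_assoc, ← mul_assoc (d.c i)]
  refine NN_gen d K K' hi hj ?_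
  by_cases h : i = K
  · subst h; exact QQ_c d i hq
  · exact QQ_S d K K' hK (SS_c d i (lt_of_le_ne hi h)) hq

lemma NN_cb (hK : K.val = K'.val) {x : A} (hx : x ∈ NN d K K') : d.cb K' * x ∈ NN d K K' := by
  refine NN_closed d K K' ?_ hx
  rintro _ ⟨i, j, hi, hj, q, hq, rfl⟩
  have h1 := T_cb d (swap i K) (swap j K') j
  rw [swap_apply_left] at h1
  rw [← mul_assoc, ← h1, mul_assoc]
  by_cases h : j = K'
  · subst h
    obtain ⟨q', hq', e⟩ := cb_QQ d K j hK hq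
    rw [e]
    exact NN_gen d K j hi hj hq'
  · rw [← mul_assoc (d.cb j)]
    refine NN_gen d K K' hi hj ?_
    exact QQ_S d K K' hK (SS_cb d j (hK ▸ lt_of_le_ne hj h)) hq

lemma swap_conj_aux {n : ℕ} {a i K : Fin n} (hai : a ≠ i) (ha : a ≠ K) :
    swap a K * swap i K = swap i K * swap a i := by
  have : swap i K * swap a i = swap ((swap i K) a) ((swap i K) i) * swap i K :=
    Equiv.mul_swap_eq_swap_mul _ _ _
  rw [this, swap_apply_left, swap_apply_of_ne_of_ne hai ha]

lemma NN_σ (hK : K.val = K'.val) {a : Fin (r+1)} (ha : a ≤ K) {x : A} (hx : x ∈ NN d K K') :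
    d.σ (swap a K) * x ∈ NN d K K' := by
  by_cases haK : a = K
  · subst haK; rw [swap_self]; change d.σ 1 * x ∈ _; simpa using hx
  refine NN_closed d K K' ?_ hx
  rintro _ ⟨i, j, hi, hj, q, hq, rfl⟩
  rw [← T_left, ← mul_assoc, T_mul, one_mul]
  by_cases hai : a = i
  · subst hai
    rw [swap_mul_self]
    have := NN_gen d K K' le_rfl hj hq
    rwa [swap_self] at this
  by_cases hiK : i = K
  · subst hiK
    rw [swap_self]
    exact NN_gen d i K' ha hj hq
  · rw [swap_conj_aux hai haK]
    have : T d (swap i K * swap a i) (swap j K') = T d (swap i K) (swap j K') * d.σ (swap a i) := by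
      rw [← T_left, T_mul, mul_one]
    rw [this, mul_assoc, ← mul_assoc (d.σ _)]
    refine NN_gen d K K' hi hj ?_
    exact QQ_S d K K' hK (SS_σ d _ _ (lt_of_le_ne ha haK) (lt_of_le_ne hi hiK)) hq

lemma NN_σb (hK : K.val = K'.val) {a : Fin (t+1)} (ha : a ≤ K') {x : A} (hx : x ∈ NN d K K') :
    d.σb (swap a K') * x ∈ NN d K K' := by
  by_cases haK : a = K'
  · subst haK; rw [swap_self]; change d.σb 1 * x ∈ _; simpa using hx
  refine NN_closed d K K' ?_ hx
  rintro _ ⟨i, j, hi, hj, q, hq, rfl⟩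
  rw [← T_right, ← mul_assoc, T_mul, one_mul]
  by_cases hai : a = j
  · subst hai
    rw [swap_mul_self]
    have := NN_gen d K K' hi le_rfl hq
    rwa [swap_self] at this
  by_cases hiK : j = K'
  · subst hiK
    rw [swap_self]
    exact NN_gen d K j hi ha hq
  · rw [swap_conj_aux hai haK]
    have : T d (swap i K) (swap j K' * swap a j) = T d (swap i K) (swap j K') * d.σb (swap a j) := by
      rw [← T_right, T_mul, mul_one]
    rw [this, mul_assoc, ← mul_assoc (d.σb _)]
    refine NN_gen d K K' hi hj ?_
    exact QQ_S d K K' hK (SS_σb d _ _ (hK ▸ lt_of_le_ne ha haK) (hK ▸ lt_of_le_ne hj hiK)) hq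

lemma NN_EE_Q (hK : K.val = K'.val) {i : Fin (r+1)} {b : Fin (t+1)} (hi : i ≤ K) (hb : b ≤ K')
    {q : A} (hq : q ∈ QQ d K) : EE d i b * (q * EE d K K') ∈ NN d K K' := by
  by_cases h : i ≠ K ∧ b ≠ K'
  · rw [← mul_assoc]
    refine NN_Q d K K' (QQ_S d K K' hK (SS_EE d _ _ (lt_of_le_ne hi h.1) ?_) hq)
    exact hK ▸ lt_of_le_ne hb h.2
  obtain ⟨s, hs, s', hs', rfl⟩ := hq
  have cs := SS_comm_EE d K K' hK hs
  have cs' := SS_comm_EE d K K' hK hs'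
  by_cases h1 : i = K
  · subst h1
    by_cases h2 : b = K'
    · subst h2
      rw [add_mul, mul_assoc (d.c i), cs, cs', mul_add, ← mul_assoc, EE_sq, ← mul_assoc, ← mul_assoc,
        EE_c_EE]
      simp
    · rw [add_mul, ← cb_S_EE d i K' hK hs', mul_add, cs, mul_assoc (d.cb K'), cs']
      rw [← mul_assoc, ← mul_assoc (EE d i b), ← cb_EE_comm d _ _ _ (Ne.symm h2), mul_assoc (d.cb K'),
        ← mul_assoc (EE d i b), EE_EE_left d i h2, mul_assoc, mul_assoc, ← cs, ← cs']
      exact add_mem (NN_σb d i K' hK hb (NN_Q d i K' (QQ_of_SS d i hs)))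
        (NN_cb d i K' hK (NN_σb d i K' hK hb (NN_Q d i K' (QQ_of_SS d i hs'))))
  · have h2 : b = K' := by tauto
    subst h2
    rw [add_mul, mul_add, cs, mul_assoc (d.c K), cs']
    rw [← mul_assoc, ← mul_assoc (EE d i b), ← c_EE_comm d _ _ _ (Ne.symm h1), mul_assoc (d.c K),
        ← mul_assoc (EE d i b), EE_EE_right d b h1, mul_assoc, mul_assoc, ← cs, ← cs']
    exact add_mem (NN_σ d K b hK hi (NN_Q d K b (QQ_of_SS d K hs)))
        (NN_c d K b hK (NN_σ d K b hK hi (NN_Q d K b (QQ_of_SS d K hs'))))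

lemma swap_le {n : ℕ} {i K a : Fin n} (hi : i ≤ K) (ha : a ≤ K) : swap i K a ≤ K := by
  rw [swap_apply_def]; split_ifs <;> first | exact le_rfl | assumption

lemma NN_EE (hK : K.val = K'.val) {a : Fin (r+1)} {b : Fin (t+1)} (ha : a ≤ K) (hb : b ≤ K')
    {x : A} (hx : x ∈ NN d K K') : EE d a b * x ∈ NN d K K' := by
  refine NN_closed d K K' ?_ hx
  rintro _ ⟨i, j, hi, hj, q, hq, rfl⟩
  have h1 := T_EE d (swap i K) (swap j K') (swap i K a) (swap j K' b)
  rw [swap_apply_self, swap_apply_self] at h1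
  rw [← mul_assoc, ← h1, mul_assoc, T, mul_assoc]
  exact NN_σ d K K' hK hi (NN_σb d K K' hK hj
    (NN_EE_Q d K K' hK (swap_le hi ha) (swap_le hj hb) hq))

lemma NN_XX (hK : K.val = K'.val) {x : A} (hx : x ∈ NN d K K') : XX d K K' hK * x ∈ NN d K K' := by
  rw [XX, Finset.sum_mul]
  refine sum_mem fun j _ => ?_
  rw [sub_mul]
  have h1 : lo K j ≤ K := Fin.le_def.2 (le_of_lt j.2)
  have h2 : lo' hK j ≤ K' := Fin.le_def.2 (by have := j.2; simp only [lo']; omega)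
  exact sub_mem (NN_EE d K K' hK le_rfl h2 hx) (NN_σ d K K' hK h1 hx)

lemma NN_XXb (hK : K.val = K'.val) {x : A} (hx : x ∈ NN d K K') :
    XXb d K K' hK * x ∈ NN d K K' := by
  rw [XXb, Finset.sum_mul]
  refine sum_mem fun j _ => ?_
  rw [sub_mul]
  have h1 : lo K j ≤ K := Fin.le_def.2 (le_of_lt j.2)
  have h2 : lo' hK j ≤ K' := Fin.le_def.2 (by have := j.2; simp only [lo']; omega)
  exact sub_mem (NN_EE d K K' hK h1 le_rfl hx) (NN_σb d K K' hK h2 hx)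

lemma NN_y (hK : K.val = K'.val) {x : A} (hx : x ∈ NN d K K') : d.y (K+1) * x ∈ NN d K K' := by
  rw [y_eq d K K' hK, add_mul, mul_assoc, mul_assoc]
  exact add_mem (NN_XX d K K' hK hx) (NN_c d K K' hK (NN_XX d K K' hK (NN_c d K K' hK hx)))

lemma NN_yb (hK : K.val = K'.val) {x : A} (hx : x ∈ NN d K K') : d.yb (K+1) * x ∈ NN d K K' := by
  rw [yb_eq d K K' hK, sub_mul, mul_assoc, mul_assoc]
  exact sub_mem (NN_XXb d K K' hK hx) (NN_cb d K K' hK (NN_XXb d K K' hK (NN_cb d K K' hK hx)))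

lemma EE_σ_EE {i : Fin (r+1)} (h : K ≠ i) : EE d K K' * d.σ (swap i K) * EE d K K' = EE d K K' := by
  have h1 := σ_EE d (swap i K) K K'
  rw [swap_apply_right] at h1
  rw [mul_assoc, h1, ← mul_assoc, EE_EE_right d K' h, mul_assoc, ← h1, ← mul_assoc, swap_comm,
    σ_swap_sq, one_mul]

lemma EE_σb_EE {j : Fin (t+1)} (h : K' ≠ j) :
    EE d K K' * d.σb (swap j K') * EE d K K' = EE d K K' := by
  have h1 := σb_EE d (swap j K') K K'
  rw [swap_apply_right] at h1
  rw [mul_assoc, h1, ← mul_assoc, EE_EE_left d K h, mul_assoc, ← h1, ← mul_assoc, swap_comm,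
    σb_swap_sq, one_mul]

lemma EE_T_mem (hK : K.val = K'.val) {i : Fin (r+1)} {j : Fin (t+1)} (hi : i ≤ K) (hj : j ≤ K')
    (h : i ≠ K ∨ j ≠ K') :
    ∃ ω ∈ SS d K.val, EE d K K' * T d (swap i K) (swap j K') * EE d K K' = ω * EE d K K' := by
  by_cases h1 : i = K
  · subst h1
    have h2 : j ≠ K' := by tauto
    refine ⟨1, one_mem _, ?_⟩
    rw [swap_self]
    have := EE_σb_EE d i K' h2.symm
    rw [← T_right] at this
    rw [one_mul]; exact this
  by_cases h2 : j = K'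
  · subst h2
    refine ⟨1, one_mem _, ?_⟩
    rw [swap_self]
    have := EE_σ_EE d K j (Ne.symm h1)
    rw [← T_left] at this
    rw [one_mul]; exact this
  · refine ⟨EE d i j, SS_EE d _ _ (lt_of_le_ne hi h1) (hK ▸ lt_of_le_ne hj h2), ?_⟩
    rw [swap_comm i, swap_comm j, EE_T_EE d (Ne.symm h1) (Ne.symm h2),
      EE_comm d (Ne.symm h1) (Ne.symm h2)]

lemma EE_NN (hK : K.val = K'.val) {x : A} (hx : x ∈ NN d K K') :
    ∃ ω ∈ SS d K.val, EE d K K' * x = ω * EE d K K' := by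
  induction hx using Submodule.span_induction with
  | zero => exact ⟨0, zero_mem _, by simp⟩
  | add x y _ _ h1 h2 =>
    obtain ⟨a, ha, h1⟩ := h1
    obtain ⟨b, hb, h2⟩ := h2
    exact ⟨a + b, add_mem ha hb, by rw [mul_add, add_mul, h1, h2]⟩
  | smul a x _ h1 =>
    obtain ⟨b, hb, h1⟩ := h1
    exact ⟨a • b, Subalgebra.smul_mem _ hb a, by rw [mul_smul_comm, smul_mul_assoc, h1]⟩
  | mem x hx =>
    obtain ⟨i, j, hi, hj, q, ⟨s, hs, s', hs', rfl⟩, rfl⟩ := hx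
    have cs := SS_comm_EE d K K' hK hs
    have cs' := SS_comm_EE d K K' hK hs'
    by_cases h : i = K ∧ j = K'
    · obtain ⟨rfl, rfl⟩ := h
      refine ⟨0, zero_mem _, ?_⟩
      rw [T_self, one_mul]
      rw [add_mul, mul_assoc (d.c i), cs, cs', mul_add, ← mul_assoc, EE_sq, ← mul_assoc, ← mul_assoc,
        EE_c_EE]
      simp
    · obtain ⟨ω, hω, hE⟩ := EE_T_mem d K K' hK hi hj (by tauto)
      have k1 : EE d K K' * (T d (swap i K) (swap j K') * (s * EE d K K')) = ω * s * EE d K K' := by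
        rw [cs, ← mul_assoc, ← mul_assoc, hE, mul_assoc, ← cs, mul_assoc]
      by_cases h1 : i = K
      · have h2 : j ≠ K' := by tauto
        refine ⟨ω * s + d.cb j * ω * s', add_mem (mul_mem hω hs)
          (mul_mem (mul_mem (SS_cb d j (hK ▸ lt_of_le_ne hj h2)) hω) hs'), ?_⟩
        have k2 := T_cb d (swap i K) (swap j K') K'
        rw [swap_apply_right] at k2
        rw [add_mul, mul_add, mul_add, k1, ← cb_S_EE d K K' hK hs', mul_assoc (d.cb K'), cs',
          ← mul_assoc (T d _ _), k2, mul_assoc (d.cb j), ← mul_assoc (EE d K K'),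
          ← cb_EE_comm d _ _ _ h2, add_mul, mul_assoc (d.cb j), mul_assoc (d.cb j),
          ← mul_assoc (T d _ _), ← mul_assoc (EE d _ _), ← mul_assoc (EE d _ _), hE]
        simp only [mul_assoc, cs']
      · refine ⟨ω * s + d.c i * ω * s', add_mem (mul_mem hω hs)
          (mul_mem (mul_mem (SS_c d i (lt_of_le_ne hi h1)) hω) hs'), ?_⟩
        have k2 := T_c d (swap i K) (swap j K') K
        rw [swap_apply_right] at k2
        rw [add_mul, mul_add, mul_add, k1, mul_assoc (d.c K), cs',
          ← mul_assoc (T d _ _), k2, mul_assoc (d.c i), ← mul_assoc (EE d K K'),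
          ← c_EE_comm d _ _ _ h1, add_mul, mul_assoc (d.c i), mul_assoc (d.c i),
          ← mul_assoc (T d _ _), ← mul_assoc (EE d _ _), ← mul_assoc (EE d _ _), hE]
        simp only [mul_assoc, cs']

lemma pow_NN {y : A} (hy : ∀ x ∈ NN d K K', y * x ∈ NN d K K') (a : ℕ) :
    y ^ a * EE d K K' ∈ NN d K K' := by
  induction a with
  | zero =>
    have := NN_Q d K K' (QQ_of_SS d K (one_mem (SS d K.val)))
    simpa using this
  | succ n ih => rw [pow_succ', mul_assoc]; exact hy _ ih

lemma exists_y (hK : K.val = K'.val) (a : ℕ) : ∃ ω ∈ SS d K.val,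
    EE d K K' * d.y (K+1) ^ a * EE d K K' = ω * EE d K K' := by
  rw [mul_assoc]
  exact EE_NN d K K' hK (pow_NN d K K' (fun x hx => NN_y d K K' hK hx) a)

lemma exists_yb (hK : K.val = K'.val) (a : ℕ) : ∃ ω ∈ SS d K.val,
    EE d K K' * d.yb (K+1) ^ a * EE d K K' = ω * EE d K K' := by
  rw [mul_assoc]
  exact EE_NN d K K' hK (pow_NN d K K' (fun x hx => NN_yb d K K' hK hx) a)

end
end BCaux


namespace BCaux
open Equiv

section Clif
variable (R : Type) [CommRing R] (X : Type) [Fintype X] [DecidableEq X]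

def QF : QuadraticForm R (X → R) := QuadraticMap.weightedSumSquares R (fun _ : X => (-1 : R))

abbrev Cl : Type := CliffordAlgebra (QF R X)

variable {R X}

lemma QF_apply (v : X → R) : QF R X v = - ∑ x, v x * v x := by
  simp [QF]

def cc (x : X) : Cl R X := CliffordAlgebra.ι (QF R X) (Pi.single x 1)

lemma cc_sq (x : X) : (cc x : Cl R X) * cc x = -1 := by
  rw [cc, CliffordAlgebra.ι_sq_scalar, QF_apply]
  simp [Pi.single_apply]

lemma cc_anti {x y : X} (h : x ≠ y) : (cc x : Cl R X) * cc y = -(cc y * cc x) := by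
  apply CliffordAlgebra.ι_mul_ι_comm_of_isOrtho
  rw [QuadraticMap.isOrtho_def]
  simp only [QF_apply, Pi.add_apply, mul_add, add_mul, Finset.sum_add_distrib]
  simp [Pi.single_apply, h, h.symm]

lemma ι_sum (v : X → R) : CliffordAlgebra.ι (QF R X) v = ∑ x, v x • cc x := by
  conv_lhs => rw [pi_eq_sum_univ' v, map_sum]
  refine Finset.sum_congr rfl fun x _ => ?_
  rw [map_smul, cc]

lemma Cl_ind {P : Cl R X → Prop} (one : P 1) (add : ∀ x y, P x → P y → P (x + y))
    (smul : ∀ (a : R) x, P x → P (a • x)) (mul_cc : ∀ x m, P m → P (m * cc x)) (m : Cl R X) :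
    P m := by
  have zero : P 0 := by simpa using smul 0 1 one
  induction m using CliffordAlgebra.right_induction with
  | algebraMap a => rw [Algebra.algebraMap_eq_smul_one]; exact smul a 1 one
  | add x y hx hy => exact add x y hx hy
  | mul_ι v m hm =>
    rw [ι_sum, Finset.mul_sum]
    apply Finset.sum_induction _ P add zero
    intro x _
    rw [mul_smul_comm]
    exact smul _ _ (mul_cc x m hm)

def al : Cl R X →ₐ[R] Cl R X := CliffordAlgebra.involute

lemma al_cc (x : X) : al (cc x : Cl R X) = - cc x := CliffordAlgebra.involute_ι _
lemma al_al (m : Cl R X) : al (al m) = m := CliffordAlgebra.involute_involute _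

def D (u : X) : Cl R X →ₗ[R] Cl R X :=
  (CliffordAlgebra.contractRight (Q := QF R X)).flip (LinearMap.proj u)

lemma D_one (u : X) : D u (1 : Cl R X) = 0 := CliffordAlgebra.contractRight_one _ _
lemma D_D (u : X) (m : Cl R X) : D u (D u m) = 0 := CliffordAlgebra.contractRight_contractRight _ _
lemma D_comm (u v : X) (m : Cl R X) : D u (D v m) = - D v (D u m) :=
  CliffordAlgebra.contractRight_comm _ _ _
lemma D_mul_same (u : X) (m : Cl R X) : D u (m * cc u) = m - D u m * cc u := by
  have := CliffordAlgebra.contractRight_mul_ι (Q := QF R X) (LinearMap.proj u) (Pi.single u 1) m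
  simp only [LinearMap.proj_apply, Pi.single_eq_same, one_smul] at this
  exact this
lemma D_mul_ne {u x : X} (h : x ≠ u) (m : Cl R X) : D u (m * cc x) = - (D u m * cc x) := by
  have := CliffordAlgebra.contractRight_mul_ι (Q := QF R X) (LinearMap.proj u) (Pi.single x 1) m
  simp only [LinearMap.proj_apply, Pi.single_eq_of_ne h.symm, zero_smul, zero_sub] at this
  exact this

lemma D_al (u : X) (m : Cl R X) : D u (al m) = - al (D u m) := by
  induction m using Cl_ind with
  | one => simp [D_one]
  | add x y hx hy => simp only [map_add, hx, hy, neg_add]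
  | smul a x hx => simp only [map_smul, hx, smul_neg]
  | mul_cc x m hm =>
    rw [map_mul, al_cc, mul_neg, map_neg]
    by_cases h : x = u
    · subst h
      rw [D_mul_same, D_mul_same, hm]
      simp only [map_sub, map_mul, al_cc, neg_mul, mul_neg]
    · rw [D_mul_ne h, D_mul_ne h, hm]
      simp only [map_neg, map_mul, al_cc, neg_mul, mul_neg]

lemma D_cc_same (u : X) (m : Cl R X) : D u (cc u * m) = cc u * D u m + al m := by
  induction m using Cl_ind with
  | one =>
    have := D_mul_same u (1 : Cl R X)
    simpa [D_one] using this
  | add x y hx hy => simp only [mul_add, map_add, hx, hy]; abel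
  | smul a x hx => simp only [mul_smul_comm, map_smul, hx, smul_add]
  | mul_cc x m hm =>
    rw [← mul_assoc]
    by_cases h : x = u
    · subst h
      rw [D_mul_same, hm, D_mul_same, map_mul, al_cc]
      noncomm_ring
    · rw [D_mul_ne h, hm, D_mul_ne h, map_mul, al_cc]
      noncomm_ring

lemma D_cc_ne {u y : X} (hy : y ≠ u) (m : Cl R X) : D u (cc y * m) = cc y * D u m := by
  induction m using Cl_ind with
  | one =>
    have := D_mul_ne hy (1 : Cl R X)
    simpa [D_one] using this
  | add x y hx hy => simp only [mul_add, map_add, hx, hy]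
  | smul a x hx => simp only [mul_smul_comm, map_smul, hx]
  | mul_cc x m hm =>
    rw [← mul_assoc]
    by_cases h : x = u
    · subst h
      rw [D_mul_same, hm, D_mul_same]
      noncomm_ring
    · rw [D_mul_ne h, hm, D_mul_ne h]
      noncomm_ring

lemma cc_mul (u : X) (m : Cl R X) : cc u * m = al m * cc u - (al (D u m) + al (D u m)) := by
  induction m using Cl_ind with
  | one => simp [D_one]
  | add x y hx hy => simp only [mul_add, map_add, hx, hy, add_mul]; abel
  | smul a x hx => simp only [mul_smul_comm, map_smul, hx, smul_mul_assoc, smul_sub, smul_add]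
  | mul_cc x m hm =>
    rw [← mul_assoc, hm]
    by_cases h : x = u
    · subst h
      rw [D_mul_same, map_mul, al_cc, map_sub, map_mul, al_cc, sub_mul, mul_assoc, mul_neg, neg_mul,
        mul_assoc, cc_sq]
      noncomm_ring
    · rw [D_mul_ne h, map_mul, al_cc, map_neg, map_mul, al_cc, sub_mul, mul_assoc, mul_neg, neg_mul,
        mul_assoc, cc_anti h]
      noncomm_ring

def actIso (g : Perm X) : (QF R X).Isometry (QF R X) where
  toLinearMap := LinearMap.funLeft R R (g⁻¹ : Perm X)
  map_app' := by
    intro v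
    simp only [AddHom.toFun_eq_coe, LinearMap.coe_toAddHom, QF_apply, LinearMap.funLeft_apply]
    rw [Equiv.sum_comp (g⁻¹ : Perm X) (fun x => v x * v x)]

def act (g : Perm X) : Cl R X →ₐ[R] Cl R X := CliffordAlgebra.map (actIso g)

lemma act_cc (g : Perm X) (x : X) : act g (cc x : Cl R X) = cc (g x) := by
  rw [act, cc, CliffordAlgebra.map_apply_ι, cc]
  congr 1
  ext y
  show Pi.single x 1 (g⁻¹ y) = _
  simp only [Pi.single_apply]
  congr 1
  rw [Perm.inv_eq_iff_eq]

lemma act_mul (g h : Perm X) (m : Cl R X) : act (g * h) m = act g (act h m) := by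
  induction m using Cl_ind with
  | one => simp
  | add x y hx hy => simp only [map_add, hx, hy]
  | smul a x hx => simp only [map_smul, hx]
  | mul_cc x m hm => simp only [map_mul, hm, act_cc, Perm.mul_apply]

lemma act_one (m : Cl R X) : act (1 : Perm X) m = m := by
  induction m using Cl_ind with
  | one => simp
  | add x y hx hy => simp only [map_add, hx, hy]
  | smul a x hx => simp only [map_smul, hx]
  | mul_cc x m hm => simp only [map_mul, hm, act_cc, Perm.one_apply]

lemma act_al (g : Perm X) (m : Cl R X) : act g (al m) = al (act g m) := by
  induction m using Cl_ind with
  | one => simp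
  | add x y hx hy => simp only [map_add, hx, hy]
  | smul a x hx => simp only [map_smul, hx]
  | mul_cc x m hm => simp only [map_mul, hm, act_cc, al_cc, map_neg]

lemma act_D (g : Perm X) (u : X) (m : Cl R X) : D (g u) (act g m) = act g (D u m) := by
  induction m using Cl_ind with
  | one => simp [D_one]
  | add x y hx hy => simp only [map_add, hx, hy]
  | smul a x hx => simp only [map_smul, hx]
  | mul_cc x m hm =>
    rw [map_mul, act_cc]
    by_cases h : x = u
    · subst h; rw [D_mul_same, D_mul_same, hm, map_sub, map_mul, act_cc]
    · rw [D_mul_ne h, D_mul_ne (fun hh => h (g.injective hh)), hm, map_neg, map_mul, act_cc]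

lemma act_swap {a b : X} (hab : a ≠ b) (m : Cl R X) :
    act (swap a b) m = m + (D a m - D b m) * (cc b - cc a) := by
  induction m using Cl_ind with
  | one => simp [D_one]
  | add x y hx hy => simp only [map_add, hx, hy]; noncomm_ring
  | smul a x hx =>
    simp only [map_smul, hx, smul_add, ← smul_sub, smul_mul_assoc]
  | mul_cc x m hm =>
    rw [map_mul, act_cc, hm]
    by_cases h : x = a
    · subst h
      rw [swap_apply_left, D_mul_same, D_mul_ne hab]
      have h1 : (D x m - D b m) * cc b * cc b = -(D x m - D b m) := by
        rw [mul_assoc, cc_sq]; simp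
      have h2 : (D x m - D b m) * cc x * cc x = -(D x m - D b m) := by
        rw [mul_assoc, cc_sq]; simp
      have h3 : (D x m - D b m) * cc x * cc b = - ((D x m - D b m) * cc b * cc x) := by
        rw [mul_assoc, cc_anti hab]; simp [mul_assoc]
      generalize D x m = P at *
      generalize D b m = Q at *
      calc (m + (P - Q) * (cc b - cc x)) * cc b
          = m * cc b + ((P - Q) * cc b * cc b) - (P - Q) * cc x * cc b := by noncomm_ring
        _ = m * cc b - (P - Q) - (P - Q) * cc x * cc b := by rw [h1]; abel
        _ = m * cc b - (P - Q) * cc x * cc b + (P - Q) * cc x * cc x := by rw [h2]; abel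
        _ = _ := by noncomm_ring
    by_cases h' : x = b
    · subst h'
      rw [swap_apply_right, D_mul_same, D_mul_ne hab.symm]
      have h1 : (D a m - D x m) * cc x * cc x = -(D a m - D x m) := by
        rw [mul_assoc, cc_sq]; simp
      have h2 : (D a m - D x m) * cc a * cc a = -(D a m - D x m) := by
        rw [mul_assoc, cc_sq]; simp
      generalize D a m = P at *
      generalize D x m = Q at *
      calc (m + (P - Q) * (cc x - cc a)) * cc a
          = m * cc a + ((P - Q) * cc x * cc a) - (P - Q) * cc a * cc a := by noncomm_ring
        _ = m * cc a + ((P - Q) * cc x * cc a) - (P - Q) * cc x * cc x := by rw [h1, h2]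
        _ = _ := by noncomm_ring
    · rw [swap_apply_of_ne_of_ne h h', D_mul_ne h, D_mul_ne h', add_mul, mul_assoc _ (_ - _) (cc x)]
      have : (cc b - cc a : Cl R X) * cc x = - (cc x * (cc b - cc a)) := by
        rw [sub_mul, cc_anti (Ne.symm h'), cc_anti (Ne.symm h)]; noncomm_ring
      rw [this]
      noncomm_ring

/-- The contraction operator. -/
def Th (u x : X) : Cl R X →ₗ[R] Cl R X :=
  LinearMap.id + (LinearMap.mulRight R (cc x - cc u)) ∘ₗ D u

lemma Th_apply (u x : X) (m : Cl R X) : Th u x m = m + D u m * (cc x - cc u) := rfl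

lemma D_Th {u x : X} (h : x ≠ u) (m : Cl R X) : D u (Th u x m) = 0 := by
  rw [Th_apply, map_add, mul_sub, map_sub, D_mul_same, D_mul_ne h, D_D]; simp

lemma Th_of_D {u x : X} {m : Cl R X} (h : D u m = 0) : Th u x m = m := by
  rw [Th_apply, h]; simp

lemma Th_cc_ne {u x y : X} (h : y ≠ u) (m : Cl R X) : Th u x (cc y * m) = cc y * Th u x m := by
  rw [Th_apply, Th_apply, D_cc_ne h]; noncomm_ring

lemma Th_mul_same {u x : X} (m : Cl R X) : Th u x (al m * cc u) = al (Th u x m) * cc x := by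
  by_cases h : x = u
  · subst h; simp [Th_apply]
  have h1 : al (D u m) * cc u * cc u = - al (D u m) := by rw [mul_assoc, cc_sq]; simp
  have h2 : al (D u m) * cc x * cc x = - al (D u m) := by rw [mul_assoc, cc_sq]; simp
  rw [Th_apply, Th_apply, D_mul_same, D_al, map_add, map_mul, map_sub, al_cc, al_cc]
  generalize al (D u m) = P at *
  calc al m * cc u + (al m - -P * cc u) * (cc x - cc u)
      = al m * cc x + P * cc u * cc x - P * cc u * cc u := by noncomm_ring
    _ = al m * cc x + P * cc u * cc x - P * cc x * cc x := by rw [h1, h2]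
    _ = _ := by noncomm_ring

lemma Th_mul_ne {u x y : X} (hu : y ≠ u) (hx : y ≠ x) (m : Cl R X) :
    Th u x (al m * cc y) = al (Th u x m) * cc y := by
  have h1 : (cc x - cc u : Cl R X) * cc y = - (cc y * (cc x - cc u)) := by
    rw [sub_mul, cc_anti hx.symm, cc_anti hu.symm]; noncomm_ring
  rw [Th_apply, Th_apply, D_mul_ne hu, D_al, map_add, map_mul, map_sub, al_cc, al_cc, add_mul,
    mul_assoc _ (- cc x - - cc u)]
  have h2 : (- cc x - - cc u : Cl R X) = - (cc x - cc u) := by abel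
  rw [h2, neg_mul (cc x - cc u), h1]
  noncomm_ring

lemma Th_cc_same {u x : X} (h : x ≠ u) (m : Cl R X) :
    Th u x (cc u * m) = Th u x (al m * cc x) := by
  have h1 : al (D u m) * cc x * cc x = - al (D u m) := by rw [mul_assoc, cc_sq]; simp
  have h0 : D u (al (D u m)) = 0 := by rw [D_al, D_D]; simp
  have h3 : al (D u m) * cc u * cc x = - (al (D u m) * cc x * cc u) := by
    rw [mul_assoc, cc_anti h.symm]; simp [mul_assoc]
  rw [cc_mul, map_sub, map_add, Th_of_D h0, Th_mul_same]
  rw [Th_apply, Th_apply, D_mul_ne h, D_al, map_add, map_mul, map_sub, al_cc, al_cc]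
  generalize al (D u m) = P at *
  calc (al m + P * (-cc x - -cc u)) * cc x - (P + P)
      = al m * cc x - P * cc x * cc x + P * cc u * cc x - (P + P) := by noncomm_ring
    _ = al m * cc x + P * cc x * cc x - (P * cc x * cc u) := by rw [h1, h3]; abel
    _ = _ := by noncomm_ring

lemma cc_of_D {u : X} {m : Cl R X} (h : D u m = 0) : cc u * m = al m * cc u := by
  rw [cc_mul, h]; simp

lemma act_Th (g : Perm X) (u x : X) (m : Cl R X) :
    act g (Th u x m) = Th (g u) (g x) (act g m) := by
  rw [Th_apply, Th_apply, map_add, map_mul, map_sub, act_cc, act_cc, act_D]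

lemma act_swap_fix {a b : X} (hab : a ≠ b) {m : Cl R X} (ha : D a m = 0) (hb : D b m = 0) :
    act (swap a b) m = m := by
  rw [act_swap hab, ha, hb]; simp

/-- `Th u x (s n) = Th u' x n` if `D u n = 0`. -/
lemma Th_swap {u u' : X} (hu : u ≠ u') (x : X) {n : Cl R X} (h : D u n = 0) :
    Th u x (act (swap u u') n) = Th u' x n := by
  have h1 : D u (act (swap u u') n) = D u' n := by
    have := act_D (swap u u') u' n
    rw [swap_apply_right] at this
    rw [this, act_swap_fix hu _ (D_D _ _)]
    rw [D_comm, h]; simp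
  rw [Th_apply, h1, act_swap hu, h, Th_apply]
  noncomm_ring

lemma Th_Th_aux {u u' x x' : X} (hu : u ≠ u') (hx' : x' ≠ u') (m : Cl R X) :
    Th u' x (Th u x' m) = m + D u m * (cc x' - cc u) + D u' m * (cc x - cc u')
      + D u (D u' m) * ((cc x' - cc u) * (cc x - cc u')) := by
  have h1 : D u' (D u m * (cc x' - cc u)) = D u (D u' m) * (cc x' - cc u) := by
    rw [mul_sub, map_sub, D_mul_ne hx', D_mul_ne hu, D_comm u u' m]; noncomm_ring
  rw [Th_apply u x', Th_apply, map_add, h1]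
  noncomm_ring

lemma Th_Th_aux2 {u u' x' : X} (hu : u ≠ u') (m : Cl R X) :
    Th u' x' (Th u u' m) = m + D u m * (cc x' - cc u) + D u' m * (cc x' - cc u')
      + D u (D u' m) * ((cc u' - cc u) * (cc x' - cc u')) := by
  have h1 : D u' (D u m * (cc u' - cc u)) = D u m + D u (D u' m) * (cc u' - cc u) := by
    rw [mul_sub, map_sub, D_mul_same, D_mul_ne hu, D_comm u u' m]; noncomm_ring
  rw [Th_apply u u', Th_apply, map_add, h1]
  noncomm_ring

/-- generic case -/
lemma Th_Th_gen {u u' x x' : X} (hu : u ≠ u') (hx' : x' ≠ u') (hx : x ≠ u) (hxx : x ≠ x') (m : Cl R X) :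
    Th u x' (Th u' x m) = Th u' x (Th u x' m) := by
  rw [Th_Th_aux hu hx', Th_Th_aux hu.symm hx, D_comm u' u m]
  have : (cc x - cc u' : Cl R X) * (cc x' - cc u) = - ((cc x' - cc u) * (cc x - cc u')) := by
    simp only [mul_sub, sub_mul]
    rw [cc_anti hxx, cc_anti hx, cc_anti hx'.symm, cc_anti hu.symm]
    abel
  rw [this]
  noncomm_ring

lemma Th_Th_c2 {u u' x : X} (hu : u ≠ u') (hx : x ≠ u) (hx' : x ≠ u') (m : Cl R X) :
    Th u x (Th u' x m) = Th u' x (Th u u' m) := by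
  rw [Th_Th_aux hu.symm hx, Th_Th_aux2 hu, D_comm u' u m]
  have : (cc x - cc u' : Cl R X) * (cc x - cc u) = - ((cc u' - cc u) * (cc x - cc u')) := by
    simp only [mul_sub, sub_mul]
    rw [cc_anti hx, cc_sq, cc_sq, cc_anti hu.symm]
    abel
  rw [this]
  noncomm_ring

lemma Th_Th_c1 {u u' x : X} (hu : u ≠ u') (hx : x ≠ u) (hx' : x ≠ u') (m : Cl R X) :
    Th u x (Th u' u m) = Th u' x (Th u x m) := (Th_Th_c2 hu.symm hx' hx m).symm

end Clif
end BCaux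


namespace BCaux
open Equiv

section Mod
variable (R : Type) [CommRing R] (r t : ℕ)

abbrev PX : Type := Fin (r+1) ⊕ Fin (t+1)
abbrev MM : Type := Perm (PX r t) →₀ Cl R (PX r t)

variable {r t}
def uu (i : Fin (r+1)) : PX r t := Sum.inl i
def vv (j : Fin (t+1)) : PX r t := Sum.inr j

lemma uu_ne_vv (i : Fin (r+1)) (j : Fin (t+1)) : (uu i : PX r t) ≠ vv j := Sum.inl_ne_inr
lemma vv_ne_uu (i : Fin (r+1)) (j : Fin (t+1)) : (vv j : PX r t) ≠ uu i := Sum.inr_ne_inl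
lemma uu_inj {i i' : Fin (r+1)} : (uu i : PX r t) = uu i' ↔ i = i' := Sum.inl_injective.eq_iff
lemma vv_inj {i i' : Fin (t+1)} : (vv i : PX r t) = vv i' ↔ i = i' := Sum.inr_injective.eq_iff

def gl : Perm (Fin (r+1)) →* Perm (PX r t) where
  toFun g := Equiv.sumCongr g 1
  map_one' := by ext x; rcases x with x | x <;> rfl
  map_mul' g h := by ext x; rcases x with x | x <;> rfl

def gr : Perm (Fin (t+1)) →* Perm (PX r t) where
  toFun g := Equiv.sumCongr 1 g
  map_one' := by ext x; rcases x with x | x <;> rfl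
  map_mul' g h := by ext x; rcases x with x | x <;> rfl

lemma gl_uu (g : Perm (Fin (r+1))) (i) : (gl g : Perm (PX r t)) (uu i) = uu (g i) := rfl
lemma gl_vv (g : Perm (Fin (r+1))) (i) : (gl g : Perm (PX r t)) (vv i) = vv i := rfl
lemma gr_uu (g : Perm (Fin (t+1))) (i) : (gr g : Perm (PX r t)) (uu i) = uu i := rfl
lemma gr_vv (g : Perm (Fin (t+1))) (i) : (gr g : Perm (PX r t)) (vv i) = vv (g i) := rfl

lemma gl_gr (g : Perm (Fin (r+1))) (h : Perm (Fin (t+1))) :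
    (gl g : Perm (PX r t)) * gr h = gr h * gl g := by
  ext x; rcases x with x | x <;> rfl

lemma gl_swap (a b : Fin (r+1)) : (gl (swap a b) : Perm (PX r t)) = swap (uu a) (uu b) := by
  ext x
  rcases x with x | x
  · show Sum.inl (swap a b x) = swap (Sum.inl a) (Sum.inl b) (Sum.inl x)
    rw [swap_apply_def, swap_apply_def]
    simp only [Sum.inl.injEq]
    split_ifs <;> rfl
  · show Sum.inr x = swap (Sum.inl a) (Sum.inl b) (Sum.inr x)
    rw [swap_apply_of_ne_of_ne] <;> simp

lemma gr_swap (a b : Fin (t+1)) : (gr (swap a b) : Perm (PX r t)) = swap (vv a) (vv b) := by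
  ext x
  rcases x with x | x
  · show Sum.inl x = swap (Sum.inr a) (Sum.inr b) (Sum.inl x)
    rw [swap_apply_of_ne_of_ne] <;> simp
  · show Sum.inr (swap a b x) = swap (Sum.inr a) (Sum.inr b) (Sum.inr x)
    rw [swap_apply_def, swap_apply_def]
    simp only [Sum.inr.injEq]
    split_ifs <;> rfl

variable {R}
def op (f : Perm (PX r t) → Perm (PX r t))
    (F : Perm (PX r t) → (Cl R (PX r t) →ₗ[R] Cl R (PX r t))) : Module.End R (MM R r t) :=
  Finsupp.lsum R (fun w => Finsupp.lsingle (f w) ∘ₗ F w)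

lemma op_single (f F) (w : Perm (PX r t)) (m : Cl R (PX r t)) :
    op f F (Finsupp.single w m) = Finsupp.single (f w) (F w m) := by
  simp [op]

lemma end_ext {f g : Module.End R (MM R r t)}
    (h : ∀ w m, f (Finsupp.single w m) = g (Finsupp.single w m)) : f = g :=
  Finsupp.lhom_ext h

lemma act_one' : (act (1 : Perm (PX r t)) : Cl R (PX r t) →ₐ[R] _).toLinearMap = LinearMap.id := by
  ext m; exact act_one m

def oσ : Perm (Fin (r+1)) →* Module.End R (MM R r t) where
  toFun g := op (fun w => gl g * w) (fun _ => (act (gl g)).toLinearMap)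
  map_one' := by
    apply end_ext; intro w m
    rw [op_single]
    simp [act_one]
  map_mul' g h := by
    apply end_ext; intro w m
    rw [Module.End.mul_apply, op_single, op_single, op_single]
    simp [act_mul, mul_assoc]

lemma oσ_s (g : Perm (Fin (r+1))) (w) (m : Cl R (PX r t)) :
    oσ g (Finsupp.single w m) = Finsupp.single (gl g * w) (act (gl g) m) := op_single _ _ _ _

def oσb : Perm (Fin (t+1)) →* Module.End R (MM R r t) where
  toFun g := op (fun w => w * (gr g)⁻¹) (fun _ => LinearMap.id)
  map_one' := by
    apply end_ext; intro w m
    rw [op_single]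
    simp
  map_mul' g h := by
    apply end_ext; intro w m
    rw [Module.End.mul_apply, op_single, op_single, op_single]
    simp [mul_assoc]

lemma oσb_s (g : Perm (Fin (t+1))) (w) (m : Cl R (PX r t)) :
    oσb g (Finsupp.single w m) = Finsupp.single (w * (gr g)⁻¹) m := op_single _ _ _ _

def oc (i : Fin (r+1)) : Module.End R (MM R r t) :=
  op id (fun _ => LinearMap.mulLeft R (cc (uu i)))

lemma oc_s (i) (w) (m : Cl R (PX r t)) :
    oc i (Finsupp.single w m) = Finsupp.single w (cc (uu i) * m) := op_single _ _ _ _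

def ocb (j : Fin (t+1)) : Module.End R (MM R r t) :=
  op id (fun w => LinearMap.mulRight R (cc (w (vv j))) ∘ₗ al.toLinearMap)

lemma ocb_s (j) (w) (m : Cl R (PX r t)) :
    ocb j (Finsupp.single w m) = Finsupp.single w (al m * cc (w (vv j))) := op_single _ _ _ _

def oe : Module.End R (MM R r t) :=
  op (fun w => swap (uu 0) (w (vv 0)) * w) (fun w => if w (vv 0) = uu 0 then 0 else Th (uu 0) (w (vv 0)))

lemma oe_zero {w} (h : w (vv 0) = uu 0) (m : Cl R (PX r t)) : oe (Finsupp.single w m) = 0 := by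
  rw [oe, op_single, if_pos h]; simp

lemma oe_ne {w} (h : w (vv 0) ≠ uu 0) (m : Cl R (PX r t)) : oe (Finsupp.single w m) =
    Finsupp.single (swap (uu 0) (w (vv 0)) * w) (Th (uu 0) (w (vv 0)) m) := by
  rw [oe, op_single, if_neg h]

lemma oe_form (w) (m : Cl R (PX r t)) : oe (Finsupp.single w m) = 0 ∨
    ∃ W n, oe (Finsupp.single w m) = Finsupp.single W n ∧ W (vv 0) = uu 0 ∧ D (uu 0) n = 0 := by
  by_cases h : w (vv 0) = uu 0
  · left; exact oe_zero h m
  · right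
    refine ⟨_, _, oe_ne h m, ?_, D_Th h m⟩
    rw [Perm.mul_apply, swap_apply_right]

lemma end_ext_e {f g : Module.End R (MM R r t)}
    (h : ∀ w n, w (vv 0) = uu 0 → D (uu 0) n = 0 → f (Finsupp.single w n) = g (Finsupp.single w n)) :
    f * oe = g * oe := by
  apply end_ext; intro w m
  rw [Module.End.mul_apply, Module.End.mul_apply]
  rcases oe_form w m with h0 | ⟨W, n, h0, h1, h2⟩
  · rw [h0]; simp
  · rw [h0]; exact h W n h1 h2

lemma o_s_e (g : Perm (Fin (r+1))) (hg : g 0 = 0) :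
    (oσ g * oe : Module.End R (MM R r t)) = oe * oσ g := by
  apply end_ext; intro w m
  rw [Module.End.mul_apply, Module.End.mul_apply, oσ_s]
  have hg' : (gl g : Perm (PX r t)) (uu 0) = uu 0 := by rw [gl_uu, hg]
  have e1 : ((gl g : Perm (PX r t)) * w) (vv 0) = gl g (w (vv 0)) := rfl
  by_cases h : w (vv 0) = uu 0
  · rw [oe_zero h, oe_zero (by rw [e1, h, hg'])]; simp
  · have h' : ((gl g : Perm (PX r t)) * w) (vv 0) ≠ uu 0 := by
      rw [e1]; intro hh; apply h; apply (gl g : Perm (PX r t)).injective; rw [hh, hg']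
    rw [oe_ne h, oe_ne h', oσ_s, e1, act_Th, hg', ← mul_assoc, ← mul_assoc,
      Equiv.mul_swap_eq_swap_mul, hg']

lemma o_sb_e (g : Perm (Fin (t+1))) (hg : g 0 = 0) :
    (oσb g * oe : Module.End R (MM R r t)) = oe * oσb g := by
  apply end_ext; intro w m
  rw [Module.End.mul_apply, Module.End.mul_apply, oσb_s]
  have e1 : (w * (gr g)⁻¹ : Perm (PX r t)) (vv 0) = w (vv 0) := by
    rw [Perm.mul_apply]; congr 1; rw [Perm.inv_eq_iff_eq, gr_vv, hg]
  by_cases h : w (vv 0) = uu 0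
  · rw [oe_zero h, oe_zero (by rw [e1, h])]; simp
  · rw [oe_ne h, oe_ne (by rw [e1]; exact h), oσb_s, e1, mul_assoc]

lemma o_cb_e (j : Fin (t+1)) (hj : j ≠ 0) :
    (ocb j * oe : Module.End R (MM R r t)) = oe * ocb j := by
  apply end_ext; intro w m
  rw [Module.End.mul_apply, Module.End.mul_apply, ocb_s]
  by_cases h : w (vv 0) = uu 0
  · rw [oe_zero h, oe_zero h]; simp
  · rw [oe_ne h, oe_ne h, ocb_s]
    congr 1
    have hx : w (vv j) ≠ w (vv 0) := fun hh => hj (vv_inj.1 (w.injective hh))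
    rw [Perm.mul_apply]
    by_cases hu : w (vv j) = uu 0
    · rw [hu, swap_apply_left, Th_mul_same]
    · rw [swap_apply_of_ne_of_ne hu hx, Th_mul_ne hu hx]

lemma o_c_e (i : Fin (r+1)) (hi : i ≠ 0) :
    (oc i * oe : Module.End R (MM R r t)) = oe * oc i := by
  apply end_ext; intro w m
  rw [Module.End.mul_apply, Module.End.mul_apply, oc_s]
  by_cases h : w (vv 0) = uu 0
  · rw [oe_zero h, oe_zero h]; simp
  · rw [oe_ne h, oe_ne h, oc_s, Th_cc_ne (by rw [Ne, uu_inj]; exact hi)]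

lemma swapinv (a b : Fin (t+1)) : (gr (swap a b) : Perm (PX r t))⁻¹ = swap (vv a) (vv b) := by
  rw [gr_swap, swap_inv]

lemma o_ese (h : (0 : Fin (r+1)) ≠ 1) :
    (oe * oσ (swap 0 1) * oe : Module.End R (MM R r t)) = oe := by
  conv_rhs => rw [← one_mul oe]
  apply end_ext_e; intro w n hw hn
  have hu : (uu 0 : PX r t) ≠ uu 1 := by rw [Ne, uu_inj]; exact h
  have e1 : (swap (uu 0) (uu 1) * w : Perm (PX r t)) (vv 0) = uu 1 := by
    rw [Perm.mul_apply, hw, swap_apply_left]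
  rw [Module.End.mul_apply, oσ_s, gl_swap, oe_ne (by rw [e1]; exact hu.symm), e1, Th_swap hu _ hn,
    ← mul_assoc, swap_mul_self, one_mul, Th_apply, sub_self, mul_zero, add_zero]
  rfl

lemma o_esbe (h : (0 : Fin (t+1)) ≠ 1) :
    (oe * oσb (swap 0 1) * oe : Module.End R (MM R r t)) = oe := by
  conv_rhs => rw [← one_mul oe]
  apply end_ext_e; intro w n hw hn
  have hu : w (vv 1) ≠ uu 0 := by
    rw [← hw]; intro hh; exact h (vv_inj.1 (w.injective hh)).symm
  have e1 : (w * swap (vv 0) (vv 1) : Perm (PX r t)) (vv 0) = w (vv 1) := by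
    rw [Perm.mul_apply, swap_apply_left]
  rw [Module.End.mul_apply, oσb_s, swapinv, oe_ne (by rw [e1]; exact hu), e1, Th_of_D hn,
    Equiv.mul_swap_eq_swap_mul, hw, ← mul_assoc, swap_mul_self, one_mul]
  rfl

lemma o_braid2 (h : (0 : Fin (r+1)) ≠ 1) (h' : (0 : Fin (t+1)) ≠ 1) :
    (oσ (swap 0 1) * oe * oσ (swap 0 1) * oσb (swap 0 1) * oe : Module.End R (MM R r t))
     = oσb (swap 0 1) * oe * oσ (swap 0 1) * oσb (swap 0 1) * oe := by
  apply end_ext_e; intro w n hw hn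
  have hu : (uu 0 : PX r t) ≠ uu 1 := by rw [Ne, uu_inj]; exact h
  simp only [Module.End.mul_apply]
  rw [oσb_s, swapinv, oσ_s, gl_swap]
  have hy0 : w (vv 1) ≠ uu 0 := by
    rw [← hw]; intro hh; exact h' (vv_inj.1 (w.injective hh)).symm
  have e1 : (swap (uu 0) (uu 1) * (w * swap (vv 0) (vv 1)) : Perm (PX r t)) (vv 0) = swap (uu 0) (uu 1) (w (vv 1)) := by
    rw [Perm.mul_apply, Perm.mul_apply, swap_apply_left]
  by_cases hy : w (vv 1) = uu 1
  · rw [oe_zero (by rw [e1, hy, swap_apply_right])]; simp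
  · have e2 : swap (uu 0) (uu 1) (w (vv 1)) = w (vv 1) := swap_apply_of_ne_of_ne hy0 hy
    rw [oe_ne (by rw [e1, e2]; exact hy0), e1, e2]
    rw [oσb_s, swapinv, oσ_s, gl_swap, Th_swap hu _ hn]
    congr 1
    · rw [Equiv.mul_swap_eq_swap_mul (swap (uu 0) (w (vv 1)) * _)]
      simp only [Perm.mul_apply, swap_apply_left, swap_apply_right, hw, e2]
      rw [swap_apply_of_ne_of_ne hu.symm (Ne.symm hy)]
    · rw [act_swap_fix hu _ (D_Th hy n)]
      rw [← Th_swap hu _ hn, D_Th hy0]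

lemma four_swaps {X : Type} [DecidableEq X] {a b x y : X} (hab : a ≠ b) (hxy : x ≠ y) (hxa : x ≠ a)
    (hxb : x ≠ b) (hya : y ≠ a) (hyb : y ≠ b) :
    swap a y * swap b x * swap x y = swap a x * swap a b * swap a y := by
  have h1 : swap a y * swap b x = swap b x * swap a y := by
    rw [Equiv.mul_swap_eq_swap_mul, swap_apply_of_ne_of_ne hab.symm hyb.symm,
      swap_apply_of_ne_of_ne hxa hxy]
  have h2 : swap a x * swap a b = swap b x * swap a x := by
    rw [Equiv.mul_swap_eq_swap_mul, swap_apply_left, swap_apply_of_ne_of_ne hab.symm hxb.symm,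
      swap_comm x b]
  rw [h1, h2, mul_assoc, mul_assoc, Equiv.mul_swap_eq_swap_mul (swap a y),
    swap_apply_of_ne_of_ne hxa hxy, swap_apply_right, swap_comm x a]

lemma o_braid1 (h : (0 : Fin (r+1)) ≠ 1) (h' : (0 : Fin (t+1)) ≠ 1) :
    (oe * oσ (swap 0 1) * oσb (swap 0 1) * oe * oσ (swap 0 1) : Module.End R (MM R r t))
     = oe * oσ (swap 0 1) * oσb (swap 0 1) * oe * oσb (swap 0 1) := by
  apply end_ext; intro w m
  have hu : (uu 0 : PX r t) ≠ uu 1 := by rw [Ne, uu_inj]; exact h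
  simp only [Module.End.mul_apply]
  rw [oσb_s, swapinv, oσ_s, gl_swap]
  obtain ⟨x, hx⟩ : ∃ x, x = w (vv 0) := ⟨_, rfl⟩
  obtain ⟨x', hx'⟩ : ∃ x, x = w (vv 1) := ⟨_, rfl⟩
  have hxx : x ≠ x' := by
    rw [hx, hx']; intro hh; exact h' (vv_inj.1 (w.injective hh))
  have A1 : ∀ z, swap (uu 0) (uu 1) (swap (uu 0) (uu 1) z) = (z : PX r t) := fun z => swap_apply_self _ _ z
  have L0 : (swap (uu 0) (uu 1) * w : Perm (PX r t)) (vv 0) = swap (uu 0) (uu 1) x := by rw [hx]; rfl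
  have R0 : (w * swap (vv 0) (vv 1) : Perm (PX r t)) (vv 0) = x' := by rw [hx', Perm.mul_apply, swap_apply_left]
  have hws : w * swap (vv 0) (vv 1) = swap x x' * w := by rw [Equiv.mul_swap_eq_swap_mul, hx, hx']
  have hLne : swap (uu 0) (uu 1) x = uu 0 ↔ x = uu 1 := by
    constructor
    · intro hh; rw [← A1 x, hh, swap_apply_left]
    · rintro rfl; rw [swap_apply_right]
  have key : ∀ hL : x ≠ uu 1, oσ (swap 0 1) (oσb (swap 0 1) (oe (Finsupp.single (swap (uu 0) (uu 1) * w)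
      (act (swap (uu 0) (uu 1)) m)))) =
      (Finsupp.single (swap (uu 1) x * (swap x x' * w)) (Th (uu 1) x m) : MM R r t) := by
    intro hL
    rw [oe_ne (by rw [L0, Ne, hLne]; exact hL), L0, oσb_s, oσ_s, gl_swap, swapinv, act_Th,
      swap_apply_left, A1, ← act_mul, swap_mul_self, act_one]
    congr 1
    simp only [← mul_assoc]
    rw [Equiv.mul_swap_eq_swap_mul (swap (uu 0) (uu 1)), swap_apply_left, A1]
    simp only [mul_assoc]
    rw [hws, ← mul_assoc (swap (uu 0) (uu 1)) (swap (uu 0) (uu 1)), swap_mul_self, one_mul]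
  have keyR : ∀ hR : x' ≠ uu 0, oσ (swap 0 1) (oσb (swap 0 1) (oe (Finsupp.single (w * swap (vv 0) (vv 1))
      m))) = (Finsupp.single (swap (uu 0) (uu 1) * (swap (uu 0) x' * w))
        (act (swap (uu 0) (uu 1)) (Th (uu 0) x' m)) : MM R r t) := by
    intro hR
    rw [oe_ne (by rw [R0]; exact hR), R0, oσb_s, oσ_s, gl_swap, swapinv]
    congr 2
    rw [mul_assoc, mul_assoc, swap_mul_self, mul_one]
  have LE : (swap (uu 1) x * (swap x x' * w)) (vv 0) = swap (uu 1) x x' := by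
    simp only [Perm.mul_apply, ← hx, swap_apply_left]
  have RE : (swap (uu 0) (uu 1) * (swap (uu 0) x' * w) : Perm (PX r t)) (vv 0) =
      swap (uu 0) (uu 1) (swap (uu 0) x' x) := by
    simp only [Perm.mul_apply, ← hx]
  by_cases hL : x = uu 1
  · rw [oe_zero (by rw [L0, hLne]; exact hL)]
    by_cases hR : x' = uu 0
    · rw [oe_zero (by rw [R0]; exact hR)]
    · rw [keyR hR, oe_zero]
      · simp
      · rw [RE, hL, swap_apply_of_ne_of_ne hu.symm (by rw [← hL]; exact hxx), swap_apply_right]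
  by_cases hR : x' = uu 0
  · rw [oe_zero (w := w * swap (vv 0) (vv 1)) (by rw [R0]; exact hR), key hL, oe_zero]
    · simp
    · rw [LE, hR, swap_apply_of_ne_of_ne hu (by rw [← hR]; exact hxx.symm)]
  rw [key hL, keyR hR]
  by_cases h1 : x = uu 0
  · by_cases h2 : x' = uu 1
    · rw [oe_zero, oe_zero]
      · rw [RE, h1, h2, swap_apply_left, swap_apply_right]
      · rw [LE, h1, h2, swap_apply_left]
    · have LE' : (swap (uu 1) x * (swap x x' * w)) (vv 0) = x' := by
        rw [LE, swap_apply_of_ne_of_ne h2 hxx.symm]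
      have RE' : (swap (uu 0) (uu 1) * (swap (uu 0) x' * w) : Perm (PX r t)) (vv 0) = x' := by
        rw [RE, h1, swap_apply_left, swap_apply_of_ne_of_ne hR h2]
      rw [oe_ne (by rw [LE']; exact hR), oe_ne (by rw [RE']; exact hR), LE', RE',
        Th_swap hu _ (D_Th hR m), h1, Th_Th_c1 hu hR h2, swap_comm (uu 1)]
  by_cases h2 : x' = uu 1
  · have LE' : (swap (uu 1) x * (swap x x' * w)) (vv 0) = x := by
      rw [LE, h2, swap_apply_left]
    have RE' : (swap (uu 0) (uu 1) * (swap (uu 0) x' * w) : Perm (PX r t)) (vv 0) = x := by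
      rw [RE, h2, A1]
    rw [oe_ne (by rw [LE']; exact h1), oe_ne (by rw [RE']; exact h1), LE', RE',
        Th_swap hu _ (D_Th hR m), h2, Th_Th_c2 hu h1 hL, swap_comm x, ← mul_assoc (swap (uu 1) x),
        ← mul_assoc (swap (uu 0) (uu 1)), swap_mul_self, swap_mul_self]
  have LE' : (swap (uu 1) x * (swap x x' * w)) (vv 0) = x' := by
    rw [LE, swap_apply_of_ne_of_ne h2 hxx.symm]
  have RE' : (swap (uu 0) (uu 1) * (swap (uu 0) x' * w) : Perm (PX r t)) (vv 0) = x := by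
    rw [RE, swap_apply_of_ne_of_ne h1 hxx, swap_apply_of_ne_of_ne h1 hL]
  rw [oe_ne (by rw [LE']; exact hR), oe_ne (by rw [RE']; exact h1), LE', RE',
        Th_swap hu _ (D_Th hR m), Th_Th_gen hu h2 h1 hxx]
  congr 1
  simp only [← mul_assoc]
  congr 1
  exact four_swaps hu hxx h1 hL hR h2

variable (R r t)
def WM : WBC R (Module.End R (MM R r t)) (r+1) (t+1) where
  σ := oσ
  σb := oσb
  c := oc
  cb := ocb
  e := oe
  c_sq i := by
    apply end_ext; intro w m
    rw [Module.End.mul_apply, oc_s, oc_s, ← mul_assoc, cc_sq]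
    simp
  c_anti i j hij := by
    apply end_ext; intro w m
    rw [LinearMap.neg_apply, Module.End.mul_apply, Module.End.mul_apply, oc_s, oc_s, oc_s, oc_s, ← mul_assoc,
      cc_anti (by rw [Ne, uu_inj]; exact hij), neg_mul, Finsupp.single_neg, mul_assoc]
  c_conj g i := by
    apply end_ext; intro w m
    rw [Module.End.mul_apply, Module.End.mul_apply, oσ_s, oc_s, oσ_s, oc_s, map_mul, act_cc, gl_uu,
      ← act_mul, map_inv, mul_inv_cancel, act_one, mul_inv_cancel_left]
  cb_sq j := by
    apply end_ext; intro w m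
    rw [Module.End.mul_apply, ocb_s, ocb_s, map_mul, al_al, al_cc, mul_assoc, neg_mul, cc_sq]
    simp
  cb_anti i j hij := by
    apply end_ext; intro w m
    rw [LinearMap.neg_apply, Module.End.mul_apply, Module.End.mul_apply, ocb_s, ocb_s, ocb_s, ocb_s,
      map_mul, map_mul, al_al, al_cc, al_cc, mul_assoc, mul_assoc, neg_mul, neg_mul, 
      cc_anti (x := w (vv j)) (y := w (vv i))
        (by rw [Ne, w.injective.eq_iff, vv_inj]; exact hij.symm), ← Finsupp.single_neg]
    congr 1
    simp
  cb_conj g i := by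
    apply end_ext; intro w m
    rw [Module.End.mul_apply, Module.End.mul_apply, oσb_s, ocb_s, oσb_s, ocb_s]
    simp [Perm.mul_apply, gr_vv]
  comm_σσb g h := by
    apply end_ext; intro w m
    rw [Module.End.mul_apply, Module.End.mul_apply, oσb_s, oσ_s, oσ_s, oσb_s, mul_assoc]
  comm_σcb g j := by
    apply end_ext; intro w m
    rw [Module.End.mul_apply, Module.End.mul_apply, oσ_s, ocb_s, oσ_s, ocb_s, map_mul, act_al, act_cc]
    rfl
  comm_σbc g j := by
    apply end_ext; intro w m
    rw [Module.End.mul_apply, Module.End.mul_apply, oσb_s, oc_s, oσb_s, oc_s]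
  anti_ccb i j := by
    apply end_ext; intro w m
    rw [LinearMap.neg_apply, Module.End.mul_apply, Module.End.mul_apply, oc_s, ocb_s, ocb_s, oc_s,
      map_mul, al_cc, ← Finsupp.single_neg]
    congr 1
    simp [mul_assoc]
  e_c1 h1 h2 := by
    show oe * oc 0 = oe * ocb 0
    apply end_ext; intro w m
    rw [Module.End.mul_apply, Module.End.mul_apply, oc_s, ocb_s]
    by_cases h : w (vv 0) = uu 0
    · rw [oe_zero h, oe_zero h]
    · rw [oe_ne h, oe_ne h, Th_cc_same h]
  c1_e h1 h2 := by
    show oc 0 * oe = ocb 0 * oe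
    apply end_ext_e; intro w m hw hm
    rw [oc_s, ocb_s, hw, cc_of_D hm]
  e_sq := by
    rw [← zero_mul oe]
    apply end_ext_e; intro w m hw hm
    rw [oe_zero hw]; rfl
  e_s_e h := by rw [sw01 h]; exact o_ese (by intro hh; simp [Fin.ext_iff] at hh; omega)
  e_sb_e h := by rw [sw01 h]; exact o_esbe (by intro hh; simp [Fin.ext_iff] at hh; omega)
  s_e_comm i hi hr := by
    apply o_s_e
    rw [sw, dif_pos ⟨by omega, hr⟩, swap_apply_of_ne_of_ne] <;> simp [Fin.ext_iff] <;> omega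
  sb_e_comm i hi hr := by
    apply o_sb_e
    rw [sw, dif_pos ⟨by omega, hr⟩, swap_apply_of_ne_of_ne] <;> simp [Fin.ext_iff] <;> omega
  braid1 h h' := by
    rw [sw01 h, sw01 h']
    exact o_braid1 (by intro hh; simp [Fin.ext_iff] at hh; omega) (by intro hh; simp [Fin.ext_iff] at hh; omega)
  braid2 h h' := by
    rw [sw01 h, sw01 h']
    exact o_braid2 (by intro hh; simp [Fin.ext_iff] at hh; omega) (by intro hh; simp [Fin.ext_iff] at hh; omega)
  c_e_comm i hi := o_c_e i (by intro h; exact hi (by rw [h]; rfl))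
  cb_e_comm i hi := o_cb_e i (by intro h; exact hi (by rw [h]; rfl))
  e_c_e h := by
    rw [← zero_mul oe]
    apply end_ext_e; intro w m hw hm
    rw [Module.End.mul_apply, oc_s, oe_zero hw]; rfl
  e_cb_e h := by
    rw [← zero_mul oe]
    apply end_ext_e; intro w m hw hm
    rw [Module.End.mul_apply, ocb_s, oe_zero hw]; rfl

end Mod
end BCaux


namespace BCaux
open Equiv

section Mod2
variable {R : Type} [CommRing R] {r t : ℕ}

def rr (τ : Perm (PX r t)) : Module.End R (MM R r t) := op (fun w => w * τ) (fun _ => LinearMap.id)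

lemma rr_s (τ : Perm (PX r t)) (w) (m : Cl R (PX r t)) :
    rr τ (Finsupp.single w m) = Finsupp.single (w * τ) m := op_single _ _ _ _

lemma rr_c (τ : Perm (PX r t)) (i) : (rr τ * oc i : Module.End R (MM R r t)) = oc i * rr τ := by
  apply end_ext; intro w m
  rw [Module.End.mul_apply, Module.End.mul_apply, oc_s, rr_s, rr_s, oc_s]

lemma rr_σ (τ : Perm (PX r t)) (g) : (rr τ * oσ g : Module.End R (MM R r t)) = oσ g * rr τ := by
  apply end_ext; intro w m
  rw [Module.End.mul_apply, Module.End.mul_apply, oσ_s, rr_s, rr_s, oσ_s, mul_assoc]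

lemma rr_σb (τ : Perm (PX r t)) (g) (h : τ * (gr g)⁻¹ = (gr g)⁻¹ * τ) :
    (rr τ * oσb g : Module.End R (MM R r t)) = oσb g * rr τ := by
  apply end_ext; intro w m
  rw [Module.End.mul_apply, Module.End.mul_apply, oσb_s, rr_s, rr_s, oσb_s, mul_assoc, mul_assoc, h]

lemma rr_cb (τ : Perm (PX r t)) (j) (h : τ (vv j) = vv j) :
    (rr τ * ocb j : Module.End R (MM R r t)) = ocb j * rr τ := by
  apply end_ext; intro w m
  rw [Module.End.mul_apply, Module.End.mul_apply, ocb_s, rr_s, rr_s, ocb_s, Perm.mul_apply, h]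

lemma rr_e (τ : Perm (PX r t)) (h : τ (vv 0) = vv 0) :
    (rr τ * oe : Module.End R (MM R r t)) = oe * rr τ := by
  apply end_ext; intro w m
  rw [Module.End.mul_apply, Module.End.mul_apply, rr_s]
  have e1 : (w * τ) (vv 0) = w (vv 0) := by rw [Perm.mul_apply, h]
  by_cases hw : w (vv 0) = uu 0
  · rw [oe_zero hw, oe_zero (by rw [e1]; exact hw)]; simp
  · rw [oe_ne hw, oe_ne (by rw [e1]; exact hw), rr_s, e1, mul_assoc]

lemma EE_vac (i : Fin (r+1)) (j : Fin (t+1)) :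
    EE (WM R r t) i j (Finsupp.single 1 1) = Finsupp.single (swap (uu i) (vv j)) 1 := by
  have h1 : ∀ w : Perm (PX r t), ∀ m : Cl R (PX r t), T (WM R r t) (swap 0 i) (swap 0 j) (Finsupp.single w m)
      = Finsupp.single (swap (uu 0) (uu i) * w * swap (vv 0) (vv j)) (act (swap (uu 0) (uu i)) m) := by
    intro w m
    show oσ _ (oσb _ _) = _
    rw [oσb_s, oσ_s, swapinv, gl_swap, mul_assoc]
  rw [EE, Module.End.mul_apply, Module.End.mul_apply, h1]
  show T (WM R r t) (swap 0 i) (swap 0 j) (oe _) = _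
  have e1 : (swap (uu 0) (uu i) * 1 * swap (vv 0) (vv j) : Perm (PX r t)) (vv 0) = vv j := by
    rw [Perm.mul_apply, swap_apply_left, mul_one,
      swap_apply_of_ne_of_ne (vv_ne_uu _ _) (vv_ne_uu _ _)]
  rw [oe_ne (by rw [e1]; exact vv_ne_uu _ _), e1, h1, map_one, Th_of_D (D_one _), map_one]
  congr 1
  rw [← mul_assoc, Equiv.mul_swap_eq_swap_mul (swap (uu 0) (uu i)) (uu 0), swap_apply_left,
    swap_apply_of_ne_of_ne (vv_ne_uu _ _) (vv_ne_uu _ _), mul_one, mul_assoc, mul_assoc, mul_assoc,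
    swap_mul_self, mul_one, swap_mul_self, mul_one]

variable {A : Type} [Ring A] [Algebra R A] (d : WBC R A (r+1) (t+1))

lemma φ_EE {φ : A →ₐ[R] Module.End R (MM R r t)} (hφ : WBCHom d (WM R r t) φ) (i j) :
    φ (EE d i j) = EE (WM R r t) i j := by
  simp only [EE, T, map_mul, hφ.map_σ, hφ.map_σb, hφ.map_e]

variable (K : Fin (r+1)) (K' : Fin (t+1))

lemma φ_comm (hK : K.val = K'.val) {φ : A →ₐ[R] Module.End R (MM R r t)}
    (hφ : WBCHom d (WM R r t) φ) {x : A} (hx : x ∈ SS d K.val) :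
    rr (swap (uu K) (vv K')) * φ x = φ x * rr (swap (uu K) (vv K')) := by
  have fixv : ∀ j : Fin (t+1), j.val < K.val → swap (uu K : PX r t) (vv K') (vv j) = vv j := by
    intro j hj
    rw [swap_apply_of_ne_of_ne (vv_ne_uu _ _)]
    rw [Ne, vv_inj]; rintro rfl; omega
  induction hx using Algebra.adjoin_induction with
  | mem x hx =>
    rcases hx with ⟨h, rfl⟩ | ⟨j, h1, h2, rfl⟩ | ⟨j, h1, h2, rfl⟩ | ⟨h, rfl⟩ | ⟨h, rfl⟩
    · rw [hφ.map_e]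
      exact rr_e _ (fixv 0 (show (0 : ℕ) < K.val by omega))
    · rw [WBC.s, hφ.map_σ]
      exact rr_σ _ _
    · rw [WBC.sb, hφ.map_σb]
      apply rr_σb
      have hj : j < t + 1 := by have := K'.isLt; omega
      rw [sw, dif_pos ⟨by omega, hj⟩, swapinv, Equiv.mul_swap_eq_swap_mul,
        fixv _ (by show j - 1 < _; omega), fixv _ (by show j < _; omega)]
    · have := cn_eq d 0
      simp at this
      rw [this, hφ.map_c]
      exact rr_c _ _
    · have := cbn_eq d 0
      simp at this
      rw [this, hφ.map_cb]
      exact rr_cb _ _ (fixv 0 (show (0 : ℕ) < K.val by omega))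
  | algebraMap a => rw [AlgHom.commutes]; exact (Algebra.commutes _ _).symm
  | add x y _ _ hx hy => rw [map_add, mul_add, add_mul, hx, hy]
  | mul x y _ _ hx hy => rw [map_mul, ← mul_assoc, hx, mul_assoc, hy, mul_assoc]

lemma φ_vac_zero (hK : K.val = K'.val) {φ : A →ₐ[R] Module.End R (MM R r t)}
    (hφ : WBCHom d (WM R r t) φ) {x : A} (hx : x ∈ SS d K.val) (h0 : x * EE d K K' = 0) :
    φ x (Finsupp.single 1 1) = 0 := by
  have h1 : φ (x * EE d K K') (Finsupp.single 1 1) = 0 := by rw [h0]; simp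
  have h2 : (Finsupp.single (swap (uu K) (vv K')) 1 : MM R r t)
      = rr (swap (uu K) (vv K')) (Finsupp.single 1 1) := by rw [rr_s, one_mul]
  rw [map_mul, φ_EE d hφ, Module.End.mul_apply, EE_vac, h2, ← Module.End.mul_apply,
    ← φ_comm d K K' hK hφ hx, Module.End.mul_apply] at h1
  have h3 : ∀ v : MM R r t, rr (swap (uu K) (vv K')) (rr (swap (uu K) (vv K')) v) = v := by
    intro v
    rw [← Module.End.mul_apply]
    have : (rr (swap (uu K) (vv K')) * rr (swap (uu K) (vv K')) : Module.End R (MM R r t)) = 1 := by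
      apply end_ext; intro w m
      rw [Module.End.mul_apply, rr_s, rr_s, mul_assoc, swap_mul_self, mul_one]; rfl
    rw [this]; rfl
  rw [← h3 (φ x _), h1, map_zero]

end Mod2
end BCaux


namespace BCaux
open Equiv

section Rho
variable {R : Type} [CommRing R] {r t : ℕ}
variable {A : Type} [Ring A] [Algebra R A] (d : WBC R A (r+1) (t+1))

/-- `α` is the parity automorphism. -/
structure Par (α : A →ₐ[R] A) : Prop where
  σ : ∀ g, α (d.σ g) = d.σ g
  σb : ∀ g, α (d.σb g) = d.σb g
  e : α d.e = d.e
  c : ∀ i, α (d.c i) = - d.c i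
  cb : ∀ j, α (d.cb j) = - d.cb j
  invol : ∀ x, α (α x) = x

def negWBC : WBC R A (r+1) (t+1) where
  σ := d.σ
  σb := d.σb
  c i := - d.c i
  cb j := - d.cb j
  e := d.e
  c_sq i := by rw [neg_mul_neg, d.c_sq]
  c_anti i j h := by rw [neg_mul_neg, neg_mul_neg, d.c_anti i j h]
  c_conj w i := by rw [mul_neg, neg_mul, d.c_conj]
  cb_sq i := by rw [neg_mul_neg, d.cb_sq]
  cb_anti i j h := by rw [neg_mul_neg, neg_mul_neg, d.cb_anti i j h]
  cb_conj w i := by rw [mul_neg, neg_mul, d.cb_conj]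
  comm_σσb := d.comm_σσb
  comm_σcb w j := by rw [mul_neg, neg_mul, d.comm_σcb]
  comm_σbc w j := by rw [mul_neg, neg_mul, d.comm_σbc]
  anti_ccb i j := by rw [neg_mul_neg, neg_mul_neg, d.anti_ccb]
  e_c1 h1 h2 := by rw [mul_neg, mul_neg, d.e_c1]
  c1_e h1 h2 := by rw [neg_mul, neg_mul, d.c1_e]
  e_sq := d.e_sq
  e_s_e := d.e_s_e
  e_sb_e := d.e_sb_e
  s_e_comm := d.s_e_comm
  sb_e_comm := d.sb_e_comm
  braid1 := d.braid1
  braid2 := d.braid2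
  c_e_comm i h := by rw [neg_mul, mul_neg, d.c_e_comm i h]
  cb_e_comm i h := by rw [neg_mul, mul_neg, d.cb_e_comm i h]
  e_c_e h := by rw [mul_neg, neg_mul, d.e_c_e, neg_zero]
  e_cb_e h := by rw [mul_neg, neg_mul, d.e_cb_e, neg_zero]

lemma exists_par (hu : d.IsUniversal) : ∃ α : A →ₐ[R] A, Par d α := by
  obtain ⟨α, hα, -⟩ := hu A (negWBC d)
  refine ⟨α, hα.map_σ, hα.map_σb, hα.map_e, hα.map_c, hα.map_cb, ?_⟩
  obtain ⟨β, -, hβ'⟩ := hu A d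
  have hc : ∀ i, α (d.c i) = - d.c i := hα.map_c
  have hcb : ∀ i, α (d.cb i) = - d.cb i := hα.map_cb
  have hs : ∀ i, α (d.σ i) = d.σ i := hα.map_σ
  have hsb : ∀ i, α (d.σb i) = d.σb i := hα.map_σb
  have he : α d.e = d.e := hα.map_e
  have h1 : WBCHom d d (α.comp α) := by
    constructor
    · intro w; simp [hs]
    · intro w; simp [hsb]
    · intro w; simp [hc]
    · intro w; simp [hcb]
    · simp [he]
  have h2 : WBCHom d d (AlgHom.id R A) := by
    constructor <;> intros <;> rfl
  have h3 : α.comp α = AlgHom.id R A := (hβ' _ h1).trans (hβ' _ h2).symm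
  intro x
  exact congrArg (fun f : A →ₐ[R] A => f x) h3

variable {d} {α : A →ₐ[R] A} (hα : Par d α)

variable (d α) in
def ro (x : PX r t) : Module.End R A :=
  match x with
  | Sum.inl i => LinearMap.mulLeft R (d.c i)
  | Sum.inr j => LinearMap.mulRight R (d.cb j) ∘ₗ α.toLinearMap

lemma ro_u (i) (X : A) : ro d α (uu i) X = d.c i * X := rfl
lemma ro_v (j) (X : A) : ro d α (vv j) X = α X * d.cb j := rfl

lemma ro_sq (hα : Par d α) (x) : ro d α x * ro d α x = -1 := by
  ext X
  rw [Module.End.mul_apply]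
  rcases x with i | j
  · show d.c i * (d.c i * X) = - X
    rw [← mul_assoc, d.c_sq, neg_one_mul]
  · show α (α X * d.cb j) * d.cb j = - X
    rw [map_mul, hα.invol, hα.cb, mul_assoc, neg_mul, d.cb_sq, mul_neg, mul_one]

lemma ro_anti (hα : Par d α) {x y} (h : x ≠ y) : ro d α x * ro d α y = - (ro d α y * ro d α x) := by
  ext X
  rw [LinearMap.neg_apply, Module.End.mul_apply, Module.End.mul_apply]
  rcases x with i | j <;> rcases y with i' | j'
  · show d.c i * (d.c i' * X) = - (d.c i' * (d.c i * X))
    rw [← mul_assoc, d.c_anti i i' (by rintro rfl; exact h rfl), ← mul_assoc, neg_mul]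
  · show d.c i * (α X * d.cb j') = - (α (d.c i * X) * d.cb j')
    rw [map_mul, hα.c, neg_mul, neg_mul, neg_neg, mul_assoc]
  · show α (d.c i' * X) * d.cb j = - (d.c i' * (α X * d.cb j))
    rw [map_mul, hα.c, neg_mul, neg_mul, mul_assoc]
  · show α (α X * d.cb j') * d.cb j = - (α (α X * d.cb j) * d.cb j')
    rw [map_mul, map_mul, hα.cb, hα.cb, mul_assoc, mul_assoc, neg_mul, neg_mul,
      d.cb_anti j j' (by rintro rfl; exact h rfl)]
    simp

variable (d α) in
def rol : (PX r t → R) →ₗ[R] Module.End R A := Fintype.linearCombination R (ro d α)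

lemma rol_sq (hα : Par d α) (v : PX r t → R) :
    rol d α v * rol d α v = algebraMap R (Module.End R A) (QF R (PX r t) v) := by
  have key : ∀ s : Finset (PX r t), (∑ x ∈ s, v x • ro d α x) * (∑ x ∈ s, v x • ro d α x)
      = algebraMap R (Module.End R A) (- ∑ x ∈ s, v x * v x) := by
    intro s
    induction s using Finset.induction_on with
    | empty => simp
    | insert a s ha ih =>
      rw [Finset.sum_insert ha, Finset.sum_insert ha, add_mul, mul_add, mul_add, ih]
      have h1 : (v a • ro d α a) * (v a • ro d α a) = algebraMap R (Module.End R A) (- (v a * v a)) := by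
        rw [smul_mul_smul_comm, ro_sq hα, Algebra.algebraMap_eq_smul_one, smul_neg, neg_smul]
      have h2 : (v a • ro d α a) * (∑ x ∈ s, v x • ro d α x)
          = - ((∑ x ∈ s, v x • ro d α x) * (v a • ro d α a)) := by
        rw [Finset.mul_sum, Finset.sum_mul, ← Finset.sum_neg_distrib]
        refine Finset.sum_congr rfl fun x hx => ?_
        rw [smul_mul_smul_comm, smul_mul_smul_comm, ro_anti hα (x := a) (y := x)
          (by rintro rfl; exact ha hx), smul_neg, mul_comm]
      rw [h1, h2, neg_add, map_add]
      abel
  rw [QF_apply, ← key]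
  rfl

def rho (hα : Par d α) : Cl R (PX r t) →ₐ[R] Module.End R A :=
  CliffordAlgebra.lift (QF R (PX r t)) ⟨rol d α, rol_sq hα⟩

lemma rho_cc (x : PX r t) : rho hα (cc x) = ro d α x := by
  rw [rho, cc, CliffordAlgebra.lift_ι_apply]
  simp [rol, Fintype.linearCombination_apply_single]

lemma rho_mul_cc (m) (x : PX r t) (X : A) : rho hα (m * cc x) X = rho hα m (ro d α x X) := by
  rw [map_mul, rho_cc]; rfl

lemma rho_σ (g) (m : Cl R (PX r t)) (X : A) :
    d.σ g * rho hα m X = rho hα (act (gl g) m) (d.σ g * X) := by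
  induction m using Cl_ind generalizing X with
  | one => simp
  | add x y hx hy => simp only [map_add, LinearMap.add_apply, mul_add, hx, hy]
  | smul a x hx => simp only [map_smul, LinearMap.smul_apply, mul_smul_comm, hx]
  | mul_cc x m hm =>
    rw [rho_mul_cc, hm, map_mul (act (gl g)), act_cc, rho_mul_cc]
    congr 1
    rcases x with i | j
    · show d.σ g * (d.c i * X) = d.c (g i) * (d.σ g * X)
      rw [← mul_assoc, σ_c, mul_assoc]
    · show d.σ g * (α X * d.cb j) = α (d.σ g * X) * d.cb j
      rw [map_mul, hα.σ, mul_assoc]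

lemma rho_σb (g) (m : Cl R (PX r t)) (X : A) :
    d.σb g * rho hα m X = rho hα m (d.σb g * X) := by
  induction m using Cl_ind generalizing X with
  | one => simp
  | add x y hx hy => simp only [map_add, LinearMap.add_apply, mul_add, hx, hy]
  | smul a x hx => simp only [map_smul, LinearMap.smul_apply, mul_smul_comm, hx]
  | mul_cc x m hm =>
    rw [rho_mul_cc, hm, rho_mul_cc]
    congr 1
    rcases x with i | j
    · show d.σb g * (d.c i * X) = d.c i * (d.σb g * X)
      rw [← mul_assoc, d.comm_σbc, mul_assoc]
    · show d.σb g * (α X * d.cb j) = α (d.σb g * X) * d.cb j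
      rw [map_mul, hα.σb, mul_assoc]

lemma rho_c (i) (m : Cl R (PX r t)) (X : A) :
    d.c i * rho hα m X = rho hα (cc (uu i) * m) X := by
  rw [map_mul, rho_cc]; rfl

lemma rho_cb (j) (m : Cl R (PX r t)) (X : A) :
    d.cb j * rho hα m X = rho hα (al m) (d.cb j * X) := by
  induction m using Cl_ind generalizing X with
  | one => simp
  | add x y hx hy => simp only [map_add, LinearMap.add_apply, mul_add, hx, hy]
  | smul a x hx => simp only [map_smul, LinearMap.smul_apply, mul_smul_comm, hx]
  | mul_cc x m hm =>
    rw [rho_mul_cc, hm, map_mul al, al_cc, mul_neg, map_neg, LinearMap.neg_apply, rho_mul_cc, ← map_neg]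
    congr 1
    rcases x with i | j'
    · show d.cb j * (d.c i * X) = - (d.c i * (d.cb j * X))
      rw [← mul_assoc, ← mul_assoc, d.anti_ccb, neg_mul, neg_neg]
    · show d.cb j * (α X * d.cb j') = - (α (d.cb j * X) * d.cb j')
      rw [map_mul, hα.cb, neg_mul, neg_mul, neg_neg, mul_assoc]

lemma e_ro (hα : Par d α) {x : PX r t} (hx : x ≠ uu 0) (X : A) :
    d.e * ro d α x X = ro d α x (d.e * X) := by
  rcases x with i | j
  · show d.e * (d.c i * X) = d.c i * (d.e * X)
    have := d.c_e_comm i (by intro h; exact hx (congrArg Sum.inl (Fin.ext h)))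
    rw [← mul_assoc, ← this, mul_assoc]
  · show d.e * (α X * d.cb j) = α (d.e * X) * d.cb j
    rw [map_mul, hα.e, mul_assoc]

lemma rho_e (m : Cl R (PX r t)) (X : A) :
    d.e * rho hα m X = rho hα (m - D (uu 0) m * cc (uu 0)) (d.e * X)
      + rho hα (D (uu 0) m) (d.e * (d.c 0 * X)) := by
  induction m using Cl_ind generalizing X with
  | one => simp [D_one]
  | add x y hx hy =>
    simp only [map_add, LinearMap.add_apply, mul_add, hx, hy, add_mul, map_sub, LinearMap.sub_apply]
    abel
  | smul a x hx =>
    simp only [map_smul, LinearMap.smul_apply, mul_smul_comm, hx, smul_mul_assoc, ← smul_sub,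
      smul_add]
  | mul_cc x m hm =>
    rw [rho_mul_cc, hm]
    by_cases h : x = uu 0
    · subst h
      have h1 : m * cc (uu 0) - D (uu 0) (m * cc (uu 0)) * cc (uu 0) = - D (uu 0) m := by
        rw [D_mul_same, sub_mul, mul_assoc (D _ m), cc_sq]; simp
      have h2 : d.c 0 * (d.c 0 * X) = - X := by rw [← mul_assoc, d.c_sq, neg_one_mul]
      rw [h1, D_mul_same, ro_u, h2, map_neg, LinearMap.neg_apply, mul_neg, map_neg]
      abel
    · have h1 : m * cc x - D (uu 0) (m * cc x) * cc (uu 0)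
          = (m - D (uu 0) m * cc (uu 0)) * cc x := by
        rw [D_mul_ne h, sub_mul, mul_assoc (D _ m), cc_anti (Ne.symm h)]
        simp [mul_assoc]
      have h2 : d.c 0 * ro d α x X = - ro d α x (d.c 0 * X) := by
        have := ro_anti hα (x := uu 0) (y := x) (Ne.symm h)
        exact congrArg (fun f : Module.End R A => f X) this
      rw [h1, rho_mul_cc, D_mul_ne h, map_neg, LinearMap.neg_apply, rho_mul_cc, h2, mul_neg, map_neg,
        e_ro hα h, e_ro hα h]

/-- the action of `e` on `ρ(m) a` -/
lemma rho_e_zero {m : Cl R (PX r t)} {a : A} (h0 : d.e * a = 0) (h1 : d.e * (d.c 0 * a) = 0) :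
    d.e * rho hα m a = 0 := by
  rw [rho_e, h0, h1]; simp

lemma rho_e_ne {m : Cl R (PX r t)} {a : A} {x : PX r t} (hx : x ≠ uu 0)
    (h : d.cb 0 * a = ro d α x a) :
    d.e * rho hα m a = rho hα (Th (uu 0) x m) (d.e * a) := by
  have h1 : d.e * (d.c 0 * a) = ro d α x (d.e * a) := by
    rw [← e_ro hα hx, ← h, ← mul_assoc, ← mul_assoc]
    congr 1
    exact d.e_c1 (Nat.succ_pos _) (Nat.succ_pos _)
  rw [rho_e, h1, ← rho_mul_cc, ← LinearMap.add_apply, ← map_add, Th_apply]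
  congr 2
  rw [mul_sub]; abel

end Rho
end BCaux


namespace BCaux
open Equiv

section Combi
variable {R A : Type} [CommRing R] [Ring A] [Algebra R A] {r t : ℕ}

abbrev PL (r t : ℕ) : Type := List (Fin (r+1) × Fin (t+1))

def OKP (P : PL r t) : Prop := P.Pairwise (fun p q => p.1 ≠ q.1 ∧ p.2 ≠ q.2)

def wP (P : PL r t) : Perm (PX r t) := (P.map fun p => swap (uu p.1) (vv p.2)).prod

def EP (d : WBC R A (r+1) (t+1)) (P : PL r t) : A := (P.map fun p => EE d p.1 p.2).prod

lemma OKP.eq_of {P : PL r t} (h : OKP P) {p q : Fin (r+1) × Fin (t+1)} (hp : p ∈ P) (hq : q ∈ P)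
    (hne : p ≠ q) : p.1 ≠ q.1 ∧ p.2 ≠ q.2 := by
  have : Std.Symm (fun p q : Fin (r+1) × Fin (t+1) => p.1 ≠ q.1 ∧ p.2 ≠ q.2) :=
    ⟨fun _ _ h => ⟨h.1.symm, h.2.symm⟩⟩
  exact List.Pairwise.forall h hp hq hne

lemma OKP.fst {P : PL r t} (h : OKP P) {i i' : Fin (r+1)} {j j' : Fin (t+1)} (hp : (i,j) ∈ P)
    (hq : (i',j') ∈ P) : i = i' ↔ j = j' := by
  by_cases hne : ((i,j) : Fin (r+1) × Fin (t+1)) = (i',j')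
  · simp at hne; simp [hne]
  · have := h.eq_of hp hq hne
    simp at this
    tauto

lemma OKP.nodup {P : PL r t} (h : OKP P) : P.Nodup :=
  List.Pairwise.imp (fun hpq h => hpq.1 (by rw [h])) h

lemma OKP.perm {P Q : PL r t} (h : OKP P) (hPQ : P.Perm Q) : OKP Q :=
  List.Perm.pairwise hPQ h (fun h => ⟨h.1.symm, h.2.symm⟩)

lemma wP_fix {P : PL r t} (x : PX r t) (h : ∀ p ∈ P, x ≠ uu p.1 ∧ x ≠ vv p.2) : wP P x = x := by
  induction P with
  | nil => rfl
  | cons p P ih =>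
    have h1 : wP (p :: P) = swap (uu p.1) (vv p.2) * wP P := by simp [wP]
    rw [h1, Perm.mul_apply, ih (fun q hq => h q (List.mem_cons_of_mem _ hq))]
    have := h p List.mem_cons_self
    exact swap_apply_of_ne_of_ne this.1 this.2

lemma wP_mem {P : PL r t} (hP : OKP P) {p} (hp : p ∈ P) :
    wP P (uu p.1) = vv p.2 ∧ wP P (vv p.2) = uu p.1 := by
  induction P with
  | nil => simp at hp
  | cons q P ih =>
    have h1 : wP (q :: P) = swap (uu q.1) (vv q.2) * wP P := by simp [wP]
    have hP' := List.pairwise_cons.1 hP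
    rw [h1, Perm.mul_apply, Perm.mul_apply]
    rcases List.mem_cons.1 hp with rfl | hp'
    · rw [wP_fix (P := P) (uu p.1), wP_fix (P := P) (vv p.2)]
      · exact ⟨swap_apply_left _ _, swap_apply_right _ _⟩
      · intro q hq
        exact ⟨vv_ne_uu _ _, fun h => (hP'.1 q hq).2 (vv_inj.1 h)⟩
      · intro q hq
        exact ⟨fun h => (hP'.1 q hq).1 (uu_inj.1 h), uu_ne_vv _ _⟩
    · obtain ⟨h2, h3⟩ := ih hP'.2 hp'
      rw [h2, h3]
      have := hP'.1 p hp'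
      constructor
      · exact swap_apply_of_ne_of_ne (vv_ne_uu _ _) (fun h => this.2 (vv_inj.1 h).symm)
      · exact swap_apply_of_ne_of_ne (fun h => this.1 (uu_inj.1 h).symm) (uu_ne_vv _ _)

lemma wP_u {P : PL r t} (hP : OKP P) {i j} (hp : (i,j) ∈ P) : wP P (uu i) = vv j := (wP_mem hP hp).1
lemma wP_v {P : PL r t} (hP : OKP P) {i j} (hp : (i,j) ∈ P) : wP P (vv j) = uu i := (wP_mem hP hp).2
lemma wP_nu {P : PL r t} {i} (hp : ∀ j, (i,j) ∉ P) : wP P (uu i) = uu i :=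
  wP_fix _ (fun p hp' => ⟨fun h => hp p.2 (by rw [uu_inj.1 h]; exact hp'), uu_ne_vv _ _⟩)
lemma wP_nv {P : PL r t} {j} (hp : ∀ i, (i,j) ∉ P) : wP P (vv j) = vv j :=
  wP_fix _ (fun p hp' => ⟨vv_ne_uu _ _, fun h => hp p.1 (by rw [vv_inj.1 h]; exact hp')⟩)

lemma wP_u_vv {P : PL r t} (hP : OKP P) {i j} (h : wP P (uu i) = vv j) : (i,j) ∈ P := by
  by_cases h1 : ∃ j', (i,j') ∈ P
  · obtain ⟨j', h1⟩ := h1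
    rw [wP_u hP h1] at h
    rw [← vv_inj.1 h]; exact h1
  · push Not at h1
    rw [wP_nu h1] at h
    exact absurd h (uu_ne_vv _ _)

lemma wP_v_uu {P : PL r t} (hP : OKP P) {i j} (h : wP P (vv j) = uu i) : (i,j) ∈ P := by
  by_cases h1 : ∃ i', (i',j) ∈ P
  · obtain ⟨i', h1⟩ := h1
    rw [wP_v hP h1] at h
    rw [← uu_inj.1 h]; exact h1
  · push Not at h1
    rw [wP_nv h1] at h
    exact absurd h (vv_ne_uu _ _)

lemma swap_comm_swap {X : Type} [DecidableEq X] {a b c e : X} (h1 : a ≠ c) (h2 : a ≠ e)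
    (h3 : b ≠ c) (h4 : b ≠ e) : Commute (swap a b) (swap c e) := by
  show swap a b * swap c e = swap c e * swap a b
  rw [mul_swap_eq_swap_mul, swap_apply_of_ne_of_ne h1.symm h3.symm,
    swap_apply_of_ne_of_ne h2.symm h4.symm]

lemma wP_perm {P Q : PL r t} (hP : OKP P) (h : P.Perm Q) : wP P = wP Q := by
  apply List.Perm.prod_eq' (h.map _)
  rw [List.pairwise_map]
  refine List.Pairwise.imp (fun {p q} hpq => ?_) hP
  apply swap_comm_swap
  · exact fun h => hpq.1 (uu_inj.1 h)
  · exact uu_ne_vv _ _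
  · exact vv_ne_uu _ _
  · exact fun h => hpq.2 (vv_inj.1 h)

variable (d : WBC R A (r+1) (t+1))

lemma EP_cons (p) (P : PL r t) : EP d (p :: P) = EE d p.1 p.2 * EP d P := by simp [EP]

lemma EP_perm {P Q : PL r t} (hP : OKP P) (h : P.Perm Q) : EP d P = EP d Q := by
  apply List.Perm.prod_eq' (h.map _)
  rw [List.pairwise_map]
  refine List.Pairwise.imp (fun {p q} hpq => ?_) hP
  exact EE_comm d hpq.1 hpq.2

lemma EP_front {P : PL r t} (hP : OKP P) {i j} (h : (i,j) ∈ P) :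
    EP d P = EE d i j * EP d (P.erase (i,j)) := by
  rw [EP_perm d hP (List.perm_cons_erase h), EP_cons]

lemma EP_back {P : PL r t} (hP : OKP P) {p} (h : p ∈ P) :
    EP d P = EP d (P.erase p) * EE d p.1 p.2 := by
  rw [EP_perm d hP ((List.perm_cons_erase h).trans (List.perm_append_singleton _ _).symm)]
  simp [EP]

lemma EP_swap {P : PL r t} (hP : OKP P) {i j i' j'} (h : (i,j) ∈ P) (h' : (i',j') ∈ P)
    (hi : i ≠ i') (hj : j ≠ j') : EP d P * T d (swap i i') (swap j j') = EP d P := by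
  have h1 : OKP (P.erase (i',j')) := List.Pairwise.sublist List.erase_sublist hP
  have h2 : (i,j) ∈ P.erase (i',j') := by
    rw [hP.nodup.mem_erase_iff]
    exact ⟨by simp [hi], h⟩
  rw [EP_back d hP h', EP_back d h1 h2]
  simp only [mul_assoc]
  rw [← mul_assoc (EE d i j), EE_EE_T d hi hj]

lemma EP_stab {P : PL r t} (hP : OKP P) : ∀ (n : ℕ) (G : Perm (Fin (r+1))) (k : Perm (Fin (t+1))),
    G.support.card ≤ n → (∀ i, (∀ j, (i,j) ∉ P) → G i = i) → (∀ j, (∀ i, (i,j) ∉ P) → k j = j) →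
    (∀ i j, (i,j) ∈ P → (G i, k j) ∈ P) → EP d P * T d G k = EP d P := by
  intro n
  induction n with
  | zero =>
    intro G k hG h1 h2 h3
    have hG1 : G = 1 := by
      rw [← Perm.card_support_eq_zero]; omega
    subst hG1
    have hk : k = 1 := by
      ext j : 1
      by_cases hj : ∃ i, (i,j) ∈ P
      · obtain ⟨i, hi⟩ := hj
        have := h3 i j hi
        exact ((hP.fst hi this).1 rfl).symm
      · push Not at hj
        exact h2 j hj
    rw [hk, T_one, mul_one]
  | succ n ih =>
    intro G k hG h1 h2 h3
    by_cases hG0 : G.support.card = 0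
    · have hG1 : G = 1 := by
        rw [← Perm.card_support_eq_zero]; omega
      exact ih G k (by omega) h1 h2 h3
    have : ∃ i, G i ≠ i := by
      by_contra hcon
      push Not at hcon
      apply hG0
      rw [Perm.card_support_eq_zero]
      ext i : 1; exact hcon i
    obtain ⟨i, hi⟩ := this
    have : ∃ j, (i,j) ∈ P := by
      by_contra hcon
      push Not at hcon
      exact hi (h1 i hcon)
    obtain ⟨j, hij⟩ := this
    have hij' := h3 i j hij
    have hj : k j ≠ j := fun h => hi ((hP.fst hij' hij).2 h)
    have e1 : T d G k = T d (swap i (G i)) (swap j (k j)) *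
        T d (swap i (G i) * G) (swap j (k j) * k) := by
      rw [T_mul, ← mul_assoc, ← mul_assoc, swap_mul_self, swap_mul_self, one_mul, one_mul]
    rw [e1, ← mul_assoc, EP_swap d hP hij hij' hi.symm hj.symm]
    apply ih
    · have := Perm.card_support_swap_mul hi
      omega
    · intro a ha
      rw [Perm.mul_apply, h1 a ha]
      apply swap_apply_of_ne_of_ne
      · rintro rfl; exact ha _ hij
      · rintro rfl; exact ha _ hij'
    · intro b hb
      rw [Perm.mul_apply, h2 b hb]
      apply swap_apply_of_ne_of_ne
      · rintro rfl; exact hb _ hij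
      · rintro rfl; exact hb _ hij'
    · intro a b hab
      rw [Perm.mul_apply, Perm.mul_apply]
      have hab' := h3 a b hab
      by_cases q1 : G a = i
      · have q2 := (hP.fst hab' hij).1 q1
        rw [q1, q2, swap_apply_left, swap_apply_left]; exact hij'
      by_cases q2 : G a = G i
      · have q3 := (hP.fst hab' hij').1 q2
        rw [q2, q3, swap_apply_right, swap_apply_right]; exact hij
      rw [swap_apply_of_ne_of_ne q1 q2, swap_apply_of_ne_of_ne]
      · exact hab'
      · exact fun h => q1 ((hP.fst hab' hij).2 h)
      · exact fun h => q2 ((hP.fst hab' hij').2 h)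

/-- `a` is the diagram basis element attached to the permutation `w`. -/
def Rep (w : Perm (PX r t)) (a : A) : Prop :=
  ∃ (P : PL r t) (g : Perm (Fin (r+1))) (h : Perm (Fin (t+1))), OKP P ∧
    w = (gr h)⁻¹ * wP P * gl g ∧ a = EP d P * T d g h

lemma gri_uu (h : Perm (Fin (t+1))) (i) : (gr h : Perm (PX r t))⁻¹ (uu i) = uu i := by
  rw [← map_inv]; rfl
lemma gri_vv (h : Perm (Fin (t+1))) (j) : (gr h : Perm (PX r t))⁻¹ (vv j) = vv (h⁻¹ j) := by
  rw [← map_inv]; rfl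

lemma rep_v {P : PL r t} (hP : OKP P) {g : Perm (Fin (r+1))} {h : Perm (Fin (t+1))} {i j}
    (hp : (i,j) ∈ P) : ((gr h)⁻¹ * wP P * gl g : Perm (PX r t)) (vv j) = uu i := by
  rw [Perm.mul_apply, Perm.mul_apply, gl_vv, wP_v hP hp, gri_uu]

lemma rep_nv {P : PL r t} {g : Perm (Fin (r+1))} {h : Perm (Fin (t+1))} {j}
    (hp : ∀ i, (i,j) ∉ P) :
    ((gr h)⁻¹ * wP P * gl g : Perm (PX r t)) (vv j) = vv (h⁻¹ j) := by
  rw [Perm.mul_apply, Perm.mul_apply, gl_vv, wP_nv hp, gri_vv]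

lemma rep_iff {P : PL r t} (hP : OKP P) {g : Perm (Fin (r+1))} {h : Perm (Fin (t+1))} {i j} :
    ((gr h)⁻¹ * wP P * gl g : Perm (PX r t)) (vv j) = uu i ↔ (i,j) ∈ P := by
  constructor
  · intro h1
    by_cases h2 : ∃ i', (i',j) ∈ P
    · obtain ⟨i', h2⟩ := h2
      rw [rep_v hP h2] at h1
      rw [← uu_inj.1 h1]; exact h2
    · push Not at h2
      rw [rep_nv h2] at h1
      exact absurd h1 (vv_ne_uu _ _)
  · exact fun h => rep_v hP h

lemma Rep.unique {w : Perm (PX r t)} {a a1 : A} (H : Rep d w a) (H1 : Rep d w a1) : a = a1 := by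
  obtain ⟨P, g, h, hP, rfl, rfl⟩ := H
  obtain ⟨P1, g1, h1, hP1, hw, rfl⟩ := H1
  have hperm : P.Perm P1 := by
    rw [List.perm_ext_iff_of_nodup hP.nodup hP1.nodup]
    rintro ⟨i, j⟩
    rw [← rep_iff hP (g := g) (h := h), hw, rep_iff hP1]
  rw [← wP_perm hP hperm] at hw
  rw [← EP_perm d hP hperm]
  have e1 : T d g h = T d (g * g1⁻¹) (h * h1⁻¹) * T d g1 h1 := by
    rw [T_mul, inv_mul_cancel_right, inv_mul_cancel_right]
  rw [e1, ← mul_assoc]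
  congr 1
  have hw' : wP P * gl (g * g1⁻¹) = gr (h * h1⁻¹) * wP P := by
    rw [map_mul, map_mul, map_inv, map_inv]
    have := congrArg (fun x => gr h * x * (gl g1)⁻¹) hw
    simp only [mul_assoc, mul_inv_cancel_left, mul_inv_cancel, mul_one] at this
    rw [this, mul_assoc]
  apply EP_stab d hP _ _ _ le_rfl
  · intro i hi
    have := congrArg (fun x : Perm (PX r t) => x (uu i)) hw'
    simp only [Perm.mul_apply, gl_uu] at this
    rw [wP_nu hi, gr_uu] at this
    by_cases hx : ∃ j, ((g * g1⁻¹) i, j) ∈ P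
    · obtain ⟨j, hx⟩ := hx
      simp only [Perm.mul_apply] at hx
      rw [wP_u hP hx] at this
      exact absurd this (vv_ne_uu _ _)
    · push Not at hx
      simp only [Perm.mul_apply] at hx
      rw [wP_nu hx] at this
      exact uu_inj.1 this
  · intro j hj
    have := congrArg (fun x : Perm (PX r t) => x (vv j)) hw'
    simp only [Perm.mul_apply, gl_vv] at this
    rw [wP_nv hj, gr_vv] at this
    exact (vv_inj.1 this).symm
  · intro i j hij
    have := congrArg (fun x : Perm (PX r t) => x (uu i)) hw'
    simp only [Perm.mul_apply, gl_uu] at this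
    rw [wP_u hP hij, gr_vv] at this
    exact wP_u_vv hP this

lemma Rep.one : Rep d (1 : Perm (PX r t)) 1 :=
  ⟨[], 1, 1, List.Pairwise.nil, by simp [wP], by simp [EP, T_one]⟩

lemma map_OKP {P : PL r t} (hP : OKP P) (b : Perm (Fin (r+1))) (b' : Perm (Fin (t+1))) :
    OKP (P.map (Prod.map b b')) := by
  rw [OKP, List.pairwise_map]
  exact List.Pairwise.imp (fun hpq => ⟨fun h => hpq.1 (b.injective h),
    fun h => hpq.2 (b'.injective h)⟩) hP

lemma T_EP (b : Perm (Fin (r+1))) (b' : Perm (Fin (t+1))) (P : PL r t) :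
    T d b b' * EP d P = EP d (P.map (Prod.map b b')) * T d b b' := by
  induction P with
  | nil => simp [EP]
  | cons p P ih =>
    rw [List.map_cons, EP_cons, EP_cons, ← mul_assoc, T_EE, mul_assoc, ih, mul_assoc]; rfl

lemma gl_wP (b : Perm (Fin (r+1))) (b' : Perm (Fin (t+1))) (P : PL r t) :
    gl b * gr b' * wP P = wP (P.map (Prod.map b b')) * (gl b * gr b') := by
  induction P with
  | nil => simp [wP]
  | cons p P ih =>
    have h1 : ∀ q (Q : PL r t), wP (q :: Q) = swap (uu q.1) (vv q.2) * wP Q := by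
      intros; simp [wP]
    rw [List.map_cons, h1, h1, ← mul_assoc, mul_swap_eq_swap_mul, mul_assoc, ih, mul_assoc]; rfl

lemma Rep.σ {w : Perm (PX r t)} {a : A} (H : Rep d w a) (b) :
    Rep d (gl b * w) (d.σ b * a) := by
  obtain ⟨P, g, h, hP, rfl, rfl⟩ := H
  refine ⟨P.map (Prod.map b (1 : Perm (Fin (t+1)))), b * g, h, map_OKP hP b 1, ?_, ?_⟩
  · have := gl_wP b 1 P
    rw [map_one, mul_one] at this
    rw [map_mul, ← mul_assoc, ← mul_assoc, ← map_inv, gl_gr, mul_assoc _ (gl b), this]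
    simp only [mul_assoc]
  · rw [← T_left, ← mul_assoc, T_EP, mul_assoc, T_mul, one_mul]

lemma Rep.σb {w : Perm (PX r t)} {a : A} (H : Rep d w a) (b) :
    Rep d (w * (gr b)⁻¹) (d.σb b * a) := by
  obtain ⟨P, g, h, hP, rfl, rfl⟩ := H
  refine ⟨P.map (Prod.map (1 : Perm (Fin (r+1))) b), g, b * h, map_OKP hP 1 b, ?_, ?_⟩
  · have := gl_wP 1 b P
    rw [map_one, one_mul] at this
    rw [map_mul, mul_inv_rev, mul_assoc _ (gl g), ← map_inv _ b, gl_gr, map_inv]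
    have h3 : wP P * (gr b)⁻¹ = (gr b)⁻¹ * wP (P.map (Prod.map (1 : Perm (Fin (r+1))) b)) := by
      rw [mul_inv_eq_iff_eq_mul, mul_assoc, ← this, inv_mul_cancel_left]
    simp only [mul_assoc]
    rw [← mul_assoc (wP P), h3]
    simp only [mul_assoc]
  · rw [← T_right, ← mul_assoc, T_EP, mul_assoc, T_mul, one_mul]

end Combi
end BCaux


namespace BCaux
open Equiv

section Combi2
variable {R A : Type} [CommRing R] [Ring A] [Algebra R A] {r t : ℕ}
variable (d : WBC R A (r+1) (t+1))

variable {d} in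
lemma al_T {α : A →ₐ[R] A} (hα : Par d α) (g h) : α (T d g h) = T d g h := by
  rw [T, map_mul, hα.σ, hα.σb]

variable {d} in
lemma al_EP {α : A →ₐ[R] A} (hα : Par d α) (P : PL r t) : α (EP d P) = EP d P := by
  induction P with
  | nil => simp [EP]
  | cons p P ih =>
    rw [EP_cons, map_mul, ih, EE, map_mul, map_mul, al_T hα, hα.e]

variable {d} in
lemma Rep.al {α : A →ₐ[R] A} (hα : Par d α) {w : Perm (PX r t)} {a : A} (H : Rep d w a) :
    α a = a := by
  obtain ⟨P, g, h, hP, rfl, rfl⟩ := H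
  rw [map_mul, al_EP hα, al_T hα]

lemma cb_EP {P : PL r t} {j} (hp : ∀ i, (i,j) ∉ P) : d.cb j * EP d P = EP d P * d.cb j := by
  induction P with
  | nil => simp [EP]
  | cons p P ih =>
    rw [EP_cons, ← mul_assoc, cb_EE_comm d, mul_assoc, ih, mul_assoc]
    · intro i hi; exact hp i (List.mem_cons_of_mem _ hi)
    · rintro rfl; exact hp p.1 List.mem_cons_self

variable {d} in
lemma Rep.cb {α : A →ₐ[R] A} (hα : Par d α) {w : Perm (PX r t)} {a : A} (H : Rep d w a) (j) :
    d.cb j * a = ro d α (w (vv j)) a := by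
  have hal := H.al hα
  obtain ⟨P, g, h, hP, rfl, rfl⟩ := H
  by_cases hx : ∃ i, (i,j) ∈ P
  · obtain ⟨i, hx⟩ := hx
    rw [rep_v hP hx, ro_u, EP_front d hP hx, ← mul_assoc, ← mul_assoc, ← mul_assoc, ← mul_assoc,
      c_EE]
  · push Not at hx
    rw [rep_nv hx, ro_v, hal, ← mul_assoc, cb_EP d hx, mul_assoc, mul_assoc, T_cb,
      show h (h⁻¹ j) = j from h.apply_symm_apply j]

variable {d} in
lemma Rep.e_zero {w : Perm (PX r t)} {a : A} (H : Rep d w a) (hw : w (vv 0) = uu 0) :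
    d.e * a = 0 ∧ d.e * (d.c 0 * a) = 0 := by
  obtain ⟨P, g, h, hP, rfl, rfl⟩ := H
  rw [rep_iff hP] at hw
  rw [EP_front d hP hw, ← EE_zero]
  constructor
  · rw [← mul_assoc, ← mul_assoc, EE_sq, zero_mul, zero_mul]
  · rw [← mul_assoc, ← mul_assoc, ← mul_assoc, EE_c_EE, zero_mul, zero_mul]

variable {d} in
lemma Rep.e_ne {w : Perm (PX r t)} {a : A} (H : Rep d w a) (hw : w (vv 0) ≠ uu 0) :
    Rep d (swap (uu 0) (w (vv 0)) * w) (d.e * a) := by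
  have H0 := H
  obtain ⟨P, g, h, hP, hw', rfl⟩ := H
  have h00 : ((0,0) : Fin (r+1) × Fin (t+1)) ∉ P := by
    intro hcon; apply hw; rw [hw']; exact rep_v hP hcon
  by_cases h1 : ∃ i, (i,(0 : Fin (t+1))) ∈ P
  · obtain ⟨i, h1⟩ := h1
    have hi : 0 ≠ i := by rintro rfl; exact h00 h1
    have e1 : w (vv 0) = uu i := by rw [hw']; exact rep_v hP h1
    have := H0.σ d (swap 0 i)
    rw [gl_swap] at this
    rw [e1]
    convert this using 1
    rw [EP_front d hP h1, ← EE_zero, ← mul_assoc, ← mul_assoc, ← mul_assoc, ← mul_assoc,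
      EE_EE_right d 0 hi]
  push Not at h1
  have e1 : w (vv 0) = vv (h⁻¹ 0) := by rw [hw']; exact rep_nv h1
  by_cases h2 : ∃ j, ((0 : Fin (r+1)), j) ∈ P
  · obtain ⟨j, h2⟩ := h2
    have hj : 0 ≠ j := by rintro rfl; exact h00 h2
    have e2 : w (vv j) = uu 0 := by rw [hw']; exact rep_v hP h2
    have := H0.σb d (swap 0 j)
    rw [swapinv, mul_swap_eq_swap_mul, e2, swap_comm] at this
    convert this using 1
    rw [EP_front d hP h2, ← EE_zero, ← mul_assoc, ← mul_assoc, ← mul_assoc, ← mul_assoc,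
      EE_EE_left d 0 hj]
  push Not at h2
  refine ⟨(0,0) :: P, g, h, ?_, ?_, ?_⟩
  · refine List.pairwise_cons.2 ⟨?_, hP⟩
    rintro ⟨i, j⟩ hij
    constructor
    · rintro rfl; exact h2 _ hij
    · rintro rfl; exact h1 _ hij
  · rw [e1, hw']
    have h3 : wP ((0,0) :: P) = swap (uu 0) (vv 0) * wP P := by simp [wP]
    rw [h3]
    simp only [← mul_assoc]
    rw [mul_swap_eq_swap_mul, gri_uu, gri_vv]
  · rw [EP_cons, EE_zero, mul_assoc]

end Combi2

section Final
variable {R A : Type} [CommRing R] [Ring A] [Algebra R A] {r t : ℕ}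
variable {d : WBC R A (r+1) (t+1)} {α : A →ₐ[R] A}

def PP (hα : Par d α) : Submodule R (MM R r t × A) :=
  Submodule.span R {p | ∃ w m a, Rep d w a ∧ p = (Finsupp.single w m, rho hα m a)}

def Good (hα : Par d α) (f : Module.End R (MM R r t)) (x : A) : Prop :=
  ∀ p ∈ PP hα, (f p.1, x * p.2) ∈ PP hα

lemma good_of (hα : Par d α) (f : Module.End R (MM R r t)) (x : A)
    (h : ∀ w m a, Rep d w a → (f (Finsupp.single w m), x * rho hα m a) ∈ PP hα) :
    Good hα f x := by
  intro p hp
  have : PP hα ≤ (PP hα).comap (LinearMap.prodMap f (LinearMap.mulLeft R x)) := by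
    rw [PP, Submodule.span_le]
    rintro _ ⟨w, m, a, H, rfl⟩
    exact h w m a H
  exact this hp

lemma mem_PP (hα : Par d α) {w : Perm (PX r t)} {m a} (H : Rep d w a) :
    (Finsupp.single w m, rho hα m a) ∈ PP hα := Submodule.subset_span ⟨w, m, a, H, rfl⟩

lemma good_σ (hα : Par d α) (g) : Good hα ((WM R r t).σ g) (d.σ g) := by
  apply good_of
  intro w m a H
  show (oσ g (Finsupp.single w m), _) ∈ _
  rw [oσ_s, rho_σ]
  exact mem_PP hα (H.σ d g)

lemma good_σb (hα : Par d α) (g) : Good hα ((WM R r t).σb g) (d.σb g) := by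
  apply good_of
  intro w m a H
  show (oσb g (Finsupp.single w m), _) ∈ _
  rw [oσb_s, rho_σb]
  exact mem_PP hα (H.σb d g)

lemma good_c (hα : Par d α) (i) : Good hα ((WM R r t).c i) (d.c i) := by
  apply good_of
  intro w m a H
  show (oc i (Finsupp.single w m), _) ∈ _
  rw [oc_s, rho_c]
  exact mem_PP hα H

lemma good_cb (hα : Par d α) (j) : Good hα ((WM R r t).cb j) (d.cb j) := by
  apply good_of
  intro w m a H
  show (ocb j (Finsupp.single w m), _) ∈ _
  rw [ocb_s, rho_cb, H.cb hα, ← rho_mul_cc]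
  exact mem_PP hα H

lemma good_e (hα : Par d α) : Good hα ((WM R r t).e) d.e := by
  apply good_of
  intro w m a H
  show (oe (Finsupp.single w m), _) ∈ _
  by_cases hw : w (vv 0) = uu 0
  · rw [oe_zero hw, rho_e_zero hα (H.e_zero hw).1 (H.e_zero hw).2]
    exact zero_mem _
  · rw [oe_ne hw, rho_e_ne hα hw (H.cb hα 0)]
    exact mem_PP hα (H.e_ne hw)

lemma good_add (hα : Par d α) {f g : Module.End R (MM R r t)} {x y} (h : Good hα f x)
    (h' : Good hα g y) : Good hα (f + g) (x + y) := by
  intro p hp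
  have := add_mem (h p hp) (h' p hp)
  simpa [add_mul] using this

lemma good_mul (hα : Par d α) {f g : Module.End R (MM R r t)} {x y} (h : Good hα f x)
    (h' : Good hα g y) : Good hα (f * g) (x * y) := by
  intro p hp
  have := h _ (h' p hp)
  simpa [mul_assoc] using this

lemma good_alg (hα : Par d α) (s : R) : Good hα (algebraMap R _ s) (algebraMap R A s) := by
  intro p hp
  have := Submodule.smul_mem _ s hp
  convert this using 1
  ext : 1
  · simp [Module.algebraMap_end_apply]
  · simp [Algebra.smul_def]

lemma good_tr (hα : Par d α) {φ : A →ₐ[R] Module.End R (MM R r t)} (hφ : WBCHom d (WM R r t) φ)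
    (m : ℕ) {x : A} (hx : x ∈ SS d m) : Good hα (φ x) x := by
  induction hx using Algebra.adjoin_induction with
  | mem x hx =>
    rcases hx with ⟨h, rfl⟩ | ⟨j, h1, h2, rfl⟩ | ⟨j, h1, h2, rfl⟩ | ⟨h, rfl⟩ | ⟨h, rfl⟩
    · rw [hφ.map_e]; exact good_e hα
    · rw [WBC.s, hφ.map_σ]; exact good_σ hα _
    · rw [WBC.sb, hφ.map_σb]; exact good_σb hα _
    · have := cn_eq d 0
      simp at this
      rw [this, hφ.map_c]; exact good_c hα _
    · have := cbn_eq d 0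
      simp at this
      rw [this, hφ.map_cb]; exact good_cb hα _
  | algebraMap s => rw [AlgHom.commutes]; exact good_alg hα s
  | add x y _ _ hx hy => rw [map_add]; exact good_add hα hx hy
  | mul x y _ _ hx hy => rw [map_mul]; exact good_mul hα hx hy

open Classical in
def Dw (d : WBC R A (r+1) (t+1)) (w : Perm (PX r t)) : A :=
  if h : ∃ a, Rep d w a then h.choose else 0

lemma Dw_eq {w : Perm (PX r t)} {a} (H : Rep d w a) : Dw d w = a := by
  have h : ∃ a, Rep d w a := ⟨a, H⟩
  rw [Dw, dif_pos h]
  exact Rep.unique d h.choose_spec H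

def Psi (hα : Par d α) : MM R r t →ₗ[R] A :=
  Finsupp.lsum R (fun w => (LinearMap.applyₗ (Dw d w)) ∘ₗ (rho hα).toLinearMap)

lemma Psi_s (hα : Par d α) (w m) : Psi hα (Finsupp.single w m) = rho hα m (Dw d w) := by
  simp [Psi]

lemma PP_graph (hα : Par d α) {p} (hp : p ∈ PP hα) : Psi hα p.1 = p.2 := by
  induction hp using Submodule.span_induction with
  | mem p hp =>
    obtain ⟨w, m, a, H, rfl⟩ := hp
    rw [Psi_s, Dw_eq H]
  | zero => simp
  | add x y _ _ hx hy => simp [hx, hy]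
  | smul s x _ hx => simp [hx]

lemma inj_main (hu : d.IsUniversal) (K : Fin (r+1)) (K' : Fin (t+1)) (hK : K.val = K'.val)
    {x : A} (hx : x ∈ SS d K.val) (h0 : x * EE d K K' = 0) : x = 0 := by
  obtain ⟨α, hα⟩ := exists_par d hu
  obtain ⟨φ, hφ, -⟩ := hu (Module.End R (MM R r t)) (WM R r t)
  have h1 := φ_vac_zero d K K' hK hφ hx h0
  have h2 := good_tr hα hφ _ hx _ (mem_PP hα (m := 1) (Rep.one d))
  have h3 := PP_graph hα h2
  simp only [h1, map_zero, map_one] at h3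
  simpa using h3.symm

end Final
end BCaux

/-- Corollary 2.10: for `1 ≤ k ≤ min{r,t}` and `a ∈ ℕ` there are unique elements
`ω_{a,k}`, `ω̄_{a,k}` of the subalgebra `BC_{k-1,k-1}` (that is `R` when `k = 1`) with
`e_k y_k^a e_k = ω_{a,k} e_k` and `e_k ȳ_k^a e_k = ω̄_{a,k} e_k`; moreover
`ω_{2n,k} = ω̄_{2n,k} = 0`. -/
theorem statement3 (R A : Type) [CommRing R] [IsDomain R] [Ring A] [Algebra R A]
    (h2 : IsUnit (2 : R)) (r t : ℕ) (hr : 1 ≤ r) (ht : 1 ≤ t)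
    (d : WBC R A r t) (hu : d.IsUniversal)
    (k : ℕ) (hk1 : 1 ≤ k) (hkr : k ≤ r) (hkt : k ≤ t) :
    (∀ a : ℕ,
      (∃! ω : A, ω ∈ Algebra.adjoin R (d.lowerGens (k - 1)) ∧
        d.E k k * d.y k ^ a * d.E k k = ω * d.E k k) ∧
      (∃! ωb : A, ωb ∈ Algebra.adjoin R (d.lowerGens (k - 1)) ∧
        d.E k k * d.yb k ^ a * d.E k k = ωb * d.E k k)) ∧
    (∀ n : ℕ,
      d.E k k * d.y k ^ (2 * n) * d.E k k = 0 ∧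
      d.E k k * d.yb k ^ (2 * n) * d.E k k = 0) := by
  obtain ⟨r, rfl⟩ : ∃ r', r = r' + 1 := ⟨r - 1, by omega⟩
  obtain ⟨t, rfl⟩ : ∃ t', t = t' + 1 := ⟨t - 1, by omega⟩
  obtain ⟨κ, rfl⟩ : ∃ κ, k = κ + 1 := ⟨k - 1, by omega⟩
  have hE : d.E (κ + 1) (κ + 1) = BCaux.EE d ⟨κ, by omega⟩ ⟨κ, by omega⟩ :=
    BCaux.E_eq d ⟨κ, by omega⟩ ⟨κ, by omega⟩
  rw [hE, Nat.add_sub_cancel]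
  have huniq : ∀ x y z : A, x ∈ Algebra.adjoin R (d.lowerGens κ) →
      y ∈ Algebra.adjoin R (d.lowerGens κ) →
      z = x * BCaux.EE d ⟨κ, by omega⟩ ⟨κ, by omega⟩ →
      z = y * BCaux.EE d ⟨κ, by omega⟩ ⟨κ, by omega⟩ → x = y := by
    intro x y z hx hy h3 h4
    rw [← sub_eq_zero]
    apply BCaux.inj_main hu ⟨κ, by omega⟩ ⟨κ, by omega⟩ rfl (sub_mem hx hy)
    rw [sub_mul, ← h3, ← h4, sub_self]
  refine ⟨fun a => ⟨?_, ?_⟩, fun n => ⟨?_, ?_⟩⟩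
  · obtain ⟨ω, h3, h4⟩ := BCaux.exists_y d ⟨κ, by omega⟩ ⟨κ, by omega⟩ rfl a
    exact ⟨ω, ⟨h3, h4⟩, fun y hy => huniq _ _ _ hy.1 h3 hy.2 h4⟩
  · obtain ⟨ω, h3, h4⟩ := BCaux.exists_yb d ⟨κ, by omega⟩ ⟨κ, by omega⟩ rfl a
    exact ⟨ω, ⟨h3, h4⟩, fun y hy => huniq _ _ _ hy.1 h3 hy.2 h4⟩
  · exact BCaux.vanish_y d ⟨κ, by omega⟩ ⟨κ, by omega⟩ rfl h2 n
  · exact BCaux.vanish_yb d ⟨κ, by omega⟩ ⟨κ, by omega⟩ rfl h2 n
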